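/- arXiv:1106.1883 — 5 statements merged into one kernel-verified Lean document; each statement's English description precedes it below -/
import Mathlib

section
/- There exists a finite pointed ruleset Γ ⊆ ℤ³ such that the unique set 𝒫 ⊆ ℕ³ satisfying the P-position property for Γ does not admit an affine stratification; that is, 𝒫 is not a finite union of sets of the form w + Λ with w ∈ ℤ³ and Λ a finitely generated additive submonoid of ℤ³. -/
/-- The board ℕ³, viewed inside ℤ³. -/
def board3 : Set (ℤ × ℤ × ℤ) := {p | 0 ≤ p.1 ∧ 0 ≤ p.2.1 ∧ 0 ≤ p.2.2}

/-- `P ⊆ ℕ³` satisfies the P-position property for the ruleset `Γ`. -/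
def PPosProperty (Γ : Finset (ℤ × ℤ × ℤ)) (P : Set (ℤ × ℤ × ℤ)) : Prop :=
  P ⊆ board3 ∧ ∀ p ∈ board3, (p ∈ P ↔ ∀ γ ∈ Γ, p - γ ∈ board3 → p - γ ∉ P)

/-- A ruleset `Γ ⊆ ℤ³` is pointed. -/
def PointedRuleset (Γ : Finset (ℤ × ℤ × ℤ)) : Prop :=
  ∃ φ : (ℤ × ℤ × ℤ) →ₗ[ℤ] ℤ,
    (∀ γ ∈ Γ, 0 < φ γ) ∧ 0 < φ (1, 0, 0) ∧ 0 < φ (0, 1, 0) ∧ 0 < φ (0, 0, 1)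

/-- `T ⊆ ℤ³` admits an affine stratification: it is a finite union of sets
`w + Λ` with `Λ` a finitely generated additive submonoid of `ℤ³`. -/
def HasAffineStratification (T : Set (ℤ × ℤ × ℤ)) : Prop :=
  ∃ (k : ℕ) (w : Fin k → ℤ × ℤ × ℤ) (Λ : Fin k → AddSubmonoid (ℤ × ℤ × ℤ)),
    (∀ t, (Λ t).FG) ∧ T = ⋃ t, (fun x => w t + x) '' (Λ t : Set (ℤ × ℤ × ℤ))

/-- Value on an even row, in terms of the residue `r` of `x` modulo `2q`, `q = 2 ^ y`. -/
def evenVal (r q : ℕ) : ℕ :=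
  if r % 3 = 0 then 0 else if r % 3 = 1 then (if r < q then 4 else 2) else 1

/-- Value on an odd row. -/
def oddVal (x r q : ℕ) : ℕ :=
  if r % 3 = 0 then (if r = 0 ∧ 0 < x then 3 else 1)
  else if r % 3 = 1 then 0 else (if r < q then 2 else 4)

/-- The phase modulo 7 of the column above `(x, y)`. -/
def phase (x y : ℕ) : ℕ :=
  if y % 2 = 0 then evenVal (x % (2 * 2 ^ y)) (2 ^ y) else oddVal x (x % (2 * 2 ^ y)) (2 ^ y)

/-- Residue `z` is blocked by the neighbouring columns. -/
def Blocked (x y z : ℕ) : Prop :=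
  (0 < x ∧ (z % 7 = phase (x - 1) y ∨ (z + 6) % 7 = phase (x - 1) y ∨
    (z + 4) % 7 = phase (x - 1) y)) ∨
  (0 < y ∧ (z % 7 = phase x (y - 1) ∨ (z + 5) % 7 = phase x (y - 1)))

lemma pow_mod_three (y : ℕ) : (y % 2 = 0 → 2 ^ y % 3 = 1) ∧ (y % 2 = 1 → 2 ^ y % 3 = 2) := by
  induction y with
  | zero => simp
  | succ n ih => rw [pow_succ]; omega

lemma pred_mod (x n : ℕ) (hx : 0 < x) (hn : 0 < n) :
    (0 < x % n ∧ (x - 1) % n = x % n - 1) ∨ (x % n = 0 ∧ (x - 1) % n = n - 1) := by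
  obtain ⟨k, hk⟩ : ∃ k, n * k + x % n = x := ⟨x / n, Nat.div_add_mod x n⟩
  have hlt := Nat.mod_lt x hn
  rcases Nat.eq_zero_or_pos (x % n) with h | h
  · right
    refine ⟨h, ?_⟩
    rw [h] at hk
    cases k with
    | zero => simp at hk; omega
    | succ j =>
      have : x - 1 = (n - 1) + n * j := by rw [← hk, mul_add]; omega
      rw [this, Nat.add_mul_mod_self_left, Nat.mod_eq_of_lt (by omega)]
  · left
    refine ⟨h, ?_⟩
    have : x - 1 = (x % n - 1) + n * k := by omega
    rw [this, Nat.add_mul_mod_self_left, Nat.mod_eq_of_lt (by omega)]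

lemma half_mod (x q : ℕ) (hq : 0 < q) :
    (x % (2 * q) < q ∧ x % q = x % (2 * q)) ∨ (q ≤ x % (2 * q) ∧ x % q = x % (2 * q) - q) := by
  have h1 : x % (2 * q) % q = x % q := Nat.mod_mod_of_dvd x ⟨2, by ring⟩
  have hlt := Nat.mod_lt x (show 0 < 2 * q by omega)
  rcases lt_or_ge (x % (2 * q)) q with h | h
  · left; exact ⟨h, by rw [← h1, Nat.mod_eq_of_lt h]⟩
  · right
    refine ⟨h, ?_⟩
    rw [← h1, Nat.mod_eq_sub_mod h, Nat.mod_eq_of_lt (by omega)]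

lemma phase_le (x y : ℕ) : phase x y ≤ 4 := by
  unfold phase evenVal oddVal
  split_ifs <;> omega

set_option maxHeartbeats 4000000 in
lemma phase_mex (x y z : ℕ) :
    (z % 7 = phase x y → ¬ Blocked x y z) ∧ (z % 7 < phase x y → Blocked x y z) := by
  have hq : 0 < 2 ^ y := by positivity
  have hx := fun h => pred_mod x (2 * 2 ^ y) h (by omega)
  have hlt := Nat.mod_lt x (show 0 < 2 * 2 ^ y by omega)
  have h3 := pow_mod_three y
  have hz : z % 7 < 7 := Nat.mod_lt _ (by norm_num)
  have hz6 : (z + 6) % 7 = (z % 7 + 6) % 7 := by omega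
  have hz5 : (z + 5) % 7 = (z % 7 + 5) % 7 := by omega
  have hz4 : (z + 4) % 7 = (z % 7 + 4) % 7 := by omega
  unfold Blocked
  rw [hz6, hz5, hz4]
  generalize z % 7 = t at *
  cases y with
  | zero =>
    simp only [phase, evenVal, oddVal, pow_zero] at *
    simp only [lt_irrefl, false_and, or_false]
    rcases Nat.eq_zero_or_pos x with h | h
    · subst h; simp
    · have := hx h
      generalize (x - 1) % (2 * 1) = r' at *
      generalize x % (2 * 1) = r at *
      split_ifs <;> omega
  | succ n =>
    have hh := half_mod x (2 ^ (n + 1)) hq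
    have hx0 : x = 0 → x % (2 * 2 ^ (n + 1)) = 0 ∧ x % 2 ^ (n + 1) = 0 := by
      rintro rfl; simp
    have e : 2 ^ (n + 1) = 2 * 2 ^ n := by ring
    simp only [Nat.add_sub_cancel, phase, ← e]
    have hq2 : 2 ^ (n + 1) = 2 * 2 ^ n := e
    generalize 2 ^ (n + 1) = q at *
    generalize 2 ^ n = q' at *
    generalize x % (2 * q) = r at *
    generalize x % q = s at *
    generalize (x - 1) % (2 * q) = r' at *
    rcases Nat.mod_two_eq_zero_or_one n with hn | hn
    · have h1 : (n + 1) % 2 = 1 := by omega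
      have h4 := h3.2 h1
      clear h3
      simp only [h1, hn, evenVal, oddVal, one_ne_zero, if_true, if_false]
      rcases Nat.eq_zero_or_pos x with h | h
      · have h0 := hx0 h
        simp only [h, h0.1, h0.2]
        simp
        try omega
      · have h5 := hx h
        clear hx hx0
        rcases hh with hh | hh <;> rcases h5 with h5 | h5 <;> split_ifs <;>
          first
          | (exfalso; clear hz hz4 hz5 hz6; omega)
          | (clear hh h5 h4 hlt; omega)
    · have h1 : (n + 1) % 2 = 0 := by omega
      have h4 := h3.1 h1
      clear h3
      simp only [h1, hn, evenVal, oddVal, one_ne_zero, if_true, if_false]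
      rcases Nat.eq_zero_or_pos x with h | h
      · have h0 := hx0 h
        simp only [h, h0.1, h0.2]
        simp
        try omega
      · have h5 := hx h
        clear hx hx0
        rcases hh with hh | hh <;> rcases h5 with h5 | h5 <;> split_ifs <;>
          first
          | (exfalso; clear hz hz4 hz5 hz6; omega)
          | (clear hh h5 h4 hlt; omega)

lemma column_step (Q : ℕ → ℕ → ℕ → Prop)
    (hQ : ∀ x y z, Q x y z ↔ (∀ k, 1 ≤ k → k ≤ 6 → k ≤ z → ¬ Q x y (z - k)) ∧
      (0 < x → ¬ Q (x - 1) y z ∧ ¬ Q (x - 1) y (z + 6) ∧ ¬ Q (x - 1) y (z + 4)) ∧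
      (0 < y → ¬ Q x (y - 1) z ∧ ¬ Q x (y - 1) (z + 5))) :
    ∀ n x y, x + y = n → ∀ z, Q x y z ↔ z % 7 = phase x y := by
  intro n
  induction n using Nat.strong_induction_on with
  | _ n ihn =>
  intro x y hxy z
  induction z using Nat.strong_induction_on with
  | _ z ihz =>
  have hB : ((0 < x → ¬ Q (x - 1) y z ∧ ¬ Q (x - 1) y (z + 6) ∧ ¬ Q (x - 1) y (z + 4)) ∧
      (0 < y → ¬ Q x (y - 1) z ∧ ¬ Q x (y - 1) (z + 5))) ↔ ¬ Blocked x y z := by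
    unfold Blocked
    have h1 : 0 < x → ∀ z, Q (x - 1) y z ↔ z % 7 = phase (x - 1) y :=
      fun h => ihn (n - 1) (by omega) _ _ (by omega)
    have h2 : 0 < y → ∀ z, Q x (y - 1) z ↔ z % 7 = phase x (y - 1) :=
      fun h => ihn (n - 1) (by omega) _ _ (by omega)
    rcases Nat.eq_zero_or_pos x with hx | hx <;> rcases Nat.eq_zero_or_pos y with hy | hy
    · simp [hx, hy]
    · have := h2 hy
      simp only [this]; simp [hx]
    · have := h1 hx
      simp only [this]; simp [hy]
    · have h1 := h1 hx
      have h2 := h2 hy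
      simp only [h1, h2, hx, hy]; tauto
  rw [hQ, hB]
  have hm := phase_mex x y z
  have hle := phase_le x y
  constructor
  · rintro ⟨h1, h2⟩
    by_contra hne
    have hge : ¬ z % 7 < phase x y := fun h => h2 (hm.2 h)
    refine h1 (z % 7 - phase x y) (by omega) (by omega) (by omega) ?_
    rw [ihz _ (by omega)]
    omega
  · intro h
    refine ⟨fun k hk1 hk2 hk3 hk => ?_, hm.1 h⟩
    rw [ihz _ (by omega)] at hk
    omega

/-- The ruleset. -/
def ruleset7 : Finset (ℤ × ℤ × ℤ) :=
  {(0, 0, 1), (0, 0, 2), (0, 0, 3), (0, 0, 4), (0, 0, 5), (0, 0, 6),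
    (1, 0, 0), (1, 0, -6), (1, 0, -4), (0, 1, 0), (0, 1, -5)}

lemma ruleset7_pointed : PointedRuleset ruleset7 := by
  refine ⟨10 • LinearMap.fst ℤ ℤ (ℤ × ℤ) +
    10 • (LinearMap.fst ℤ ℤ ℤ ∘ₗ LinearMap.snd ℤ ℤ (ℤ × ℤ)) +
    (LinearMap.snd ℤ ℤ ℤ ∘ₗ LinearMap.snd ℤ ℤ (ℤ × ℤ)), ?_, ?_, ?_, ?_⟩
  · intro γ hγ
    simp only [ruleset7, Finset.mem_insert, Finset.mem_singleton] at hγ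
    rcases hγ with h | h | h | h | h | h | h | h | h | h | h <;> subst h <;> simp
  all_goals simp

lemma P_iff (P : Set (ℤ × ℤ × ℤ)) (hP : PPosProperty ruleset7 P) (x y z : ℕ) :
    ((x : ℤ), (y : ℤ), (z : ℤ)) ∈ P ↔ z % 7 = phase x y := by
  refine column_step (fun x y z => ((x : ℤ), (y : ℤ), (z : ℤ)) ∈ P) ?_ (x + y) x y rfl z
  clear x y z
  intro x y z
  have hb : ((x : ℤ), (y : ℤ), (z : ℤ)) ∈ board3 := by simp [board3]
  have := hP.2 _ hb
  rw [this]
  simp only [ruleset7, Finset.mem_insert, Finset.mem_singleton, forall_eq_or_imp, forall_eq,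
    Prod.mk_sub_mk, board3, Set.mem_ofPred_eq, sub_zero, sub_neg_eq_add]
  have key : ∀ k : ℕ, k ≤ z → ((z - k : ℕ) : ℤ) = (z : ℤ) - k := fun k hk => by omega
  constructor
  · rintro ⟨h1, h2, h3, h4, h5, h6, h7, h8, h9, h10, h11⟩
    refine ⟨fun k hk1 hk6 hkz => ?_, fun hx => ?_, fun hy => ?_⟩
    · rw [key k hkz]
      interval_cases k
      · exact h1 (by omega)
      · exact h2 (by omega)
      · exact h3 (by omega)
      · exact h4 (by omega)
      · exact h5 (by omega)
      · exact h6 (by omega)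
    · push_cast [Nat.cast_sub (show 1 ≤ x from hx)]
      exact ⟨h7 (by omega), h8 (by omega), h9 (by omega)⟩
    · push_cast [Nat.cast_sub (show 1 ≤ y from hy)]
      exact ⟨h10 (by omega), h11 (by omega)⟩
  · rintro ⟨h1, h2, h3⟩
    have hk : ∀ k : ℕ, 1 ≤ k → k ≤ 6 → (0 ≤ (z : ℤ) - k) →
        ((x : ℤ), (y : ℤ), (z : ℤ) - k) ∉ P := by
      intro k hk1 hk6 hkz
      have := h1 k hk1 hk6 (by omega)
      rwa [key k (by omega)] at this
    have hx : (0 ≤ (x : ℤ) - 1) → ((x : ℤ) - 1, (y : ℤ), (z : ℤ)) ∉ P ∧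
        ((x : ℤ) - 1, (y : ℤ), (z : ℤ) + 6) ∉ P ∧ ((x : ℤ) - 1, (y : ℤ), (z : ℤ) + 4) ∉ P := by
      intro h
      have hx : 1 ≤ x := by omega
      have := h2 (by omega)
      push_cast [Nat.cast_sub hx] at this
      exact this
    have hy : (0 ≤ (y : ℤ) - 1) → ((x : ℤ), (y : ℤ) - 1, (z : ℤ)) ∉ P ∧
        ((x : ℤ), (y : ℤ) - 1, (z : ℤ) + 5) ∉ P := by
      intro h
      have hy : 1 ≤ y := by omega
      have := h3 (by omega)
      push_cast [Nat.cast_sub hy] at this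
      exact this
    exact ⟨fun h => hk 1 (by norm_num) (by norm_num) h.2.2,
      fun h => hk 2 (by norm_num) (by norm_num) h.2.2,
      fun h => hk 3 (by norm_num) (by norm_num) h.2.2,
      fun h => hk 4 (by norm_num) (by norm_num) h.2.2,
      fun h => hk 5 (by norm_num) (by norm_num) h.2.2,
      fun h => hk 6 (by norm_num) (by norm_num) h.2.2,
      fun h => (hx h.1).1, fun h => (hx h.1).2.1, fun h => (hx h.1).2.2,
      fun h => (hy h.2.1).1, fun h => (hy h.2.1).2⟩

lemma phase_eq_three (x y : ℕ) :
    phase x y = 3 ↔ y % 2 = 1 ∧ 0 < x ∧ 2 ^ (y + 1) ∣ x := by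
  rw [Nat.dvd_iff_mod_eq_zero, pow_succ, mul_comm (2 ^ y) 2]
  unfold phase evenVal oddVal
  generalize x % (2 * 2 ^ y) = r
  constructor
  · intro h
    split_ifs at h <;> omega
  · rintro ⟨h1, h2, h3⟩
    simp [h1, h2, h3]

lemma slice_iff (P : Set (ℤ × ℤ × ℤ)) (hP : PPosProperty ruleset7 P) (x y : ℕ) :
    ((x : ℤ), (y : ℤ), (3 : ℤ)) ∈ P ↔ y % 2 = 1 ∧ 0 < x ∧ 2 ^ (y + 1) ∣ x := by
  have := P_iff P hP x y 3
  rw [← phase_eq_three]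
  push_cast at this
  rw [this]
  omega

lemma exists_pow_gt (a b : ℤ) : ∃ B : ℕ, ∀ y : ℕ, B < y → a + b * y < 2 ^ (y + 1) := by
  have hsq : ∀ y : ℕ, y ^ 2 ≤ 2 ^ (y + 1) := by
    intro y
    rcases lt_or_ge y 3 with h | h
    · interval_cases y <;> norm_num
    · induction y, h using Nat.le_induction with
      | base => norm_num
      | succ n hn ih => rw [pow_succ 2 (n + 1)]; nlinarith
  refine ⟨(|a| + |b| + 1).toNat, fun y hy => ?_⟩
  have h1 : ((y : ℤ)) ^ 2 ≤ 2 ^ (y + 1) := by exact_mod_cast hsq y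
  have h2 : |a| + |b| + 1 < (y : ℤ) := by omega
  have ha := le_abs_self a
  have hb := le_abs_self b
  have ha0 := abs_nonneg a
  have hb0 := abs_nonneg b
  have h3 : b * y ≤ |b| * y := mul_le_mul_of_nonneg_right hb (by positivity)
  nlinarith

/-- Each stratum contains only finitely many of the points `(2 ^ (y + 1), y, 3)`. -/
lemma stratum_bound (P : Set (ℤ × ℤ × ℤ)) (hP : PPosProperty ruleset7 P) (w : ℤ × ℤ × ℤ)
    (Λ : AddSubmonoid (ℤ × ℤ × ℤ)) (hfg : Λ.FG)
    (hsub : (fun x => w + x) '' (Λ : Set (ℤ × ℤ × ℤ)) ⊆ P) :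
    ∃ B : ℕ, ∀ y : ℕ, B < y →
      (((2 ^ (y + 1) : ℕ) : ℤ), (y : ℤ), (3 : ℤ)) ∉ (fun x => w + x) '' (Λ : Set (ℤ × ℤ × ℤ)) := by
  obtain ⟨G, hG⟩ := hfg
  have hmem : ∀ g ∈ Λ, w + g ∈ P := fun g hg => hsub ⟨g, hg, rfl⟩
  have hGm : ∀ g ∈ G, g ∈ Λ := fun g hg => by
    rw [← hG]; exact AddSubmonoid.subset_closure hg
  have aux : ∀ u v : ℤ, (∀ n : ℕ, 0 ≤ u + n * v) → 0 ≤ v := by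
    intro u v h
    by_contra hv
    have := h (u.natAbs + 1)
    push_cast at this
    have h2 : u ≤ |u| := le_abs_self u
    nlinarith [abs_nonneg u]
  have hnn : ∀ g ∈ Λ, 0 ≤ g.1 ∧ 0 ≤ g.2.1 ∧ 0 ≤ g.2.2 := by
    intro g hg
    have hb : ∀ n : ℕ, w + n • g ∈ board3 := fun n => hP.1 (hmem _ (Λ.nsmul_mem hg n))
    simp only [board3, Set.mem_ofPred_eq, Prod.fst_add, Prod.snd_add, Prod.smul_fst,
      Prod.smul_snd, nsmul_eq_mul] at hb
    exact ⟨aux _ _ fun n => (hb n).1, aux _ _ fun n => (hb n).2.1, aux _ _ fun n => (hb n).2.2⟩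
  by_cases hex : ∃ g ∈ G, 0 < g.1 ∧ g.2.1 = 0 ∧ g.2.2 = 0
  · obtain ⟨⟨a, b, c⟩, hg, ha, hb, hc⟩ := hex
    simp only at ha hb hc
    subst hb hc
    refine ⟨a.natAbs, fun y hy => ?_⟩
    rintro ⟨l, hl, hle⟩
    have h1 := hmem _ (Λ.add_mem hl (hGm _ hg))
    have h0 := hmem _ hl
    simp only at hle
    rw [← add_assoc, hle] at h1
    rw [hle] at h0
    obtain ⟨n, rfl⟩ : ∃ n : ℕ, a = n := ⟨a.toNat, by omega⟩
    simp only [Prod.mk_add_mk, add_zero] at h1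
    rw [← Nat.cast_add, slice_iff P hP] at h1
    have hd : 2 ^ (y + 1) ∣ n := (Nat.dvd_add_right (dvd_refl _)).1 h1.2.2
    have hle := Nat.le_of_dvd (by omega) hd
    have := Nat.lt_two_pow_self (n := y + 1)
    simp at hy
    omega
  · push Not at hex
    obtain ⟨C, hC0, hC⟩ : ∃ C : ℤ, 0 ≤ C ∧ ∀ g ∈ G, g.1 ≤ C := by
      refine ⟨∑ g ∈ G, g.1, Finset.sum_nonneg fun g hg => (hnn g (hGm g hg)).1, fun g hg => ?_⟩
      exact Finset.single_le_sum (f := fun g : ℤ × ℤ × ℤ => g.1)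
        (fun g hg => (hnn g (hGm g hg)).1) hg
    have hlin : ∀ g ∈ Λ, g.1 ≤ C * (g.2.1 + g.2.2) := by
      intro g hg
      rw [← hG] at hg
      induction hg using AddSubmonoid.closure_induction with
      | mem g hg =>
        have h := hnn g (hGm g hg)
        have hc := hC g hg
        by_cases h0 : g.2.1 + g.2.2 = 0
        · by_contra hlt
          rw [h0] at hlt
          exact hex g hg (by omega) (by omega) (by omega)
        · have : 1 ≤ g.2.1 + g.2.2 := by omega
          nlinarith
      | zero => simp
      | add a b _ _ ha hb =>
        simp only [Prod.fst_add, Prod.snd_add]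
        linarith
    obtain ⟨B, hB⟩ := exists_pow_gt (w.1 + C * (3 - w.2.1 - w.2.2)) C
    refine ⟨B, fun y hy => ?_⟩
    rintro ⟨l, hl, hle⟩
    have h1 := hlin l hl
    have h2 := hB y hy
    obtain ⟨w1, w2, w3⟩ := w
    obtain ⟨l1, l2, l3⟩ := l
    simp only [Prod.mk_add_mk, Prod.mk.injEq] at hle h1 h2
    obtain ⟨e1, e2, e3⟩ := hle
    push_cast at e1
    have e4 : l2 + l3 = y + 3 - w2 - w3 := by linarith
    rw [e4] at h1
    nlinarith

theorem lattice_game_without_affine_stratification :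
    ∃ Γ : Finset (ℤ × ℤ × ℤ), PointedRuleset Γ ∧
      ∀ P : Set (ℤ × ℤ × ℤ), PPosProperty Γ P → ¬ HasAffineStratification P := by
  refine ⟨ruleset7, ruleset7_pointed, fun P hP => ?_⟩
  rintro ⟨k, w, Λ, hfg, hT⟩
  have hb : ∀ t, ∃ B : ℕ, ∀ y : ℕ, B < y → (((2 ^ (y + 1) : ℕ) : ℤ), (y : ℤ), (3 : ℤ)) ∉
      (fun x => w t + x) '' (Λ t : Set (ℤ × ℤ × ℤ)) := fun t =>
    stratum_bound P hP (w t) (Λ t) (hfg t) (by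
      rw [hT]; exact Set.subset_iUnion (fun t => (fun x => w t + x) '' (Λ t : Set (ℤ × ℤ × ℤ))) t)
  choose B hB using hb
  have hmem := (slice_iff P hP (2 ^ (2 * (∑ t, B t) + 1 + 1)) (2 * (∑ t, B t) + 1)).2
    ⟨by omega, by positivity, dvd_refl _⟩
  rw [hT] at hmem
  obtain ⟨t, ht⟩ := Set.mem_iUnion.1 hmem
  refine hB t _ ?_ ht
  have : B t ≤ ∑ t, B t := Finset.single_le_sum (f := B) (fun _ _ => Nat.zero_le _) (Finset.mem_univ t)
  omega
end

section
/- There exists a finite pointed ruleset Γ ⊆ ℤ³ such that, for the unique set 𝒫 ⊆ ℕ³ satisfying the P-position property for Γ, the power series F = ∑_{p ∈ 𝒫} x^{p₁} y^{p₂} z^{p₃} in ℚ[[x,y,z]] is not rational: there do not exist polynomials P, Q ∈ ℚ[x,y,z] with Q having nonzero constant term and Q·F = P. -/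
open Classical in
/-- The multigraded generating function `∑_{p ∈ P} x^{p₁} y^{p₂} z^{p₃}` of a
set `P ⊆ ℕ³`, as a formal power series in three variables over `ℚ`. -/
noncomputable def genFun (P : Set (ℤ × ℤ × ℤ)) : MvPowerSeries (Fin 3) ℚ :=
  fun e => if ((e 0 : ℤ), (e 1 : ℤ), (e 2 : ℤ)) ∈ P then 1 else 0


/-- Parity of binomial coefficients. -/
def TT (i c : ℕ) : Prop := Nat.choose i c % 2 = 1

/-- The explicit description of the slice `z = 1`. -/
def spec (x y : ℕ) : Prop :=
  (x % 17 = 0 ∧ ¬ TT (x / 17) (y + 1)) ∨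
  (x % 17 = 4 ∧ TT (x / 17) (y + 1) ∧ TT (x / 17) y) ∨
  (x % 17 = 11 ∧ TT (x / 17) (y + 1) ∧ ¬ TT (x / 17) y) ∨
  (x % 17 = 12 ∧ TT (x / 17) y ∧ ¬ TT (x / 17) (y + 1))

/-- The ruleset. -/
def GG : Finset (ℤ × ℤ × ℤ) :=
  {(4, 0, 0), (4, 1, 0), (11, 0, 0), (7, 0, 0), (12, 1, 0), (8, 0, 0), (6, 0, 0), (5, 0, 0),
   (3, 0, 0), (14, 0, 0),
   (-16, 0, 1), (-12, 0, 1), (-9, 0, 1), (-4, 0, 1), (-3, 0, 1)}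

theorem GG_pointed : PointedRuleset GG := by
  refine ⟨(LinearMap.fst ℤ ℤ (ℤ × ℤ)) + (LinearMap.fst ℤ ℤ ℤ).comp (LinearMap.snd ℤ ℤ (ℤ × ℤ))
    + (17 : ℤ) • (LinearMap.snd ℤ ℤ ℤ).comp (LinearMap.snd ℤ ℤ (ℤ × ℤ)), ?_, ?_, ?_, ?_⟩
  · intro γ hγ
    simp only [GG, Finset.mem_insert, Finset.mem_singleton] at hγ
    rcases hγ with h | h | h | h | h | h | h | h | h | h | h | h | h | h | h <;> subst h <;> simp
  all_goals simp

theorem move_iff (P : Set (ℤ × ℤ × ℤ)) (x y z : ℕ) (a b c : ℕ) :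
    ((((x : ℤ), (y : ℤ), (z : ℤ)) - ((a : ℤ), (b : ℤ), (c : ℤ)) ∈ board3 →
      ((x : ℤ), (y : ℤ), (z : ℤ)) - ((a : ℤ), (b : ℤ), (c : ℤ)) ∉ P)) ↔
    (a ≤ x → b ≤ y → c ≤ z → (((x - a : ℕ) : ℤ), ((y - b : ℕ) : ℤ), ((z - c : ℕ) : ℤ)) ∉ P) := by
  simp only [board3, Set.mem_ofPred_eq, Prod.mk_sub_mk]
  constructor
  · intro h h1 h2 h3
    rw [Nat.cast_sub h1, Nat.cast_sub h2, Nat.cast_sub h3]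
    exact h ⟨by omega, by omega, by omega⟩
  · rintro h ⟨h1, h2, h3⟩
    have := h (by omega) (by omega) (by omega)
    rwa [Nat.cast_sub (by omega), Nat.cast_sub (by omega), Nat.cast_sub (by omega)] at this

theorem move_iff' (P : Set (ℤ × ℤ × ℤ)) (x y z : ℕ) (a : ℕ) :
    ((((x : ℤ), (y : ℤ), (z : ℤ)) - (-(a : ℤ), 0, 1) ∈ board3 →
      ((x : ℤ), (y : ℤ), (z : ℤ)) - (-(a : ℤ), 0, 1) ∉ P)) ↔
    (1 ≤ z → (((x + a : ℕ) : ℤ), (y : ℤ), ((z - 1 : ℕ) : ℤ)) ∉ P) := by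
  simp only [board3, Set.mem_ofPred_eq, Prod.mk_sub_mk]
  constructor
  · intro h h3
    have := h ⟨by omega, by omega, by omega⟩
    rw [Nat.cast_sub h3]
    push_cast
    simpa using this
  · rintro h ⟨h1, h2, h3⟩
    have := h (by omega)
    rw [Nat.cast_sub (by omega)] at this
    push_cast at this
    simpa using this

theorem step (P : Set (ℤ × ℤ × ℤ)) (hP : PPosProperty GG P) (x y z : ℕ) :
    (((x : ℤ), (y : ℤ), (z : ℤ)) ∈ P) ↔
      (∀ a b, (a, b) ∈ ([(4, 0), (4, 1), (11, 0), (7, 0), (12, 1), (8, 0), (6, 0), (5, 0),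
        (3, 0), (14, 0)] : List (ℕ × ℕ)) → a ≤ x → b ≤ y →
          (((x - a : ℕ) : ℤ), ((y - b : ℕ) : ℤ), (z : ℤ)) ∉ P) ∧
      (∀ a ∈ ([16, 12, 9, 4, 3] : List ℕ), 1 ≤ z →
          (((x + a : ℕ) : ℤ), (y : ℤ), ((z - 1 : ℕ) : ℤ)) ∉ P) := by
  rw [hP.2 _ ⟨by simp, by simp, by simp⟩]
  constructor
  · intro h
    constructor
    · intro a b hab h1 h2
      have hm : ((a : ℤ), (b : ℤ), ((0 : ℕ) : ℤ)) ∈ GG := by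
        simp only [List.mem_cons, Prod.mk.injEq, List.not_mem_nil, or_false] at hab
        rcases hab with h | h | h | h | h | h | h | h | h | h <;> obtain ⟨rfl, rfl⟩ := h <;>
          simp [GG]
      have := (move_iff P x y z a b 0).1 (h _ hm) h1 h2 (Nat.zero_le _)
      simpa using this
    · intro a ha h1
      have hm : (-(a : ℤ), (0 : ℤ), (1 : ℤ)) ∈ GG := by
        simp only [List.mem_cons, List.not_mem_nil, or_false] at ha
        rcases ha with h | h | h | h | h <;> subst h <;> simp [GG]
      exact (move_iff' P x y z a).1 (h _ hm) h1
  · rintro ⟨h1, h2⟩ γ hγ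
    have key1 : ∀ a b : ℕ, (a, b) ∈ ([(4, 0), (4, 1), (11, 0), (7, 0), (12, 1), (8, 0), (6, 0),
        (5, 0), (3, 0), (14, 0)] : List (ℕ × ℕ)) → γ = ((a : ℤ), (b : ℤ), ((0 : ℕ) : ℤ)) →
        (((x : ℤ), (y : ℤ), (z : ℤ)) - γ ∈ board3 → ((x : ℤ), (y : ℤ), (z : ℤ)) - γ ∉ P) := by
      rintro a b hab rfl
      exact (move_iff P x y z a b 0).2 fun h3 h4 _ => by simpa using h1 a b hab h3 h4
    have key2 : ∀ a ∈ ([16, 12, 9, 4, 3] : List ℕ), γ = (-(a : ℤ), (0 : ℤ), (1 : ℤ)) →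
        (((x : ℤ), (y : ℤ), (z : ℤ)) - γ ∈ board3 → ((x : ℤ), (y : ℤ), (z : ℤ)) - γ ∉ P) := by
      rintro a ha rfl
      exact (move_iff' P x y z a).2 (h2 a ha)
    simp only [GG, Finset.mem_insert, Finset.mem_singleton] at hγ
    rcases hγ with h | h | h | h | h | h | h | h | h | h | h | h | h | h | h
    · exact key1 4 0 (by simp) (by simpa using h)
    · exact key1 4 1 (by simp) (by simpa using h)
    · exact key1 11 0 (by simp) (by simpa using h)
    · exact key1 7 0 (by simp) (by simpa using h)
    · exact key1 12 1 (by simp) (by simpa using h)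
    · exact key1 8 0 (by simp) (by simpa using h)
    · exact key1 6 0 (by simp) (by simpa using h)
    · exact key1 5 0 (by simp) (by simpa using h)
    · exact key1 3 0 (by simp) (by simpa using h)
    · exact key1 14 0 (by simp) (by simpa using h)
    · exact key2 16 (by simp) (by simpa using h)
    · exact key2 12 (by simp) (by simpa using h)
    · exact key2 9 (by simp) (by simpa using h)
    · exact key2 4 (by simp) (by simpa using h)
    · exact key2 3 (by simp) (by simpa using h)

theorem slice0 (P : Set (ℤ × ℤ × ℤ)) (hP : PPosProperty GG P) (x y : ℕ) :
    (((x : ℤ), (y : ℤ), ((0 : ℕ) : ℤ)) ∈ P) ↔ x % 17 < 3 := by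
  induction x using Nat.strong_induction_on generalizing y with
  | _ x ih =>
    rw [step P hP]
    have hlt : ∀ a b, (a, b) ∈ ([(4, 0), (4, 1), (11, 0), (7, 0), (12, 1), (8, 0), (6, 0), (5, 0),
        (3, 0), (14, 0)] : List (ℕ × ℕ)) → a ≤ x →
        ((((x - a : ℕ) : ℤ), ((y - b : ℕ) : ℤ), ((0 : ℕ) : ℤ)) ∈ P ↔ (x - a) % 17 < 3) := by
      intro a b hab hx
      refine ih _ ?_ _
      simp only [List.mem_cons, Prod.mk.injEq, List.not_mem_nil, or_false] at hab
      omega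
    constructor
    · rintro ⟨h, -⟩
      by_contra hx
      have hk : ∀ a, (a, 0) ∈ ([(4, 0), (4, 1), (11, 0), (7, 0), (12, 1), (8, 0), (6, 0), (5, 0),
        (3, 0), (14, 0)] : List (ℕ × ℕ)) → a ≤ x → ¬ ((x - a) % 17 < 3) := by
        intro a ha hax
        rw [← hlt a 0 ha hax]
        exact h a 0 ha hax (Nat.zero_le _)
      have k3 := hk 3 (by simp)
      have k5 := hk 5 (by simp)
      have k8 := hk 8 (by simp)
      have k11 := hk 11 (by simp)
      have k14 := hk 14 (by simp)
      omega
    · intro hx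
      refine ⟨fun a b hab h1 h2 => ?_, fun a _ h => by omega⟩
      rw [hlt a b hab h1]
      simp only [List.mem_cons, Prod.mk.injEq, List.not_mem_nil, or_false] at hab
      omega

theorem TT_succ (i c : ℕ) : TT (i + 1) (c + 1) ↔ ¬ (TT i c ↔ TT i (c + 1)) := by
  unfold TT
  rw [Nat.choose_succ_succ']
  omega

theorem TT_zero (i : ℕ) : TT i 0 := by simp [TT]

theorem TT_zero_succ (c : ℕ) : ¬ TT 0 (c + 1) := by simp [TT]

theorem spec_eq (q r y : ℕ) (hr : r < 17) : spec (17 * q + r) y ↔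
  (r = 0 ∧ ¬ TT q (y + 1)) ∨ (r = 4 ∧ TT q (y + 1) ∧ TT q y) ∨
  (r = 11 ∧ TT q (y + 1) ∧ ¬ TT q y) ∨ (r = 12 ∧ TT q y ∧ ¬ TT q (y + 1)) := by
  have h1 : (17 * q + r) / 17 = q := by omega
  have h2 : (17 * q + r) % 17 = r := by omega
  unfold spec
  rw [h1, h2]

theorem slice1 (P : Set (ℤ × ℤ × ℤ)) (hP : PPosProperty GG P) (x y : ℕ) :
    (((x : ℤ), (y : ℤ), ((1 : ℕ) : ℤ)) ∈ P) ↔ spec x y := by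
  induction x using Nat.strong_induction_on generalizing y with
  | _ x ih =>
    rw [step P hP]
    have hlt : ∀ a b, (a, b) ∈ ([(4, 0), (4, 1), (11, 0), (7, 0), (12, 1), (8, 0), (6, 0), (5, 0),
        (3, 0), (14, 0)] : List (ℕ × ℕ)) → a ≤ x →
        ((((x - a : ℕ) : ℤ), ((y - b : ℕ) : ℤ), ((1 : ℕ) : ℤ)) ∈ P ↔ spec (x - a) (y - b)) := by
      intro a b hab hx
      refine ih _ ?_ _
      simp only [List.mem_cons, Prod.mk.injEq, List.not_mem_nil, or_false] at hab
      omega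
    have e1 : (∀ a b, (a, b) ∈ ([(4, 0), (4, 1), (11, 0), (7, 0), (12, 1), (8, 0), (6, 0), (5, 0),
        (3, 0), (14, 0)] : List (ℕ × ℕ)) → a ≤ x → b ≤ y →
          (((x - a : ℕ) : ℤ), ((y - b : ℕ) : ℤ), ((1 : ℕ) : ℤ)) ∉ P) ↔
        (∀ a b, (a, b) ∈ ([(4, 0), (4, 1), (11, 0), (7, 0), (12, 1), (8, 0), (6, 0), (5, 0),
        (3, 0), (14, 0)] : List (ℕ × ℕ)) → a ≤ x → b ≤ y → ¬ spec (x - a) (y - b)) := by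
      constructor
      · intro h a b hab h1 h2
        rw [← hlt a b hab h1]
        exact h a b hab h1 h2
      · intro h a b hab h1 h2
        rw [hlt a b hab h1]
        exact h a b hab h1 h2
    have e2 : (∀ a ∈ ([16, 12, 9, 4, 3] : List ℕ), 1 ≤ 1 →
          (((x + a : ℕ) : ℤ), (y : ℤ), ((1 - 1 : ℕ) : ℤ)) ∉ P) ↔
        (x % 17 = 0 ∨ x % 17 = 4 ∨ x % 17 = 11 ∨ x % 17 = 12) := by
      simp only [Nat.sub_self, slice0 P hP, le_refl, true_imp_iff, List.forall_mem_cons]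
      simp only [List.not_mem_nil, false_imp_iff, implies_true, and_true]
      omega
    rw [e1, e2]
    clear e1 e2 hlt ih
    obtain ⟨q, r, hr, rfl⟩ : ∃ q r, r < 17 ∧ x = 17 * q + r :=
      ⟨x / 17, x % 17, by omega, by omega⟩
    rw [spec_eq q r y hr]
    have hr' : (17 * q + r) % 17 = r := by omega
    rw [hr']
    -- evaluation of `spec` at a predecessor
    have same : ∀ a y', a ≤ r → (spec (17 * q + r - a) y' ↔ spec (17 * q + (r - a)) y') := by
      intro a y' h
      rw [Nat.add_sub_assoc h]
    constructor
    · rintro ⟨h, hh⟩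
      rcases hh with rfl | rfl | rfl | rfl
      · left
        refine ⟨rfl, ?_⟩
        rcases q with _ | q
        · exact TT_zero_succ y
        · have h6 := h 6 0 (by simp) (by omega) (by omega)
          have h5 := h 5 0 (by simp) (by omega) (by omega)
          rw [show 17 * (q + 1) + 0 - 6 = 17 * q + 11 by omega, spec_eq _ _ _ (by omega)] at h6
          rw [show 17 * (q + 1) + 0 - 5 = 17 * q + 12 by omega, spec_eq _ _ _ (by omega)] at h5
          rw [TT_succ]
          simp at h5 h6
          tauto
      · right; left
        have h0 := h 4 0 (by simp) (by omega) (by omega)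
        have h1 := h 4 1 (by simp) (by omega)
        rw [same _ _ (by omega), spec_eq _ _ _ (by omega)] at h0
        rw [same _ _ (by omega), spec_eq _ _ _ (by omega)] at h1
        rcases y with _ | y
        · have := TT_zero q
          simp at h0
          tauto
        · simp at h0 h1
          tauto
      · right; right; left
        have h0 := h 11 0 (by simp) (by omega) (by omega)
        have h1 := h 7 0 (by simp) (by omega) (by omega)
        rw [same _ _ (by omega), spec_eq _ _ _ (by omega)] at h0
        rw [same _ _ (by omega), spec_eq _ _ _ (by omega)] at h1
        simp at h0 h1
        tauto
      · right; right; right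
        have h0 := h 12 1 (by simp) (by omega)
        have h1 := h 8 0 (by simp) (by omega) (by omega)
        rw [same _ _ (by omega), spec_eq _ _ _ (by omega)] at h0
        rw [same _ _ (by omega), spec_eq _ _ _ (by omega)] at h1
        rcases y with _ | y
        · have := TT_zero q
          simp at h1
          tauto
        · simp at h0 h1
          tauto
    · intro hs
      refine ⟨?_, by tauto⟩
      intro a b hab h1 h2 hc
      simp only [List.mem_cons, Prod.mk.injEq, List.not_mem_nil, or_false] at hab
      obtain ⟨q', r', hr1, hq'⟩ : ∃ q' r', r' < 17 ∧ 17 * q + r - a = 17 * q' + r' :=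
        ⟨(17 * q + r - a) / 17, (17 * q + r - a) % 17, by omega, by omega⟩
      rw [hq', spec_eq _ _ _ hr1] at hc
      rcases hs with ⟨rfl, hs⟩ | ⟨rfl, hs⟩ | ⟨rfl, hs⟩ | ⟨rfl, hs⟩
      · have : (r' = 11 ∨ r' = 12) ∧ b = 0 ∧ q = q' + 1 := by omega
        obtain ⟨h3, rfl, rfl⟩ := this
        rw [TT_succ] at hs
        rcases h3 with rfl | rfl <;> simp at hc <;> tauto
      · have : r' = 0 ∧ q' = q ∧ (b = 0 ∨ b = 1) := by omega
        obtain ⟨rfl, rfl, h3⟩ := this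
        rcases h3 with rfl | rfl
        · simp at hc
          tauto
        · rw [Nat.sub_add_cancel h2] at hc
          simp at hc
          tauto
      · have : (r' = 0 ∨ r' = 4) ∧ q' = q ∧ b = 0 := by omega
        obtain ⟨h3, rfl, rfl⟩ := this
        rcases h3 with rfl | rfl <;> simp at hc <;> tauto
      · have : ((r' = 0 ∧ b = 1) ∨ (r' = 4 ∧ b = 0)) ∧ q' = q := by omega
        obtain ⟨h3, rfl⟩ := this
        rcases h3 with ⟨rfl, rfl⟩ | ⟨rfl, rfl⟩
        · rw [Nat.sub_add_cancel h2] at hc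
          simp at hc
          tauto
        · simp at hc
          tauto

theorem TT_iff (i c : ℕ) : TT i c ↔ ((Nat.choose i c : ℕ) : ZMod 2) = 1 := by
  unfold TT
  have h := ZMod.natCast_eq_natCast_iff (Nat.choose i c) 1 2
  rw [Nat.cast_one] at h
  rw [h]
  rfl

open Polynomial in
theorem choose_shift (k i c : ℕ) : ((Nat.choose (i + 2 ^ k) c : ℕ) : ZMod 2) =
    (Nat.choose i c : ZMod 2) + if 2 ^ k ≤ c then (Nat.choose i (c - 2 ^ k) : ZMod 2) else 0 := by
  have : Fact (Nat.Prime 2) := ⟨Nat.prime_two⟩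
  have h : ((1 + X : (ZMod 2)[X]) ^ (i + 2 ^ k)) = (1 + X) ^ i + (1 + X) ^ i * X ^ (2 ^ k) := by
    rw [pow_add, add_pow_char_pow, one_pow]
    ring
  have h2 := congrArg (fun p => coeff p c) h
  simp only [coeff_add, coeff_one_add_X_pow, coeff_mul_X_pow'] at h2
  exact h2

theorem TT_large (i c : ℕ) (h : i < c) : ¬ TT i c := by
  simp [TT, Nat.choose_eq_zero_of_lt h]

theorem TT_shift1 (k q c : ℕ) (hc : c < 2 ^ k) : TT (q + 2 ^ k) c ↔ TT q c := by
  rw [TT_iff, TT_iff, choose_shift, if_neg (by omega), add_zero]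

theorem TT_shift1' (k q : ℕ) (hq : q < 2 ^ k) : TT (q + 2 ^ k) (2 ^ k) := by
  rw [TT_iff, choose_shift, Nat.choose_eq_zero_of_lt hq]
  simp

theorem TT_shift2 (k q c : ℕ) (hc : c < 2 ^ k) (hq : q < 2 ^ k) :
    ¬ TT (q + 2 * 2 ^ k) (c + 2 ^ k) := by
  have : q + 2 * 2 ^ k = q + 2 ^ (k + 1) := by ring
  rw [this, TT_shift1 _ _ _ (by rw [pow_succ]; omega)]
  exact TT_large _ _ (by omega)

theorem TT_shift2' (k q : ℕ) (hq : q < 2 ^ k) :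
    TT (q + 2 * 2 ^ k) (2 ^ k + 2 ^ k) := by
  have : q + 2 * 2 ^ k = q + 2 ^ (k + 1) := by ring
  rw [this]
  have h2 : 2 ^ k + 2 ^ k = 2 ^ (k + 1) := by ring
  rw [h2]
  exact TT_shift1' _ _ (by omega)

open Classical in
/-- Indicator of a proposition. -/
noncomputable def ind (p : Prop) : ℚ := if p then 1 else 0

theorem ind_true {p : Prop} (h : p) : ind p = 1 := by simp [ind, h]
theorem ind_false {p : Prop} (h : ¬ p) : ind p = 0 := by simp [ind, h]

/-- The four-window identity in the slice `z = 1`. -/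
theorem window (k q r y : ℕ) (hr : r < 17) (hq : q < 2 ^ k) (hy : y < 2 ^ k)
    (hx : 17 * q + r ≤ 17 * (2 ^ k - 1) + 4) :
    ind (spec (17 * (q + 2 ^ k) + r) y) - ind (spec (17 * q + r) y)
      - ind (spec (17 * (q + 2 * 2 ^ k) + r) (y + 2 ^ k)) + ind (spec (17 * q + r) (y + 2 ^ k))
    = ind (17 * q + r = 17 * (2 ^ k - 1) + 4 ∧ y = 2 ^ k - 1) := by
  rw [spec_eq _ _ _ hr, spec_eq _ _ _ hr, spec_eq _ _ _ hr, spec_eq _ _ _ hr]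
  have a1 := TT_shift1 k q y hy
  have a2 := TT_shift2 k q y hy hq
  have a3 := TT_large q (y + 2 ^ k) (by omega)
  have a4 := TT_large q (y + 2 ^ k + 1) (by omega)
  by_cases hy1 : y + 1 < 2 ^ k
  · have b1 := TT_shift1 k q (y + 1) hy1
    have b2 := TT_shift2 k q (y + 1) hy1 hq
    rw [show y + 1 + 2 ^ k = y + 2 ^ k + 1 by omega] at b2
    rw [ind_false (p := _ ∧ y = 2 ^ k - 1) (by omega)]
    simp only [a1, a2, a3, a4, b1, b2]
    ring
  · have hy2 : y + 1 = 2 ^ k := by omega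
    have b1 := TT_shift1' k q hq
    have b2 := TT_shift2' k q hq
    have b3 := TT_large q (2 ^ k) hq
    rw [show 2 ^ k + 2 ^ k = y + 2 ^ k + 1 by omega] at b2
    rw [← hy2] at b1 b3
    have b3 : ¬ TT q (y + 1) := b3
    rw [hy2] at b1
    rw [show TT (q + 2 ^ k) (y + 1) ↔ True by rw [hy2]; simpa using b1]
    simp only [a1, a2, a3, a4, b2, b3]
    by_cases hq2 : q = y
    · have c1 : TT q y := by rw [hq2]; simp [TT]
      have hr4 : r ≤ 4 := by omega
      simp only [c1]
      by_cases r0 : r = 0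
      · subst r0
        rw [ind_false (p := _ ∧ y = 2 ^ k - 1) (by omega)]
        simp [ind]
      · by_cases r4 : r = 4
        · subst r4
          rw [ind_true (p := _ ∧ y = 2 ^ k - 1) (by omega)]
          simp [ind]
        · rw [ind_false (p := _ ∧ y = 2 ^ k - 1) (by omega)]
          have : r ≠ 11 := by omega
          have : r ≠ 12 := by omega
          simp [ind, *]
    · have c1 : ¬ TT q y := TT_large _ _ (by omega)
      rw [ind_false (p := _ ∧ y = 2 ^ k - 1) (by omega)]
      simp only [c1]
      simp

/-- Points of the slice `z = 1` as exponents. -/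
noncomputable def pt (x y : ℕ) : Fin 3 →₀ ℕ := Finsupp.equivFunOnFinite.symm ![x, y, 1]

theorem coeff_Q_mul (Q : MvPolynomial (Fin 3) ℚ) (F : MvPowerSeries (Fin 3) ℚ)
    (v : Fin 3 →₀ ℕ) : MvPowerSeries.coeff v ((Q : MvPowerSeries (Fin 3) ℚ) * F) =
      ∑ d ∈ Q.support, Q.coeff d * (if d ≤ v then MvPowerSeries.coeff (v - d) F else 0) := by
  conv_lhs => rw [Q.as_sum]
  rw [← MvPolynomial.coeToMvPowerSeries.ringHom_apply, map_sum, Finset.sum_mul, map_sum]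
  refine Finset.sum_congr rfl fun d _ => ?_
  rw [MvPolynomial.coeToMvPowerSeries.ringHom_apply, MvPolynomial.coe_monomial,
    MvPowerSeries.coeff_monomial_mul]
  split_ifs <;> simp

theorem coeff_genFun (P : Set (ℤ × ℤ × ℤ)) (e : Fin 3 →₀ ℕ) :
    MvPowerSeries.coeff e (genFun P) = ind (((e 0 : ℤ), (e 1 : ℤ), (e 2 : ℤ)) ∈ P) := rfl

theorem le_degree (Q : MvPolynomial (Fin 3) ℚ) (d : Fin 3 →₀ ℕ) (hd : d ∈ Q.support) (i : Fin 3) :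
    d i ≤ Q.totalDegree :=
  (Finsupp.le_degree i d).trans (MvPolynomial.le_totalDegree hd)

/-- The coefficient contribution as a function of the exponent. -/
theorem term_eq (P : Set (ℤ × ℤ × ℤ)) (hP : PPosProperty GG P) (x y : ℕ) (d : Fin 3 →₀ ℕ)
    (h0 : d 0 ≤ x) (h1 : d 1 ≤ y) :
    (if d ≤ pt x y then MvPowerSeries.coeff (pt x y - d) (genFun P) else 0) =
      if d 2 = 0 then ind (spec (x - d 0) (y - d 1)) else
        if d 2 = 1 then ind ((x - d 0) % 17 < 3) else 0 := by
  have hle : d ≤ pt x y ↔ d 2 ≤ 1 := by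
    rw [Finsupp.le_def]
    simp [Fin.forall_fin_succ, pt, h0, h1]
  rw [coeff_genFun]
  have e0 : (pt x y - d) 0 = x - d 0 := by simp [pt]
  have e1 : (pt x y - d) 1 = y - d 1 := by simp [pt]
  have e2 : (pt x y - d) 2 = 1 - d 2 := by simp [pt]
  rw [e0, e1, e2]
  by_cases h2 : d 2 = 0
  · rw [if_pos (hle.2 (by omega)), if_pos h2, h2, Nat.sub_zero, slice1 P hP]
  · by_cases h3 : d 2 = 1
    · rw [if_pos (hle.2 (by omega)), if_neg h2, if_pos h3, h3, Nat.sub_self, slice0 P hP]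
    · rw [if_neg (fun h => by have := hle.1 h; omega), if_neg h2, if_neg h3]

theorem lattice_game_without_rational_strategy :
    ∃ Γ : Finset (ℤ × ℤ × ℤ), PointedRuleset Γ ∧
      ∀ P : Set (ℤ × ℤ × ℤ), PPosProperty Γ P →
        ¬ ∃ (Pp Qq : MvPolynomial (Fin 3) ℚ), MvPolynomial.coeff 0 Qq ≠ 0 ∧
            (Qq : MvPowerSeries (Fin 3) ℚ) * genFun P = (Pp : MvPowerSeries (Fin 3) ℚ) := by
  refine ⟨GG, GG_pointed, ?_⟩
  rintro P hP ⟨R, Q, hQ, h⟩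
  obtain ⟨k, hk⟩ : ∃ k : ℕ, Q.totalDegree + R.totalDegree + 2 < 2 ^ k :=
    ⟨_, Nat.lt_two_pow_self⟩
  have hR : ∀ x y, 2 ^ k - 1 ≤ y →
      MvPowerSeries.coeff (pt x y) ((Q : MvPowerSeries (Fin 3) ℚ) * genFun P) = 0 := by
    intro x y hy
    rw [h, MvPolynomial.coeff_coe, ← MvPolynomial.notMem_support_iff]
    intro hm
    have := le_degree R _ hm 1
    have e : pt x y 1 = y := by simp [pt]
    omega
  have h11 := hR (17 * (2 ^ k - 1 + 2 ^ k) + 4) (2 ^ k - 1) le_rfl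
  have h10 := hR (17 * (2 ^ k - 1) + 4) (2 ^ k - 1) le_rfl
  have h01 := hR (17 * (2 ^ k - 1 + 2 * 2 ^ k) + 4) (2 ^ k - 1 + 2 ^ k) (by omega)
  have h00 := hR (17 * (2 ^ k - 1) + 4) (2 ^ k - 1 + 2 ^ k) (by omega)
  rw [coeff_Q_mul] at h11 h10 h01 h00
  have hsum : ∑ d ∈ Q.support, Q.coeff d * (if d = 0 then (1 : ℚ) else 0) = 0 := by
    have hcomb := congrArg₂ (· + ·) (congrArg₂ (· - ·) (congrArg₂ (· - ·) h11 h10) h01) h00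
    simp only [sub_zero, add_zero] at hcomb
    refine Eq.trans ?_ hcomb
    rw [← Finset.sum_sub_distrib, ← Finset.sum_sub_distrib, ← Finset.sum_add_distrib]
    refine Finset.sum_congr rfl fun d hd => ?_
    have d0 := le_degree Q d hd 0
    have d1 := le_degree Q d hd 1
    rw [← mul_sub, ← mul_sub, ← mul_add]
    congr 1
    rw [term_eq P hP _ _ d (by omega) (by omega), term_eq P hP _ _ d (by omega) (by omega),
      term_eq P hP _ _ d (by omega) (by omega), term_eq P hP _ _ d (by omega) (by omega)]
    have hd0 : d = 0 ↔ d 0 = 0 ∧ d 1 = 0 ∧ d 2 = 0 := by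
      rw [Finsupp.ext_iff]
      simp [Fin.forall_fin_succ]
    by_cases h2 : d 2 = 0
    · simp only [if_pos h2]
      obtain ⟨q, r, hr, hqr⟩ : ∃ q r, r < 17 ∧ 17 * (2 ^ k - 1) + 4 - d 0 = 17 * q + r :=
        ⟨(17 * (2 ^ k - 1) + 4 - d 0) / 17, (17 * (2 ^ k - 1) + 4 - d 0) % 17,
          by omega, by omega⟩
      have hw := window k q r (2 ^ k - 1 - d 1) hr (by omega) (by omega) (by omega)
      rw [show 17 * (2 ^ k - 1 + 2 ^ k) + 4 - d 0 = 17 * (q + 2 ^ k) + r by omega,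
        show 17 * (2 ^ k - 1 + 2 * 2 ^ k) + 4 - d 0 = 17 * (q + 2 * 2 ^ k) + r by omega,
        hqr, show 2 ^ k - 1 + 2 ^ k - d 1 = 2 ^ k - 1 - d 1 + 2 ^ k by omega, hw]
      by_cases hd' : d = 0
      · rw [if_pos hd', ind_true]
        have := hd0.1 hd'
        omega
      · rw [if_neg hd', ind_false]
        intro hc
        exact hd' (hd0.2 ⟨by omega, by omega, h2⟩)
    · rw [if_neg (fun h => h2 (hd0.1 h).2.2)]
      simp only [if_neg h2]
      by_cases h3 : d 2 = 1
      · simp only [if_pos h3]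
        have m1 : (17 * (2 ^ k - 1 + 2 ^ k) + 4 - d 0) % 17 = (17 * (2 ^ k - 1) + 4 - d 0) % 17 := by
          omega
        have m2 : (17 * (2 ^ k - 1 + 2 * 2 ^ k) + 4 - d 0) % 17
            = (17 * (2 ^ k - 1) + 4 - d 0) % 17 := by
          omega
        rw [m1, m2]
        ring
      · simp only [if_neg h3]
        ring
  apply hQ
  have hmem : (0 : Fin 3 →₀ ℕ) ∈ Q.support := MvPolynomial.mem_support_iff.2 hQ
  simpa [Finset.sum_ite_eq', hmem] using hsum
end

section
/- Let Σ be a finite nonempty type, σ₀ ∈ Σ, r ≥ 1, g : Σ^r → Σ, and let β₁, …, β_r ∈ ℤ² be nonzero vectors for which there is a ℤ-linear functional ψ : ℤ² → ℤ with ψ(βᵢ) > 0 for all i and ψ(e₁) > 0, ψ(e₂) > 0, and such that some βᵢ has first coordinate ≤ 0 and some βᵢ′ has second coordinate ≤ 0. Let f : ℕ² → Σ be the unique function with f(ℓ) = g(f(ℓ−β₁), …, f(ℓ−β_r)) whenever ℓ − βᵢ ∈ ℕ² for all i, and f(ℓ) = σ₀ otherwise. Then there exist s ∈ ℕ, an injection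 enc : Σ → (Fin s → Bool), an integer m > 0, points out₁, …, out_s ∈ ℕ², and a finite pointed ruleset Γ ⊆ ℤ³, such that for the unique set 𝒫 ⊆ ℕ³ satisfying the P-position property for Γ, and for every ℓ ∈ ℕ² and every j, one has enc(f(ℓ))(j) = true if and only if (out_j + m·ℓ, 1) ∈ 𝒫. -/
namespace LG

/-- residues of layer-0 P-positions -/
def QQ (M n x : ℤ) : Prop := ∃ k : ℤ, x = M * k ∨ x = M * k + n

/-- differences of such residues -/
def DD (M n x : ℤ) : Prop := ∃ k : ℤ, x = M * k ∨ x = M * k + n ∨ x = M * k - n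

lemma QQ_sub {M n x g : ℤ} (h : QQ M n x) (h' : QQ M n (x - g)) : DD M n g := by
  obtain ⟨k, hk⟩ := h
  obtain ⟨k', hk'⟩ := h'
  have e : M * (k - k') = M * k - M * k' := by ring
  refine ⟨k - k', ?_⟩
  rw [e]
  omega

lemma QQ_shift {M n x k : ℤ} : QQ M n (M * k + x) ↔ QQ M n x := by
  constructor
  · rintro ⟨l, h⟩
    have e : M * (l - k) = M * l - M * k := by ring
    exact ⟨l - k, by rw [e]; omega⟩
  · rintro ⟨l, h⟩
    have e : M * (l + k) = M * l + M * k := by ring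
    exact ⟨l + k, by rw [e]; omega⟩

lemma mk_cases {M : ℤ} (hM : 0 < M) (k : ℤ) :
    (k = 0 ∧ M * k = 0) ∨ (k = 1 ∧ M * k = M) ∨ M * k ≤ -M ∨ 2 * M ≤ M * k := by
  by_cases h0 : k = 0
  · left; simp [h0]
  by_cases h1 : k = 1
  · right; left; simp [h1]
  by_cases h2 : k ≤ -1
  · right; right; left; nlinarith
  · right; right; right
    have : 2 ≤ k := by omega
    nlinarith

lemma DD_bdd {M n N x : ℤ} (hM : M = 2 * n + N) (hN : 0 < N) (hn : N < n)
    (h : DD M n x) (h0 : 0 ≤ x) (h1 : x < M) : x = 0 ∨ x = n ∨ x = n + N := by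
  obtain ⟨k, hk⟩ := h
  rcases mk_cases (by omega : 0 < M) k with h | h | h | h <;> omega

lemma DD_small {M n N x : ℤ} (hM : M = 2 * n + N) (hN : 0 < N) (hn : N < n)
    (h : DD M n x) (h0 : -N < x) (h1 : x < N) : x = 0 := by
  obtain ⟨k, hk⟩ := h
  rcases mk_cases (by omega : 0 < M) k with h | h | h | h <;> omega

lemma DD_shift {M n x k : ℤ} (h : DD M n (x + M * k)) : DD M n x := by
  obtain ⟨l, h⟩ := h
  have e : M * (l - k) = M * l - M * k := by ring
  exact ⟨l - k, by rw [e]; omega⟩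

lemma QQ_mid {M n N x : ℤ} (hM : M = 2 * n + N) (hN : 0 < N) (hn : N < n)
    (h : QQ M n x) (h0 : n < x) (h1 : x < M) : False := by
  obtain ⟨k, hk⟩ := h
  rcases mk_cases (by omega : 0 < M) k with h | h | h | h <;> omega

lemma QQ_small {M n N x : ℤ} (hM : M = 2 * n + N) (hN : 0 < N) (hn : N < n)
    (h : QQ M n x) (h0 : -N < x) (h1 : x < N) : x = 0 := by
  obtain ⟨k, hk⟩ := h
  rcases mk_cases (by omega : 0 < M) k with h | h | h | h <;> omega

lemma gd_bdd {M n N x u k : ℤ} (hM : M = 2 * n + N) (hN : 0 < N) (hn : N < n)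
    (h : x = u + M * k) (h0 : 0 ≤ x) (h1 : x < M) (hu : -N < u) (hu' : u < N) :
    (x = u) ∨ (x = u + M) := by
  rcases mk_cases (by omega : 0 < M) k with h | h | h | h <;> omega

lemma QQ0 {M n : ℤ} (k : ℤ) : QQ M n (M * k) := ⟨k, Or.inl rfl⟩
lemma QQn {M n : ℤ} (k : ℤ) : QQ M n (M * k + n) := ⟨k, Or.inr rfl⟩

open Classical in
/-- base moves inside a layer -/
noncomputable def gB {ι : Type} (M n : ℤ) (X Y : ι → ℤ) : Finset (ℤ × ℤ × ℤ) :=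
  (Finset.Ico 0 M ×ˢ Finset.Ico 0 M ×ˢ {0}).filter (fun γ =>
    ¬ (DD M n γ.1 ∧ DD M n γ.2.1) ∧
    ¬ ∃ i j, ∃ k l : ℤ, γ.1 = X i - X j + M * k ∧ γ.2.1 = Y i - Y j + M * l)

open Classical in
/-- wires -/
noncomputable def gW {ι : Type} (M : ℤ) (X Y : ι → ℤ) (E : Finset (ι × ι × ℤ × ℤ)) :
    Finset (ℤ × ℤ × ℤ) :=
  E.image (fun e => (X e.1 - X e.2.1 + M * e.2.2.1, Y e.1 - Y e.2.1 + M * e.2.2.2, 0))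

open Classical in
/-- masking moves from layer 1 to layer 0 -/
noncomputable def gT {ι : Type} (M n : ℤ) (X Y : ι → ℤ) : Finset (ℤ × ℤ × ℤ) :=
  (Finset.Ico 0 M ×ˢ Finset.Ico 0 M ×ˢ {1}).filter (fun γ =>
    ∀ i, ¬ (QQ M n (2 * n + X i - γ.1) ∧ QQ M n (2 * n + Y i - γ.2.1)))

/-- the ruleset -/
noncomputable def gG {ι : Type} (M n : ℤ) (X Y : ι → ℤ) (E : Finset (ι × ι × ℤ × ℤ)) :
    Finset (ℤ × ℤ × ℤ) := by
  classical exact gB M n X Y ∪ gW M X Y E ∪ gT M n X Y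

lemma mem_gG {ι : Type} (M n : ℤ) (X Y : ι → ℤ) (E : Finset (ι × ι × ℤ × ℤ)) (γ) :
    γ ∈ gG M n X Y E ↔ γ ∈ gB M n X Y ∨ γ ∈ gW M X Y E ∨ γ ∈ gT M n X Y := by
  simp [gG]

lemma mem_gB {ι : Type} (M n : ℤ) (X Y : ι → ℤ) (x y z : ℤ) :
    (x, y, z) ∈ gB M n X Y ↔ ((0 ≤ x ∧ x < M) ∧ (0 ≤ y ∧ y < M) ∧ z = 0) ∧
    ¬ (DD M n x ∧ DD M n y) ∧
    ¬ ∃ i j, ∃ k l : ℤ, x = X i - X j + M * k ∧ y = Y i - Y j + M * l := by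
  simp only [gB, Finset.mem_filter, Finset.mem_product, Finset.mem_Ico, Finset.mem_singleton]

lemma mem_gT {ι : Type} (M n : ℤ) (X Y : ι → ℤ) (x y z : ℤ) :
    (x, y, z) ∈ gT M n X Y ↔ ((0 ≤ x ∧ x < M) ∧ (0 ≤ y ∧ y < M) ∧ z = 1) ∧
    ∀ i, ¬ (QQ M n (2 * n + X i - x) ∧ QQ M n (2 * n + Y i - y)) := by
  simp only [gT, Finset.mem_filter, Finset.mem_product, Finset.mem_Ico, Finset.mem_singleton]

lemma mem_gW {ι : Type} (M : ℤ) (X Y : ι → ℤ) (E : Finset (ι × ι × ℤ × ℤ)) (x y z : ℤ) :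
    (x, y, z) ∈ gW M X Y E ↔ ∃ i j d₁ d₂, (i, j, d₁, d₂) ∈ E ∧
      x = X i - X j + M * d₁ ∧ y = Y i - Y j + M * d₂ ∧ z = 0 := by
  simp only [gW, Finset.mem_image, Prod.mk.injEq, Prod.exists]
  constructor
  · rintro ⟨i, j, a, b, h, h1, h2, h3⟩
    exact ⟨i, j, a, b, h, h1.symm, h2.symm, h3.symm⟩
  · rintro ⟨i, j, a, b, h, h1, h2, h3⟩
    exact ⟨i, j, a, b, h, h1.symm, h2.symm, h3.symm⟩

/-- assumptions on the placement of gates -/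
structure Good {ι : Type} (M n N : ℤ) (X Y : ι → ℤ) (E : Finset (ι × ι × ℤ × ℤ)) : Prop where
  hM : M = 2 * n + N
  hN : 0 < N
  hn : N < n
  X0 : ∀ i, 0 ≤ X i
  X1 : ∀ i, X i < N
  Y0 : ∀ i, 0 ≤ Y i
  Y1 : ∀ i, Y i < N
  anti : ∀ i j, X i ≤ X j → Y i ≤ Y j → i = j
  inj : ∀ i j, X i = X j → i = j
  sidon : ∀ i j k l, X i - X j = X k - X l → Y i - Y j = Y k - Y l → i ≠ j → i = k ∧ j = l
  ne : ∀ i j d₁ d₂, (i, j, d₁, d₂) ∈ E → i ≠ j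

variable {ι : Type} {M n N : ℤ} {X Y : ι → ℤ} {E : Finset (ι × ι × ℤ × ℤ)}

lemma decomp {M x : ℤ} (hM : 0 < M) (hx : 0 ≤ x) :
    ∃ k s : ℤ, 0 ≤ k ∧ 0 ≤ s ∧ s < M ∧ x = M * k + s :=
  ⟨x / M, x % M, Int.ediv_nonneg hx hM.le, Int.emod_nonneg _ hM.ne', Int.emod_lt_of_pos _ hM,
    (Int.mul_ediv_add_emod x M).symm⟩

/-- a residue below `2n` reduces to one below `n` by subtracting an element of `{0,n}` -/
lemma low {n x : ℤ} (h0 : 0 ≤ x) (h : x < 2 * n) :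
    ∃ q t : ℤ, (q = 0 ∨ q = n) ∧ x = q + t ∧ 0 ≤ t ∧ t < n := by
  by_cases hx : x < n
  · exact ⟨0, x, by omega, by omega, by omega, by omega⟩
  · exact ⟨n, x - n, by omega, by omega, by omega, by omega⟩

/-- every non-Q residue has a base move to a Q residue. -/
lemma exists_move (H : Good M n N X Y E) {x y : ℤ} (hx0 : 0 ≤ x) (hx : x < M) (hy0 : 0 ≤ y)
    (hy : y < M) (hq : ¬ ((x = 0 ∨ x = n) ∧ (y = 0 ∨ y = n))) :
    ∃ a b q q' : ℤ, (a, b, 0) ∈ gB M n X Y ∧ (q = 0 ∨ q = n) ∧ (q' = 0 ∨ q' = n) ∧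
      x = q + a ∧ y = q' + b := by
  obtain ⟨hM, hN, hn, X0, X1, Y0, Y1, anti, inj, sidon, ne⟩ := H
  -- membership criterion
  have key : ∀ a b : ℤ, 0 ≤ a → a < M → 0 ≤ b → b < M →
      ¬ ((a = 0 ∨ a = n ∨ a = n + N) ∧ (b = 0 ∨ b = n ∨ b = n + N)) →
      ¬ ((a < N ∨ 2 * n < a) ∧ (b < N ∨ 2 * n < b) ∧ ¬ (a < N ∧ b < N) ∧
        ¬ (2 * n < a ∧ 2 * n < b)) → (a, b, (0:ℤ)) ∈ gB M n X Y := by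
    intro a b ha ha' hb hb' h1 h2
    rw [mem_gB]
    refine ⟨⟨⟨ha, ha'⟩, ⟨hb, hb'⟩, rfl⟩, ?_, ?_⟩
    · rintro ⟨h3, h4⟩
      exact h1 ⟨DD_bdd hM hN hn h3 ha ha', DD_bdd hM hN hn h4 hb hb'⟩
    · rintro ⟨i, j, k, l, h3, h4⟩
      have := X0 i; have := X1 i; have := Y0 i; have := Y1 i
      have := X0 j; have := X1 j; have := Y0 j; have := Y1 j
      have h3' := gd_bdd hM hN hn h3 ha ha' (by omega) (by omega)
      have h4' := gd_bdd hM hN hn h4 hb hb' (by omega) (by omega)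
      have a1 := anti i j
      have a2 := anti j i
      by_cases hij : i = j
      · subst hij
        omega
      · have a1 : ¬ (X i ≤ X j ∧ Y i ≤ Y j) := fun h => hij (a1 h.1 h.2)
        have a2 : ¬ (X j ≤ X i ∧ Y j ≤ Y i) := fun h => hij (a2 h.1 h.2).symm
        omega
  by_cases hx2 : x < 2 * n
  · obtain ⟨q, t, hq1, hq2, hq3, hq4⟩ := low hx0 hx2
    by_cases hy2 : y < 2 * n
    · obtain ⟨q', t', hq1', hq2', hq3', hq4'⟩ := low hy0 hy2
      exact ⟨t, t', q, q', key _ _ (by omega) (by omega) (by omega) (by omega) (by omega) (by omega),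
        hq1, hq1', hq2, hq2'⟩
    · by_cases hs : t = 0 ∧ y = 2 * n
      · exact ⟨t, y, q, 0, key _ _ (by omega) (by omega) (by omega) (by omega) (by omega) (by omega),
          hq1, Or.inl rfl, hq2, by omega⟩
      · exact ⟨t, y - n, q, n, key _ _ (by omega) (by omega) (by omega) (by omega) (by omega)
          (by omega), hq1, Or.inr rfl, hq2, by omega⟩
  · by_cases hy2 : y < 2 * n
    · obtain ⟨q', t', hq1', hq2', hq3', hq4'⟩ := low hy0 hy2
      by_cases hs : t' = 0 ∧ x = 2 * n
      · exact ⟨x, t', 0, q', key _ _ (by omega) (by omega) (by omega) (by omega) (by omega) (by omega),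
          Or.inl rfl, hq1', by omega, hq2'⟩
      · exact ⟨x - n, t', n, q', key _ _ (by omega) (by omega) (by omega) (by omega) (by omega)
          (by omega), Or.inr rfl, hq1', by omega, hq2'⟩
    · exact ⟨x, y, 0, 0, key _ _ (by omega) (by omega) (by omega) (by omega) (by omega) (by omega),
        Or.inl rfl, Or.inl rfl, by omega, by omega⟩

lemma layer_moves (H : Good M n N X Y E) {a b : ℤ} (h : (a, b, (0:ℤ)) ∈ gG M n X Y E) :
    ¬ (DD M n a ∧ DD M n b) := by
  rw [mem_gG] at h
  rcases h with h | h | h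
  · exact ((mem_gB _ _ _ _ _ _ _).1 h).2.1
  · obtain ⟨i, j, d₁, d₂, hE, ha, hb, -⟩ := (mem_gW _ _ _ _ _ _ _).1 h
    rintro ⟨h1, -⟩
    rw [ha] at h1
    have h1 := DD_small H.hM H.hN H.hn (DD_shift h1)
    have := H.X0 i; have := H.X1 i
    have := H.X0 j; have := H.X1 j
    exact H.ne _ _ _ _ hE (H.inj i j (by omega))
  · have := ((mem_gT _ _ _ _ _ _ _).1 h).1.2.2
    omega

lemma gG_z {γ : ℤ × ℤ × ℤ} (h : γ ∈ gG M n X Y E) : γ.2.2 = 0 ∨ γ.2.2 = 1 := by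
  obtain ⟨a, b, c⟩ := γ
  rw [mem_gG] at h
  rcases h with h | h | h
  · exact Or.inl ((mem_gB _ _ _ _ _ _ _).1 h).1.2.2
  · obtain ⟨i, j, d₁, d₂, hE, ha, hb, hc⟩ := (mem_gW _ _ _ _ _ _ _).1 h
    exact Or.inl hc
  · exact Or.inr ((mem_gT _ _ _ _ _ _ _).1 h).1.2.2

lemma mem_board {x y z : ℤ} : (x, y, z) ∈ board3 ↔ 0 ≤ x ∧ 0 ≤ y ∧ 0 ≤ z := Iff.rfl

lemma layer0 (H : Good M n N X Y E) (hp : PointedRuleset (gG M n X Y E))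
    {P : Set (ℤ × ℤ × ℤ)} (hP : PPosProperty (gG M n X Y E) P) :
    ∀ x y : ℤ, 0 ≤ x → 0 ≤ y → ((x, y, (0:ℤ)) ∈ P ↔ QQ M n x ∧ QQ M n y) := by
  obtain ⟨φ, hφ, h1, h2, h3⟩ := hp
  have hM0 : 0 < M := by have := H.hM; have := H.hN; have := H.hn; omega
  have hlin : ∀ x y : ℤ, φ (x, y, 0) = x * φ (1, 0, 0) + y * φ (0, 1, 0) := by
    intro x y
    have : ((x, y, 0) : ℤ × ℤ × ℤ) = x • (1, 0, 0) + y • (0, 1, 0) := by simp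
    rw [this, map_add, map_smul, map_smul, smul_eq_mul, smul_eq_mul]
  have main : ∀ m : ℕ, ∀ x y : ℤ, 0 ≤ x → 0 ≤ y → φ (x, y, 0) < m →
      ((x, y, (0:ℤ)) ∈ P ↔ QQ M n x ∧ QQ M n y) := by
    intro m
    induction m with
    | zero =>
      intro x y hx hy h
      rw [hlin] at h
      push_cast at h
      have := mul_nonneg hx h1.le
      have := mul_nonneg hy h2.le
      omega
    | succ m ih =>
      intro x y hx hy h
      have ih' : ∀ a b : ℤ, (a, b, (0:ℤ)) ∈ gG M n X Y E → 0 ≤ x - a → 0 ≤ y - b →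
          ((x - a, y - b, (0:ℤ)) ∈ P ↔ QQ M n (x - a) ∧ QQ M n (y - b)) := by
        intro a b hab ha hb
        apply ih _ _ ha hb
        have := hφ _ hab
        rw [hlin] at this h ⊢
        push_cast at h
        have e : (x - a) * φ (1, 0, 0) + (y - b) * φ (0, 1, 0) =
          (x * φ (1, 0, 0) + y * φ (0, 1, 0)) - (a * φ (1, 0, 0) + b * φ (0, 1, 0)) := by ring
        rw [e]
        omega
      rw [hP.2 _ (mem_board.2 ⟨hx, hy, le_rfl⟩)]
      constructor
      · intro hall
        by_contra hq
        obtain ⟨k, s, hk, hs, hs', rfl⟩ := decomp hM0 hx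
        obtain ⟨l, t, hl, ht, ht', rfl⟩ := decomp hM0 hy
        obtain ⟨a, b, q, q', hB, hq1, hq2, hsa, htb⟩ := exists_move H hs hs' ht ht' (by
          rintro ⟨h1, h2⟩
          refine hq ⟨⟨k, by omega⟩, ⟨l, by omega⟩⟩)
        have hG : (a, b, (0:ℤ)) ∈ gG M n X Y E := (mem_gG _ _ _ _ _ _).2 (Or.inl hB)
        have hk' := mul_nonneg hM0.le hk
        have hl' := mul_nonneg hM0.le hl
        have := H.hn
        have := H.hN
        have hxa : 0 ≤ M * k + s - a := by omega
        have hyb : 0 ≤ M * l + t - b := by omega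
        refine hall _ hG ?_ ?_
        · exact mem_board.2 ⟨hxa, hyb, by simp⟩
        · have := (ih' a b hG hxa hyb).2 ⟨⟨k, by omega⟩, ⟨l, by omega⟩⟩
          simpa using this
      · rintro ⟨hqx, hqy⟩ ⟨a, b, c⟩ hγ hbd hmem
        have hc : c = 0 := by
          have hz := gG_z hγ
          have h0c : (0:ℤ) ≤ 0 - c := (mem_board.1 hbd).2.2
          simp only at hz
          omega
        subst hc
        have hxa := (mem_board.1 hbd).1
        have hyb := (mem_board.1 hbd).2.1
        have hmem' : (x - a, y - b, (0:ℤ)) ∈ P := by simpa using hmem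
        have := (ih' a b hγ hxa hyb).1 hmem'
        exact layer_moves H hγ ⟨QQ_sub hqx this.1, QQ_sub hqy this.2⟩
  intro x y hx hy
  refine main ((φ (x, y, 0)).toNat + 1) x y hx hy ?_
  push_cast
  have := Int.self_le_toNat (φ (x, y, 0))
  omega

/-- The layer-1 non-gates are all outside `P`. -/
lemma layer1_nongate (H : Good M n N X Y E) (hp : PointedRuleset (gG M n X Y E))
    {P : Set (ℤ × ℤ × ℤ)} (hP : PPosProperty (gG M n X Y E) P)
    {x y : ℤ} (hx : 0 ≤ x) (hy : 0 ≤ y) (h : (x, y, (1:ℤ)) ∈ P) :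
    ∃ i, ∃ k l : ℤ, 0 ≤ k ∧ 0 ≤ l ∧ x = 2 * n + X i + M * k ∧ y = 2 * n + Y i + M * l := by
  have h0 := layer0 H hp hP
  have hM := H.hM
  have hN := H.hN
  have hn := H.hn
  have hM0 : 0 < M := by omega
  obtain ⟨k, s, hk, hs, hs', rfl⟩ := decomp hM0 hx
  obtain ⟨l, t, hl, ht, ht', rfl⟩ := decomp hM0 hy
  have hk' := mul_nonneg hM0.le hk
  have hl' := mul_nonneg hM0.le hl
  have hall := (hP.2 _ (mem_board.2 ⟨hx, hy, by omega⟩)).1 h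
  have key : ∀ q q' a b : ℤ, (q = 0 ∨ q = n) → (q' = 0 ∨ q' = n) → s = q + a → t = q' + b →
      0 ≤ a → 0 ≤ b →
      (∀ i, ¬ (QQ M n (2 * n + X i - a) ∧ QQ M n (2 * n + Y i - b))) → False := by
    intro q q' a b hq hq' hs1 ht1 ha hb hi
    have hG : (a, b, (1:ℤ)) ∈ gG M n X Y E := by
      rw [mem_gG, mem_gT]
      exact Or.inr (Or.inr ⟨⟨⟨ha, by omega⟩, ⟨hb, by omega⟩, rfl⟩, hi⟩)
    have hxa : 0 ≤ M * k + s - a := by omega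
    have hyb : 0 ≤ M * l + t - b := by omega
    refine hall _ hG (mem_board.2 ⟨hxa, hyb, by simp⟩) ?_
    have := (h0 _ _ hxa hyb).2 ⟨⟨k, by omega⟩, ⟨l, by omega⟩⟩
    simpa using this
  by_cases hs2 : s < 2 * n
  · exfalso
    obtain ⟨q, u, hq1, hq2, hq3, hq4⟩ := low hs hs2
    refine key q 0 u t hq1 (Or.inl rfl) hq2 (by omega) hq3 ht ?_
    rintro i ⟨hi, -⟩
    have := H.X0 i
    have := H.X1 i
    exact QQ_mid hM hN hn hi (by omega) (by omega)
  by_cases ht2 : t < 2 * n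
  · exfalso
    obtain ⟨q, u, hq1, hq2, hq3, hq4⟩ := low ht ht2
    refine key 0 q s u (Or.inl rfl) hq1 (by omega) hq2 hs hq3 ?_
    rintro i ⟨-, hi⟩
    have := H.Y0 i
    have := H.Y1 i
    exact QQ_mid hM hN hn hi (by omega) (by omega)
  by_contra hcon
  refine key 0 0 s t (Or.inl rfl) (Or.inl rfl) (by omega) (by omega) hs ht ?_
  rintro i ⟨h1, h2⟩
  have := H.X0 i
  have := H.X1 i
  have := H.Y0 i
  have := H.Y1 i
  have e1 := QQ_small hM hN hn h1 (by omega) (by omega)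
  have e2 := QQ_small hM hN hn h2 (by omega) (by omega)
  exact hcon ⟨i, k, l, hk, hl, by omega, by omega⟩

lemma eq_of_mod {u v k l : ℤ} (hM : M = 2 * n + N) (hN : 0 < N) (hn : N < n)
    (hu : -N < u) (hu' : u < N) (hv : -N < v) (hv' : v < N) (h : u + M * k = v + M * l) :
    u = v ∧ k = l := by
  have e : M * (k - l) = M * k - M * l := by ring
  rcases mk_cases (by omega : 0 < M) (k - l) with h | h | h | h <;> omega

/-- Gates compute the NOR of their wires. -/
lemma gate_eq (H : Good M n N X Y E) (hp : PointedRuleset (gG M n X Y E))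
    {P : Set (ℤ × ℤ × ℤ)} (hP : PPosProperty (gG M n X Y E) P) (i : ι)
    {k l : ℤ} (hk : 0 ≤ k) (hl : 0 ≤ l) :
    ((2 * n + X i + M * k, 2 * n + Y i + M * l, (1:ℤ)) ∈ P ↔
      ∀ j d₁ d₂, (i, j, d₁, d₂) ∈ E → 0 ≤ k - d₁ → 0 ≤ l - d₂ →
        (2 * n + X j + M * (k - d₁), 2 * n + Y j + M * (l - d₂), (1:ℤ)) ∉ P) := by
  have hM := H.hM
  have hN := H.hN
  have hn := H.hn
  have hM0 : 0 < M := by omega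
  have hk' := mul_nonneg hM0.le hk
  have hl' := mul_nonneg hM0.le hl
  have X0i := H.X0 i
  have X1i := H.X1 i
  have Y0i := H.Y0 i
  have Y1i := H.Y1 i
  rw [hP.2 _ (mem_board.2 ⟨by omega, by omega, by omega⟩)]
  constructor
  · intro hall j d₁ d₂ hE hd₁ hd₂
    have := hall (X i - X j + M * d₁, Y i - Y j + M * d₂, 0)
      ((mem_gG _ _ _ _ _ _).2 (Or.inr (Or.inl ((mem_gW _ _ _ _ _ _ _).2
        ⟨i, j, d₁, d₂, hE, rfl, rfl, rfl⟩))))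
    have e : ((2 * n + X i + M * k, 2 * n + Y i + M * l, (1:ℤ)) -
      (X i - X j + M * d₁, Y i - Y j + M * d₂, (0:ℤ)) : ℤ × ℤ × ℤ) =
      (2 * n + X j + M * (k - d₁), 2 * n + Y j + M * (l - d₂), (1:ℤ)) := by
      ext
      · simp only [Prod.fst_sub]; ring
      · simp only [Prod.fst_sub, Prod.snd_sub]; ring
      · simp only [Prod.snd_sub]; ring
    rw [e] at this
    apply this
    have := mul_nonneg hM0.le hd₁
    have := mul_nonneg hM0.le hd₂
    have := H.X0 j
    have := H.Y0 j
    exact mem_board.2 ⟨by omega, by omega, by omega⟩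
  · intro hall ⟨a, b, c⟩ hγ hbd hmem
    have hxa := (mem_board.1 hbd).1
    have hyb := (mem_board.1 hbd).2.1
    rcases (mem_gG _ _ _ _ _ _).1 hγ with h | h | h
    · rw [mem_gB] at h
      obtain ⟨⟨-, -, rfl⟩, -, hno⟩ := h
      have hmem' : (2 * n + X i + M * k - a, 2 * n + Y i + M * l - b, (1:ℤ)) ∈ P := by
        simpa using hmem
      obtain ⟨j, k', l', -, -, e1, e2⟩ := layer1_nongate H hp hP hxa hyb hmem'
      apply hno
      refine ⟨i, j, k - k', l - l', ?_, ?_⟩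
      · linear_combination -e1
      · linear_combination -e2
    · rw [mem_gW] at h
      obtain ⟨i', j', d₁, d₂, hE, ha, hb, rfl⟩ := h
      have hmem' : (2 * n + X i + M * k - a, 2 * n + Y i + M * l - b, (1:ℤ)) ∈ P := by
        simpa using hmem
      obtain ⟨j, k', l', hk0, hl0, e1, e2⟩ := layer1_nongate H hp hP hxa hyb hmem'
      have := H.X0 j; have := H.X1 j; have := H.Y0 j; have := H.Y1 j
      have := H.X0 i'; have := H.X1 i'; have := H.Y0 i'; have := H.Y1 i'
      have := H.X0 j'; have := H.X1 j'; have := H.Y0 j'; have := H.Y1 j'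
      have E1 : (X i' - X j') + M * d₁ = (X i - X j) + M * (k - k') := by
        linear_combination -e1 - ha
      have E2 : (Y i' - Y j') + M * d₂ = (Y i - Y j) + M * (l - l') := by
        linear_combination -e2 - hb
      obtain ⟨F1, G1⟩ := eq_of_mod hM hN hn (by omega) (by omega) (by omega) (by omega) E1
      obtain ⟨F2, G2⟩ := eq_of_mod hM hN hn (by omega) (by omega) (by omega) (by omega) E2
      obtain ⟨rfl, rfl⟩ := H.sidon _ _ _ _ F1 F2 (H.ne _ _ _ _ hE)
      subst G1 G2
      refine hall _ _ _ hE (by omega) (by omega) ?_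
      rw [e1, e2] at hmem'
      simpa using hmem'
    · rw [mem_gT] at h
      obtain ⟨⟨-, -, rfl⟩, hno⟩ := h
      have hmem' : (2 * n + X i + M * k - a, 2 * n + Y i + M * l - b, (0:ℤ)) ∈ P := by
        simpa using hmem
      obtain ⟨q1, q2⟩ := (layer0 H hp hP _ _ hxa hyb).1 hmem'
      rw [show 2 * n + X i + M * k - a = M * k + (2 * n + X i - a) by ring, QQ_shift] at q1
      rw [show 2 * n + Y i + M * l - b = M * l + (2 * n + Y i - b) by ring, QQ_shift] at q2
      exact hno i ⟨q1, q2⟩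

lemma two_pow_sidon {i j k l : ℕ} (h : 2 ^ i + 2 ^ l = 2 ^ k + 2 ^ j) (hij : i ≠ j) :
    i = k ∧ j = l := by
  have key : ∀ a b c d : ℕ, 2 ^ a + 2 ^ b = 2 ^ c + 2 ^ d → ¬ (c < a ∧ d < a) := by
    rintro a b c d h ⟨hc, hd⟩
    have h1 : 2 ^ (c + 1) ≤ 2 ^ a := Nat.pow_le_pow_right (by norm_num) hc
    have h2 : 2 ^ (d + 1) ≤ 2 ^ a := Nat.pow_le_pow_right (by norm_num) hd
    have h3 : 0 < 2 ^ b := by positivity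
    rw [pow_succ] at h1 h2
    omega
  have inj : ∀ a b : ℕ, 2 ^ a = 2 ^ b → a = b := fun a b h => Nat.pow_right_injective le_rfl h
  have k1 := key i l k j h
  have k2 := key l i k j (by omega)
  have k3 := key k j i l (by omega)
  have k4 := key j k i l (by omega)
  by_cases hik : i = k
  · subst hik
    exact ⟨rfl, (inj _ _ (by omega)).symm⟩
  · by_cases hjl : j = l
    · subst hjl
      exact ⟨inj _ _ (by omega), rfl⟩
    · exfalso
      by_cases hkl : k = l
      · subst hkl
        exact hij (inj _ _ (by omega))
      · omega

/-- Any finite acyclic NOR network with positive delays can be realised by a game. -/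
lemma network {ι : Type} [Fintype ι] (E : Finset (ι × ι × ℤ × ℤ)) (lev : ι → ℕ)
    (c₁ c₂ : ℤ) (hc₁ : 0 < c₁) (hc₂ : 0 < c₂)
    (hne : ∀ i j d₁ d₂, (i, j, d₁, d₂) ∈ E → i ≠ j)
    (hE : ∀ i j d₁ d₂, (i, j, d₁, d₂) ∈ E →
      (d₁ = 0 ∧ d₂ = 0 ∧ lev j < lev i) ∨ 0 < c₁ * d₁ + c₂ * d₂) :
    ∃ (M : ℕ) (A : ι → ℤ × ℤ) (Γ : Finset (ℤ × ℤ × ℤ)), 0 < M ∧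
      (∀ i, 0 ≤ (A i).1 ∧ 0 ≤ (A i).2) ∧ PointedRuleset Γ ∧
      ∀ P, PPosProperty Γ P → ∀ i, ∀ k l : ℤ, 0 ≤ k → 0 ≤ l →
        (((A i).1 + M * k, (A i).2 + M * l, (1:ℤ)) ∈ P ↔
          ∀ j d₁ d₂, (i, j, d₁, d₂) ∈ E → 0 ≤ k - d₁ → 0 ≤ l - d₂ →
            ((A j).1 + M * (k - d₁), (A j).2 + M * (l - d₂), (1:ℤ)) ∉ P) := by
  classical
  -- ranks
  let e := Fintype.equivFin ι
  let m := Fintype.card ι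
  let ρ : ι → ℕ := fun i => lev i * m + (e i : ℕ)
  have hρlt : ∀ i j, lev i < lev j → ρ i < ρ j := by
    intro i j h
    have h1 : (e i : ℕ) < m := (e i).2
    have h2 : (lev i + 1) * m ≤ lev j * m := Nat.mul_le_mul_right _ h
    have h3 : (lev i + 1) * m = lev i * m + m := by ring
    show lev i * m + (e i : ℕ) < lev j * m + (e j : ℕ)
    omega
  have hρinj : ∀ i j, ρ i = ρ j → i = j := by
    intro i j h
    rcases lt_trichotomy (lev i) (lev j) with h1 | h1 | h1
    · have := hρlt _ _ h1; omega
    · have : (e i : ℕ) = (e j : ℕ) := by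
        have h' : lev i * m + (e i : ℕ) = lev j * m + (e j : ℕ) := h
        rw [h1] at h'
        omega
      exact e.injective (Fin.ext this)
    · have := hρlt _ _ h1; omega
  obtain ⟨K, hK⟩ : ∃ K : ℕ, ∀ i, ρ i < K :=
    ⟨Finset.univ.sup ρ + 1, fun i => Nat.lt_succ_of_le (Finset.le_sup (Finset.mem_univ i))⟩
  let t : ι → ℤ := fun i => 2 ^ ρ i
  let T : ℤ := 2 ^ K
  have ht0 : ∀ i, 0 < t i := fun i => by show (0:ℤ) < 2 ^ ρ i; positivity
  have htT : ∀ i, t i < T := fun i => pow_lt_pow_right₀ (by norm_num) (hK i)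
  have htlt : ∀ i j, ρ i < ρ j → t i < t j := fun i j h => pow_lt_pow_right₀ (by norm_num) h
  have htinj : ∀ i j, t i = t j → i = j := by
    intro i j h
    apply hρinj
    rcases lt_trichotomy (ρ i) (ρ j) with h1 | h1 | h1
    · have := htlt _ _ h1; omega
    · exact h1
    · have := htlt _ _ h1; omega
  have hsid : ∀ i j k l, t i - t j = t k - t l → i ≠ j → i = k ∧ j = l := by
    intro i j k l h hij
    have h' : (2:ℤ) ^ ρ i + 2 ^ ρ l = 2 ^ ρ k + 2 ^ ρ j := by
      have : (2:ℤ) ^ ρ i - 2 ^ ρ j = 2 ^ ρ k - 2 ^ ρ l := h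
      linarith
    have h'' : (2:ℕ) ^ ρ i + 2 ^ ρ l = 2 ^ ρ k + 2 ^ ρ j := by exact_mod_cast h'
    obtain ⟨h1, h2⟩ := two_pow_sidon h'' (fun h => hij (hρinj _ _ h))
    exact ⟨hρinj _ _ h1, hρinj _ _ h2⟩
  have hT : 0 < T := by show (0:ℤ) < 2 ^ K; positivity
  obtain ⟨C, hC⟩ : ∃ C : ℤ, C = c₂ + 1 := ⟨_, rfl⟩
  have hC0 : 0 < C := by omega
  obtain ⟨N, hN⟩ : ∃ N : ℤ, N = C * T := ⟨_, rfl⟩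
  have hN0 : 0 < N := by rw [hN]; positivity
  have hTN : T ≤ N := by rw [hN]; nlinarith
  obtain ⟨n, hn⟩ : ∃ n : ℤ, n = (c₁ + 1) * N := ⟨_, rfl⟩
  have hnN : N < n := by rw [hn]; nlinarith
  obtain ⟨M, hM⟩ : ∃ M : ℤ, M = 2 * n + N := ⟨_, rfl⟩
  have hM0 : 0 < M := by omega
  let X : ι → ℤ := fun i => C * t i
  let Y : ι → ℤ := fun i => T - t i
  have hX : ∀ i, X i = C * t i := fun _ => rfl
  have hY : ∀ i, Y i = T - t i := fun _ => rfl
  have H : Good M n N X Y E := by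
    refine ⟨hM, hN0, hnN, ?_, ?_, ?_, ?_, ?_, ?_, ?_, hne⟩
    · intro i; rw [hX]; have := ht0 i; positivity
    · intro i; rw [hX, hN]; exact mul_lt_mul_of_pos_left (htT i) hC0
    · intro i; rw [hY]; have := htT i; omega
    · intro i; rw [hY]; have := ht0 i; omega
    · intro i j h1 h2
      rw [hX, hX] at h1
      rw [hY, hY] at h2
      have := le_of_mul_le_mul_left h1 hC0
      exact htinj _ _ (by omega)
    · intro i j h1
      rw [hX, hX] at h1
      exact htinj _ _ (mul_left_cancel₀ hC0.ne' h1)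
    · intro i j k l _ h2 hij
      simp only [hY] at h2
      have := hsid j i l k (by omega) hij.symm
      exact ⟨this.2, this.1⟩
  have hp : PointedRuleset (gG M n X Y E) := by
    let φ : (ℤ × ℤ × ℤ) →ₗ[ℤ] ℤ :=
      c₁ • LinearMap.fst ℤ ℤ (ℤ × ℤ) +
      c₂ • (LinearMap.fst ℤ ℤ ℤ ∘ₗ LinearMap.snd ℤ ℤ (ℤ × ℤ)) +
      (LinearMap.snd ℤ ℤ ℤ ∘ₗ LinearMap.snd ℤ ℤ (ℤ × ℤ))
    have hφ : ∀ x y z, φ (x, y, z) = c₁ * x + c₂ * y + z := by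
      intro x y z
      simp [φ]
    refine ⟨φ, ?_, by rw [hφ]; omega, by rw [hφ]; omega, by rw [hφ]; omega⟩
    rintro ⟨a, b, c⟩ h
    rw [hφ]
    rcases (mem_gG _ _ _ _ _ _).1 h with h | h | h
    · rw [mem_gB] at h
      obtain ⟨⟨⟨ha, -⟩, ⟨hb, -⟩, rfl⟩, hD, -⟩ := h
      by_cases ha0 : a = 0
      · by_cases hb0 : b = 0
        · exact absurd ⟨⟨0, by omega⟩, ⟨0, by omega⟩⟩ hD
        · have : 0 < c₂ * b := mul_pos hc₂ (by omega)
          have : 0 ≤ c₁ * a := by positivity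
          omega
      · have : 0 < c₁ * a := mul_pos hc₁ (by omega)
        have : 0 ≤ c₂ * b := by positivity
        omega
    · rw [mem_gW] at h
      obtain ⟨i, j, d₁, d₂, hEm, rfl, rfl, rfl⟩ := h
      have e1 : c₁ * (X i - X j + M * d₁) + c₂ * (Y i - Y j + M * d₂) + 0 =
        (c₁ * C - c₂) * (t i - t j) + M * (c₁ * d₁ + c₂ * d₂) := by
        rw [hX, hX, hY, hY]; ring
      rw [e1]
      have hcc : 0 < c₁ * C - c₂ := by rw [hC]; nlinarith
      rcases hE _ _ _ _ hEm with ⟨rfl, rfl, hl⟩ | hd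
      · have := htlt _ _ (hρlt _ _ hl)
        have : 0 < (c₁ * C - c₂) * (t i - t j) := mul_pos hcc (by omega)
        simpa using this
      · have h1 : M ≤ M * (c₁ * d₁ + c₂ * d₂) := by nlinarith
        have h2 : -T ≤ t i - t j := by have := ht0 i; have := htT j; omega
        have h3 : (c₁ * C - c₂) * (-T) ≤ (c₁ * C - c₂) * (t i - t j) :=
          mul_le_mul_of_nonneg_left h2 hcc.le
        have h4 : c₁ * N = c₁ * C * T := by rw [hN]; ring
        have h5 : 0 < c₂ * T := mul_pos hc₂ hT
        have h6 : n = c₁ * N + N := by rw [hn]; ring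
        have h7 : (c₁ * C - c₂) * (-T) = - (c₁ * C * T) + c₂ * T := by ring
        omega
    · rw [mem_gT] at h
      obtain ⟨⟨⟨ha, -⟩, ⟨hb, -⟩, rfl⟩, -⟩ := h
      have : 0 ≤ c₁ * a := by positivity
      have : 0 ≤ c₂ * b := by positivity
      omega
  refine ⟨M.toNat, fun i => (2 * n + X i, 2 * n + Y i), gG M n X Y E, by omega, ?_, hp, ?_⟩
  · intro i
    have := H.X0 i
    have := H.Y0 i
    constructor
    · show 0 ≤ 2 * n + X i
      omega
    · show 0 ≤ 2 * n + Y i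
      omega
  · intro P hP i k l hk hl
    rw [Int.toNat_of_nonneg hM0.le]
    exact gate_eq H hp hP i hk hl

/-- gates of the network computing `f` -/
abbrev Gt (r : ℕ) (S : Type) := Option (Fin r ⊕ (Fin r → S) ⊕ S)

end LG

theorem lattice_game_computes_recursive_function
    (S : Type) [Fintype S] [Nonempty S] (σ₀ : S)
    (r : ℕ) (hr : 1 ≤ r) (g : (Fin r → S) → S)
    (β : Fin r → ℤ × ℤ) (hβ0 : ∀ i, β i ≠ 0)
    (ψ : (ℤ × ℤ) →ₗ[ℤ] ℤ)
    (hψβ : ∀ i, 0 < ψ (β i)) (hψ1 : 0 < ψ (1, 0)) (hψ2 : 0 < ψ (0, 1))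
    (hβ1 : ∃ i, (β i).1 ≤ 0) (hβ2 : ∃ i', (β i').2 ≤ 0)
    (f : ℤ × ℤ → S)
    (hf : ∀ ℓ : ℤ × ℤ, 0 ≤ ℓ.1 → 0 ≤ ℓ.2 →
      ((∀ i, 0 ≤ (ℓ - β i).1 ∧ 0 ≤ (ℓ - β i).2) →
          f ℓ = g (fun i => f (ℓ - β i))) ∧
      ((¬ ∀ i, 0 ≤ (ℓ - β i).1 ∧ 0 ≤ (ℓ - β i).2) → f ℓ = σ₀)) :
    ∃ (s : ℕ) (enc : S → Fin s → Bool), Function.Injective enc ∧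
      ∃ m : ℕ, 0 < m ∧
        ∃ out : Fin s → ℤ × ℤ, (∀ j, 0 ≤ (out j).1 ∧ 0 ≤ (out j).2) ∧
          ∃ Γ : Finset (ℤ × ℤ × ℤ), PointedRuleset Γ ∧
            ∀ P : Set (ℤ × ℤ × ℤ), PPosProperty Γ P →
              ∀ ℓ : ℤ × ℤ, 0 ≤ ℓ.1 → 0 ≤ ℓ.2 → ∀ j : Fin s,
                (enc (f ℓ) j = true ↔
                  ((out j).1 + (m : ℤ) * ℓ.1, (out j).2 + (m : ℤ) * ℓ.2, (1 : ℤ)) ∈ P) := by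
  classical
  -- gates: `none` is constantly true, then boundary detectors, minterms, outputs
  let gT : LG.Gt r S := none
  let gn : Fin r → LG.Gt r S := fun k => some (Sum.inl k)
  let gm : (Fin r → S) → LG.Gt r S := fun c => some (Sum.inr (Sum.inl c))
  let gO : S → LG.Gt r S := fun s => some (Sum.inr (Sum.inr s))
  let lev : LG.Gt r S → ℕ := fun x => match x with
    | none => 0
    | some (Sum.inl _) => 1
    | some (Sum.inr (Sum.inl _)) => 2
    | some (Sum.inr (Sum.inr _)) => 3
  let E1 : Finset (LG.Gt r S × LG.Gt r S × ℤ × ℤ) := Finset.univ.image (fun k : Fin r => (gn k, gT, β k))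
  let E2 : Finset (LG.Gt r S × LG.Gt r S × ℤ × ℤ) := Finset.univ.image
    (fun ck : (Fin r → S) × Fin r => (gm ck.1, gO (ck.1 ck.2), β ck.2))
  let E3 : Finset (LG.Gt r S × LG.Gt r S × ℤ × ℤ) := Finset.univ.image
    (fun ck : (Fin r → S) × Fin r => (gm ck.1, gn ck.2, 0))
  let E4 : Finset (LG.Gt r S × LG.Gt r S × ℤ × ℤ) := Finset.univ.image
    (fun c : Fin r → S => (gO (g c), gm c, 0))
  let E5 : Finset (LG.Gt r S × LG.Gt r S × ℤ × ℤ) := Finset.univ.image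
    (fun k : Fin r => (gO σ₀, gn k, 0))
  let E := E1 ∪ E2 ∪ E3 ∪ E4 ∪ E5
  have hmem : ∀ i j d₁ d₂, (i, j, d₁, d₂) ∈ E ↔
      (∃ k, gn k = i ∧ gT = j ∧ β k = (d₁, d₂)) ∨
      (∃ c k, gm c = i ∧ gO (c k) = j ∧ β k = (d₁, d₂)) ∨
      (∃ c k, gm c = i ∧ gn k = j ∧ (0, 0) = (d₁, d₂)) ∨
      (∃ c, gO (g c) = i ∧ gm c = j ∧ (0, 0) = (d₁, d₂)) ∨
      (∃ k, gO σ₀ = i ∧ gn k = j ∧ (0, 0) = (d₁, d₂)) := by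
    intro i j d₁ d₂
    simp only [E, E1, E2, E3, E4, E5, Finset.mem_union, Finset.mem_image, Finset.mem_univ,
      true_and, Prod.exists, Prod.mk.injEq, or_assoc, Prod.ext_iff, Prod.fst_zero, Prod.snd_zero,
      exists_and_left, exists_and_right]
  have hψ : ∀ x y : ℤ, ψ (x, y) = ψ (1, 0) * x + ψ (0, 1) * y := by
    intro x y
    have : ((x, y) : ℤ × ℤ) = x • (1, 0) + y • (0, 1) := by simp
    rw [this, map_add, map_smul, map_smul, smul_eq_mul, smul_eq_mul]
    ring
  obtain ⟨M, A, Γ, hM, hA, hp, hnet⟩ := LG.network E lev (ψ (1, 0)) (ψ (0, 1)) hψ1 hψ2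
    (by
      intro i j d₁ d₂ h
      rw [hmem] at h
      rcases h with ⟨k, rfl, rfl, -⟩ | ⟨c, k, rfl, rfl, -⟩ | ⟨c, k, rfl, rfl, -⟩ |
        ⟨c, rfl, rfl, -⟩ | ⟨k, rfl, rfl, -⟩ <;> simp [gn, gT, gm, gO])
    (by
      intro i j d₁ d₂ h
      rw [hmem] at h
      rcases h with ⟨k, rfl, rfl, h⟩ | ⟨c, k, rfl, rfl, h⟩ | ⟨c, k, rfl, rfl, h⟩ |
        ⟨c, rfl, rfl, h⟩ | ⟨k, rfl, rfl, h⟩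
      · right; rw [← hψ, ← h]; exact hψβ k
      · right; rw [← hψ, ← h]; exact hψβ k
      · left; simp only [Prod.mk.injEq] at h; exact ⟨h.1.symm, h.2.symm, by simp [lev, gn, gm]⟩
      · left; simp only [Prod.mk.injEq] at h; exact ⟨h.1.symm, h.2.symm, by simp [lev, gO, gm]⟩
      · left; simp only [Prod.mk.injEq] at h; exact ⟨h.1.symm, h.2.symm, by simp [lev, gn, gO]⟩)
  let e := Fintype.equivFin S
  refine ⟨Fintype.card S, fun s j => decide (e.symm j ≠ s), ?_, M, hM, fun j => A (gO (e.symm j)),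
    fun j => hA _, Γ, hp, ?_⟩
  · intro s s' h
    have := congrFun h (e s)
    simpa using this
  intro P hP
  let V : LG.Gt r S → ℤ × ℤ → Prop := fun i ℓ => ((A i).1 + M * ℓ.1, (A i).2 + M * ℓ.2, (1:ℤ)) ∈ P
  have hV : ∀ i ℓ, 0 ≤ ℓ.1 → 0 ≤ ℓ.2 → (V i ℓ ↔ ∀ j d₁ d₂, (i, j, d₁, d₂) ∈ E →
      0 ≤ (ℓ - (d₁, d₂)).1 → 0 ≤ (ℓ - (d₁, d₂)).2 → ¬ V j (ℓ - (d₁, d₂))) :=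
    fun i ℓ h1 h2 => hnet P hP i ℓ.1 ℓ.2 h1 h2
  have VT : ∀ ℓ : ℤ × ℤ, 0 ≤ ℓ.1 → 0 ≤ ℓ.2 → V gT ℓ := by
    intro ℓ h1 h2
    rw [hV _ _ h1 h2]
    intro j d₁ d₂ h
    rw [hmem] at h
    simp [gn, gT, gm, gO] at h
  have Vn : ∀ (k : Fin r) (ℓ : ℤ × ℤ), 0 ≤ ℓ.1 → 0 ≤ ℓ.2 →
      (V (gn k) ℓ ↔ ¬ (0 ≤ (ℓ - β k).1 ∧ 0 ≤ (ℓ - β k).2)) := by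
    intro k ℓ h1 h2
    rw [hV _ _ h1 h2]
    constructor
    · rintro h ⟨h3, h4⟩
      exact h gT (β k).1 (β k).2 ((hmem _ _ _ _).2 (Or.inl ⟨k, rfl, rfl, rfl⟩)) h3 h4
        (VT _ h3 h4)
    · intro h j d₁ d₂ hE h3 h4
      rw [hmem] at hE
      rcases hE with ⟨k', hk, rfl, hd⟩ | ⟨c, k', hk, -⟩ | ⟨c, k', hk, -⟩ | ⟨c, hk, -⟩ | ⟨k', hk, -⟩
      · have : k' = k := by simpa [gn] using hk
        subst this
        rw [← hd] at h3 h4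
        exact absurd ⟨h3, h4⟩ h
      all_goals simp [gn, gm, gO] at hk
  have Vm : ∀ (c : Fin r → S) (ℓ : ℤ × ℤ), 0 ≤ ℓ.1 → 0 ≤ ℓ.2 →
      (V (gm c) ℓ ↔ ∀ k, (0 ≤ (ℓ - β k).1 ∧ 0 ≤ (ℓ - β k).2) ∧ ¬ V (gO (c k)) (ℓ - β k)) := by
    intro c ℓ h1 h2
    rw [hV _ _ h1 h2]
    constructor
    · intro h k
      have hb : 0 ≤ (ℓ - β k).1 ∧ 0 ≤ (ℓ - β k).2 := by
        have := h (gn k) 0 0 ((hmem _ _ _ _).2 (Or.inr (Or.inr (Or.inl ⟨c, k, rfl, rfl, rfl⟩))))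
          (by simpa using h1) (by simpa using h2)
        have e0 : ℓ - ((0:ℤ), (0:ℤ)) = ℓ := sub_zero ℓ
        rw [e0, Vn k ℓ h1 h2, not_not] at this
        exact this
      exact ⟨hb, h (gO (c k)) (β k).1 (β k).2
        ((hmem _ _ _ _).2 (Or.inr (Or.inl ⟨c, k, rfl, rfl, rfl⟩))) hb.1 hb.2⟩
    · intro h j d₁ d₂ hE h3 h4
      rw [hmem] at hE
      rcases hE with ⟨k', hk, -⟩ | ⟨c', k', hk, rfl, hd⟩ | ⟨c', k', hk, rfl, hd⟩ | ⟨c', hk, -⟩ |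
        ⟨k', hk, -⟩
      · simp [gn, gm] at hk
      · have : c' = c := by simpa [gm] using hk
        subst this
        rw [← hd]
        exact (h k').2
      · rw [← hd]
        have e0 : ℓ - ((0:ℤ), (0:ℤ)) = ℓ := sub_zero ℓ
        rw [e0, Vn k' ℓ h1 h2, not_not]
        exact (h k').1
      · simp [gO, gm] at hk
      · simp [gO, gm] at hk
  have VO : ∀ (s : S) (ℓ : ℤ × ℤ), 0 ≤ ℓ.1 → 0 ≤ ℓ.2 →
      (V (gO s) ℓ ↔ (∀ c, g c = s → ¬ V (gm c) ℓ) ∧ (s = σ₀ → ∀ k, ¬ V (gn k) ℓ)) := by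
    intro s ℓ h1 h2
    have e0 : ℓ - ((0:ℤ), (0:ℤ)) = ℓ := sub_zero ℓ
    rw [hV _ _ h1 h2]
    constructor
    · intro h
      constructor
      · intro c hc
        have := h (gm c) 0 0 ((hmem _ _ _ _).2
          (Or.inr (Or.inr (Or.inr (Or.inl ⟨c, by rw [hc], rfl, rfl⟩)))))
          (by simpa using h1) (by simpa using h2)
        rwa [e0] at this
      · intro hs k
        have := h (gn k) 0 0 ((hmem _ _ _ _).2
          (Or.inr (Or.inr (Or.inr (Or.inr ⟨k, by rw [hs], rfl, rfl⟩)))))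
          (by simpa using h1) (by simpa using h2)
        rwa [e0] at this
    · rintro ⟨ha, hb⟩ j d₁ d₂ hE h3 h4
      rw [hmem] at hE
      rcases hE with ⟨k', hk, -⟩ | ⟨c', k', hk, -⟩ | ⟨c', k', hk, -⟩ | ⟨c', hk, rfl, hd⟩ |
        ⟨k', hk, rfl, hd⟩
      · simp [gn, gO] at hk
      · simp [gm, gO] at hk
      · simp [gm, gO] at hk
      · have : g c' = s := by simpa [gO] using hk
        rw [← hd, e0]
        exact ha c' this
      · have : σ₀ = s := by simpa [gO] using hk
        rw [← hd, e0]
        exact hb this.symm k'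
  have main : ∀ N : ℕ, ∀ ℓ : ℤ × ℤ, 0 ≤ ℓ.1 → 0 ≤ ℓ.2 → ψ ℓ < N →
      ∀ s, (V (gO s) ℓ ↔ s ≠ f ℓ) := by
    intro N
    induction N with
    | zero =>
      intro ℓ h1 h2 h
      have := hψ ℓ.1 ℓ.2
      have := mul_nonneg hψ1.le h1
      have := mul_nonneg hψ2.le h2
      push_cast at h
      simp only [Prod.mk.eta] at *
      omega
    | succ N ih =>
      intro ℓ h1 h2 h s
      have ih' : ∀ k, 0 ≤ (ℓ - β k).1 → 0 ≤ (ℓ - β k).2 →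
          ∀ s, (V (gO s) (ℓ - β k) ↔ s ≠ f (ℓ - β k)) := by
        intro k h3 h4
        apply ih _ h3 h4
        rw [map_sub]
        have := hψβ k
        push_cast at h
        omega
      rw [VO s ℓ h1 h2]
      by_cases hb : ∀ i, 0 ≤ (ℓ - β i).1 ∧ 0 ≤ (ℓ - β i).2
      · have hfe := (hf ℓ h1 h2).1 hb
        have hmc : ∀ c, V (gm c) ℓ ↔ c = fun i => f (ℓ - β i) := by
          intro c
          rw [Vm c ℓ h1 h2, funext_iff]
          refine forall_congr' fun k => ?_
          rw [ih' k (hb k).1 (hb k).2, not_not]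
          exact and_iff_right (hb k)
        have hnk : ∀ k, ¬ V (gn k) ℓ := by
          intro k
          rw [Vn k ℓ h1 h2, not_not]
          exact hb k
        rw [hfe]
        constructor
        · rintro ⟨ha, -⟩ hs
          exact ha _ hs.symm ((hmc _).2 rfl)
        · intro hs
          refine ⟨?_, fun _ => hnk⟩
          intro c hc hv
          rw [hmc] at hv
          subst hv
          exact hs hc.symm
      · have hfe := (hf ℓ h1 h2).2 hb
        rw [hfe]
        have hmc : ∀ c, ¬ V (gm c) ℓ := by
          intro c hv
          rw [Vm c ℓ h1 h2] at hv
          exact hb fun k => (hv k).1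
        constructor
        · rintro ⟨-, ha⟩ hs
          apply hb
          intro k
          have := ha hs k
          rw [Vn k ℓ h1 h2, not_not] at this
          exact this
        · intro hs
          exact ⟨fun c _ => hmc c, fun h => absurd h hs⟩
  intro ℓ h1 h2 j
  have hm := main ((ψ ℓ).toNat + 1) ℓ h1 h2 (by
    have := Int.self_le_toNat (ψ ℓ)
    push_cast
    omega) (e.symm j)
  rw [decide_eq_true_iff]
  exact hm.symm
end

section
/- There is no computable function d taking as input a finite subset Γ of ℤ³ and natural numbers m, a, b and returning a Boolean, such that for every pointed finite Γ ⊆ ℤ³, every m, a, b ∈ ℕ, and every set 𝒫 ⊆ ℕ³ satisfying the P-position property for Γ, one has d(Γ, m, a, b) = true if and only if there exist i, j ∈ ℕ with (m·i + a, m·j + b, 1) ∈ 𝒫. -/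
/-! ## Stage 1: a circuit of NOR gates inside a lattice game -/

namespace LGame

/-- Existence of the set of P-positions. -/
theorem exists_ppos (Γ : Finset (ℤ × ℤ × ℤ)) (h : PointedRuleset Γ) :
    ∃ P, PPosProperty Γ P := by
  obtain ⟨φ, hφ, he1, he2, he3⟩ := h
  have hstep : ∃ P : Set (ℤ × ℤ × ℤ), ∀ p, p ∈ P ↔ (p ∈ board3 ∧
      ∀ γ ∈ Γ, 0 ≤ φ (p - γ) → p - γ ∈ board3 → p - γ ∉ P) := by
    let R : (ℤ × ℤ × ℤ) → (ℤ × ℤ × ℤ) → Prop := fun q p => (φ q).toNat < (φ p).toNat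
    have wf : WellFounded R := InvImage.wf (fun p => (φ p).toNat) Nat.lt_wfRel.wf
    let F : ∀ p, (∀ q, R q p → Prop) → Prop := fun p rec =>
      p ∈ board3 ∧ ∀ γ ∈ Γ, 0 ≤ φ (p - γ) → p - γ ∈ board3 → ∀ hq : R (p - γ) p, ¬ rec (p - γ) hq
    refine ⟨{p | wf.fix F p}, fun p => ?_⟩
    have : wf.fix F p = F p (fun q _ => wf.fix F q) := wf.fix_eq F p
    rw [Set.mem_ofPred_eq, this]
    refine and_congr_right fun hp => forall₄_congr fun γ hγ h0 hb => ?_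
    have hR : R (p - γ) p := by
      have := hφ γ hγ
      simp only [R, map_sub] at h0 ⊢
      omega
    exact ⟨fun H => H hR, fun H _ => H⟩
  obtain ⟨P, hP⟩ := hstep
  have hnn : ∀ p ∈ board3, 0 ≤ φ p := by
    rintro ⟨x, y, z⟩ ⟨hx, hy, hz⟩
    have : ((x, y, z) : ℤ × ℤ × ℤ) = x • (1, 0, 0) + y • (0, 1, 0) + z • (0, 0, 1) := by
      simp
    rw [this]
    simp only [map_add, map_zsmul, smul_eq_mul]
    simp only at hx hy hz
    positivity
  refine ⟨P, fun p hp => ((hP p).1 hp).1, fun p hp => ?_⟩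
  rw [hP p]
  exact ⟨fun H γ hγ hb => H.2 γ hγ (hnn _ hb) hb, fun H => ⟨hp, fun γ hγ _ hb => H γ hγ hb⟩⟩

theorem pow_sidon {i j k l : ℕ} (hij : i ≠ j) (h : 2 ^ i + 2 ^ l = 2 ^ k + 2 ^ j) :
    i = k ∧ l = j := by
  by_cases hik : i = k
  · subst hik
    refine ⟨rfl, ?_⟩
    have : 2 ^ l = 2 ^ j := by omega
    exact Nat.pow_right_injective (le_refl 2) this
  exfalso
  have key : ∀ a, ¬ (2 ^ a < 2 ^ l ∧ 2 ^ l < 2 * 2 ^ a) := by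
    rintro a ⟨h1, h2⟩
    rw [← pow_succ'] at h2
    have h1 := (Nat.pow_lt_pow_iff_right (by norm_num : 1 < 2)).1 h1
    have h2 := (Nat.pow_lt_pow_iff_right (by norm_num : 1 < 2)).1 h2
    omega
  have lt2 : ∀ {a b : ℕ}, a < b → 2 * 2 ^ a ≤ 2 ^ b := by
    intro a b hab
    rw [← pow_succ']
    exact Nat.pow_le_pow_right (by norm_num) hab
  have hpos : ∀ a : ℕ, 0 < 2 ^ a := fun a => by positivity
  have hi := hpos i
  have hj := hpos j
  have hk := hpos k
  have hl := hpos l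
  have kj := key j
  have kk := key k
  rcases lt_or_gt_of_ne hij with h1 | h1 <;> rcases lt_or_gt_of_ne hik with h2 | h2
  · have := lt2 h1
    have := lt2 h2
    rcases lt_trichotomy j k with h3 | h3 | h3
    · have := lt2 h3; omega
    · subst h3; omega
    · have := lt2 h3; omega
  · have := lt2 h1
    have := lt2 h2
    have k1 := key (j - 1)
    obtain ⟨j, rfl⟩ : ∃ j', j = j' + 1 := ⟨j - 1, by omega⟩
    simp only [Nat.add_sub_cancel, pow_succ] at *
    omega
  · have := lt2 h1
    have := lt2 h2
    have k1 := key (k - 1)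
    obtain ⟨k, rfl⟩ : ∃ j', k = j' + 1 := ⟨k - 1, by omega⟩
    simp only [Nat.add_sub_cancel, pow_succ] at *
    omega
  · have := lt2 h1
    have := lt2 h2
    omega

/-- position of the gate number `n` inside a block -/
def gpos (n : ℕ) : ℤ := 2 ^ (n + 2)

/-- length of a block -/
def gmod (G : ℕ) : ℤ := 2 ^ (G + 3)

theorem gpos_four (n : ℕ) : ∃ a : ℤ, gpos n = 4 * a ∧ 1 ≤ a :=
  ⟨2 ^ n, by rw [gpos, pow_add]; ring, one_le_pow₀ (by norm_num)⟩

theorem gmod_four (G : ℕ) : ∃ a : ℤ, gmod G = 4 * a ∧ 2 ≤ a :=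
  ⟨2 ^ (G + 1), by rw [gmod, pow_add, pow_add]; ring, by
    have : (1 : ℤ) ≤ 2 ^ G := one_le_pow₀ (by norm_num)
    rw [pow_succ]; omega⟩

theorem gpos_lt {n G : ℕ} (h : n < G) : 4 * gpos n ≤ gmod G := by
  have : (2 : ℤ) ^ (n + 4) ≤ 2 ^ (G + 3) := pow_le_pow_right₀ (by norm_num) (by omega)
  simp only [gpos, gmod] at *
  calc (4 : ℤ) * 2 ^ (n + 2) = 2 ^ (n + 4) := by ring
    _ ≤ _ := this

theorem gpos_mono {a b : ℕ} (h : a < b) : gpos a < gpos b :=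
  pow_lt_pow_right₀ (by norm_num) (by omega)

theorem gpos_inj {a b : ℕ} (h : gpos a = gpos b) : a = b := by
  rcases lt_trichotomy a b with h1 | h1 | h1
  · have := gpos_mono h1; omega
  · exact h1
  · have := gpos_mono h1; omega

theorem gpos_sidon {G i j k l : ℕ} (hi : i < G) (hj : j < G) (hk : k < G) (hl : l < G)
    (hij : i ≠ j) (h : gmod G ∣ (gpos i - gpos j) - (gpos k - gpos l)) : i = k ∧ j = l := by
  have h0 : (gpos i - gpos j) - (gpos k - gpos l) = 0 := by
    apply Int.eq_zero_of_abs_lt_dvd h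
    have := gpos_lt hi
    have := gpos_lt hj
    have := gpos_lt hk
    have := gpos_lt hl
    obtain ⟨a1, e1, f1⟩ := gpos_four i
    obtain ⟨a2, e2, f2⟩ := gpos_four j
    obtain ⟨a3, e3, f3⟩ := gpos_four k
    obtain ⟨a4, e4, f4⟩ := gpos_four l
    rw [abs_lt]
    constructor <;> omega
  have h1 : 2 ^ (i + 2) + 2 ^ (l + 2) = 2 ^ (k + 2) + 2 ^ (j + 2) := by
    have : gpos i + gpos l = gpos k + gpos j := by omega
    unfold gpos at this
    exact_mod_cast this
  have := pow_sidon (by omega) h1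
  omega

/-- the vector of an edge -/
def evec {ι : Type} (idx : ι → ℕ) (G : ℕ) (i j : ι) (a b : ℕ) : ℤ × ℤ × ℤ :=
  (gpos (idx i) - gpos (idx j) + gmod G * a, (b : ℤ), 0)

open Classical in
/-- the part of the rule set that does not depend on the circuit -/
noncomputable def fixedRules {ι : Type} (idx : ι → ℕ) (G : ℕ) : Finset (ℤ × ℤ × ℤ) :=
  ((Finset.Icc 2 (gmod G - 2)).filter (fun c => ¬ (4 : ℤ) ∣ c)).image (fun c => (c, 0, 0)) ∪
  ((Finset.Ico 0 (gmod G)).filter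
    (fun t => ∀ i, t ≠ gpos (idx i) ∧ t + 1 ≠ gpos (idx i))).image (fun t => (t, 0, 1))

theorem mem_fixedRules {ι : Type} (idx : ι → ℕ) (G : ℕ) (γ : ℤ × ℤ × ℤ) :
    γ ∈ fixedRules idx G ↔
      (∃ c : ℤ, 2 ≤ c ∧ c ≤ gmod G - 2 ∧ ¬ (4 : ℤ) ∣ c ∧ γ = (c, 0, 0)) ∨
      (∃ t : ℤ, 0 ≤ t ∧ t < gmod G ∧ (∀ i, t ≠ gpos (idx i) ∧ t + 1 ≠ gpos (idx i)) ∧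
        γ = (t, 0, 1)) := by
  classical
  simp only [fixedRules, Finset.mem_union, Finset.mem_image, Finset.mem_filter, Finset.mem_Icc,
    Finset.mem_Ico]
  constructor
  · rintro (⟨c, ⟨⟨h1, h2⟩, h3⟩, rfl⟩ | ⟨c, ⟨⟨h1, h2⟩, h3⟩, rfl⟩)
    · exact Or.inl ⟨c, h1, h2, h3, rfl⟩
    · exact Or.inr ⟨c, h1, h2, h3, rfl⟩
  · rintro (⟨c, h1, h2, h3, rfl⟩ | ⟨c, h1, h2, h3, rfl⟩)
    · exact Or.inl ⟨c, ⟨⟨h1, h2⟩, h3⟩, rfl⟩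
    · exact Or.inr ⟨c, ⟨⟨h1, h2⟩, h3⟩, rfl⟩

end LGame

namespace LGame

section circuit

variable {ι : Type} {idx : ι → ℕ} {G : ℕ} {Edge : ι → ι → ℕ → ℕ → Prop} {Γ : Finset (ℤ × ℤ × ℤ)}

theorem edge_pos (hlt : ∀ i, idx i < G)
    (hE : ∀ i j a b, Edge i j a b → i ≠ j ∧ (a = 0 → b = 0 → idx j < idx i)) {i j : ι} {a b : ℕ} (h : Edge i j a b) :
    0 < gpos (idx i) - gpos (idx j) + gmod G * a + gmod G * b := by
  obtain ⟨-, h2⟩ := hE _ _ _ _ h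
  have hi := gpos_lt (hlt i)
  have hj := gpos_lt (hlt j)
  obtain ⟨a1, e1, f1⟩ := gpos_four (idx i)
  obtain ⟨a2, e2, f2⟩ := gpos_four (idx j)
  by_cases h0 : a = 0 ∧ b = 0
  · have := gpos_mono (h2 h0.1 h0.2)
    simp only [h0.1, h0.2]
    push_cast
    omega
  · have h3 : (1 : ℤ) ≤ (a : ℤ) + b := by omega
    have h4 : gmod G * 1 ≤ gmod G * ((a : ℤ) + b) :=
      mul_le_mul_of_nonneg_left h3 (by omega)
    rw [mul_add] at h4
    omega

theorem circuit_pointed (hlt : ∀ i, idx i < G)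
    (hE : ∀ i j a b, Edge i j a b → i ≠ j ∧ (a = 0 → b = 0 → idx j < idx i))
    (hΓ : ∀ γ, γ ∈ Γ ↔ γ ∈ fixedRules idx G ∨
      ∃ i j a b, Edge i j a b ∧ γ = evec idx G i j a b) : PointedRuleset Γ := by
  obtain ⟨m4, hm4, hm4'⟩ := gmod_four G
  refine ⟨LinearMap.fst ℤ ℤ (ℤ × ℤ) + (gmod G) • (LinearMap.fst ℤ ℤ ℤ ∘ₗ LinearMap.snd ℤ ℤ (ℤ × ℤ))
    + (LinearMap.snd ℤ ℤ ℤ ∘ₗ LinearMap.snd ℤ ℤ (ℤ × ℤ)), ?_, ?_, ?_, ?_⟩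
  · intro γ hγ
    rcases (hΓ γ).1 hγ with h | ⟨i, j, a, b, h, rfl⟩
    · rcases (mem_fixedRules _ _ _).1 h with ⟨c, h1, h2, h3, rfl⟩ | ⟨t, h1, h2, h3, rfl⟩
      · simp; omega
      · simp; omega
    · have := edge_pos hlt hE h
      simpa [evec] using this
  all_goals simp
  omega

theorem edge_not_dvd (hlt : ∀ i, idx i < G)
    (hE : ∀ i j a b, Edge i j a b → i ≠ j ∧ (a = 0 → b = 0 → idx j < idx i)) {i j : ι} {a b : ℕ} (hinj : Function.Injective idx) (h : Edge i j a b) (e : ℤ)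
    (he : -1 ≤ e) (he' : e ≤ 1) : ¬ gmod G ∣ gpos (idx i) - gpos (idx j) + gmod G * a + e := by
  intro hd
  obtain ⟨h1, -⟩ := hE _ _ _ _ h
  have hi := gpos_lt (hlt i)
  have hj := gpos_lt (hlt j)
  obtain ⟨a1, e1, f1⟩ := gpos_four (idx i)
  obtain ⟨a2, e2, f2⟩ := gpos_four (idx j)
  obtain ⟨m4, hm4, hm4'⟩ := gmod_four G
  have hd2 : gmod G ∣ gpos (idx i) - gpos (idx j) + e := by
    have := Int.dvd_sub hd (Int.dvd_mul_right (gmod G) a)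
    convert this using 1
    ring
  have h4 : (4 : ℤ) ∣ gpos (idx i) - gpos (idx j) + e := dvd_trans ⟨m4, hm4⟩ hd2
  have he0 : e = 0 := by omega
  subst he0
  have h0 := Int.eq_zero_of_abs_lt_dvd hd2 (by rw [abs_lt]; constructor <;> omega)
  exact h1 (hinj (gpos_inj (by omega)))

theorem exists_mod (m x : ℤ) (hm : 0 < m) (hx : 0 ≤ x) :
    ∃ c, 0 ≤ c ∧ c < m ∧ c ≤ x ∧ m ∣ x - c := by
  refine ⟨x % m, Int.emod_nonneg _ (by omega), Int.emod_lt_of_pos _ hm, ?_, ?_⟩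
  · have := Int.mul_ediv_add_emod x m
    have h2 : 0 ≤ m * (x / m) := mul_nonneg hm.le (Int.ediv_nonneg hx hm.le)
    omega
  · exact Int.dvd_self_sub_emod

theorem not_dvd_of {m x : ℤ} (h0 : 0 < x) (h1 : x < m) : ¬ m ∣ x := fun h => by
  have := Int.le_of_dvd h0 h
  omega

theorem layer_zero (hinj : Function.Injective idx) (hlt : ∀ i, idx i < G)
    (hE : ∀ i j a b, Edge i j a b → i ≠ j ∧ (a = 0 → b = 0 → idx j < idx i))
    (hΓ : ∀ γ, γ ∈ Γ ↔ γ ∈ fixedRules idx G ∨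
      ∃ i j a b, Edge i j a b ∧ γ = evec idx G i j a b) {P : Set (ℤ × ℤ × ℤ)} (hP : PPosProperty Γ P) :
    ∀ x y : ℤ, 0 ≤ x → 0 ≤ y → ((x, y, 0) ∈ P ↔ gmod G ∣ x ∨ gmod G ∣ x - 1) := by
  obtain ⟨m4, hm4, hm4'⟩ := gmod_four G
  suffices H : ∀ N : ℕ, ∀ x y : ℤ, 0 ≤ x → 0 ≤ y → x + gmod G * y < N →
      ((x, y, 0) ∈ P ↔ gmod G ∣ x ∨ gmod G ∣ x - 1) by
    intro x y hx hy
    exact H (x + gmod G * y + 1).toNat x y hx hy (by omega)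
  intro N
  induction N with
  | zero =>
    intro x y hx hy h
    have : 0 ≤ gmod G * y := mul_nonneg (by omega) hy
    push_cast at h
    omega
  | succ N ih =>
    intro x y hx hy hN
    rw [hP.2 (x, y, 0) ⟨hx, hy, le_refl _⟩]
    constructor
    · intro H
      by_contra hne
      push Not at hne
      obtain ⟨c, hc0, hcm, hcx, hd⟩ := exists_mod (gmod G) x (by omega) hx
      have hc1 : c ≠ 0 := by rintro rfl; exact hne.1 (by simpa using hd)
      have hc2 : c ≠ 1 := by rintro rfl; exact hne.2 hd
      by_cases hc : (4 : ℤ) ∣ c ∨ c = gmod G - 1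
      · have hm : ((c - 1, 0, 0) : ℤ × ℤ × ℤ) ∈ Γ :=
          (hΓ _).2 (Or.inl ((mem_fixedRules _ _ _).2 (Or.inl ⟨c - 1, by omega, by omega, by omega, rfl⟩)))
        refine H _ hm ⟨?_, ?_, ?_⟩ ?_
        · simp; omega
        · simpa using hy
        · simp
        · simp only [Prod.mk_sub_mk, sub_zero]
          refine (ih _ _ (by omega) hy (by push_cast at hN; omega)).2 (Or.inr ?_)
          convert hd using 1
          ring
      · have hm : ((c, 0, 0) : ℤ × ℤ × ℤ) ∈ Γ :=
          (hΓ _).2 (Or.inl ((mem_fixedRules _ _ _).2 (Or.inl ⟨c, by omega, by omega, by omega, rfl⟩)))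
        refine H _ hm ⟨?_, ?_, ?_⟩ ?_
        · simp; omega
        · simpa using hy
        · simp
        · simp only [Prod.mk_sub_mk, sub_zero]
          exact (ih _ _ (by omega) hy (by push_cast at hN; omega)).2 (Or.inl hd)
    · intro hx1 γ hγ hb hin
      -- in each case the first coordinate of `γ` plus a number in `[-1, 1]` is divisible
      have aux : ∀ s : ℤ, (gmod G ∣ x - s ∨ gmod G ∣ x - s - 1) →
          ∃ e, -1 ≤ e ∧ e ≤ 1 ∧ gmod G ∣ s + e := by
        intro s hs
        rcases hx1 with h1 | h1 <;> rcases hs with h2 | h2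
        · exact ⟨0, by norm_num, by norm_num, by convert Int.dvd_sub h1 h2 using 1; ring⟩
        · exact ⟨1, by norm_num, by norm_num, by convert Int.dvd_sub h1 h2 using 1; ring⟩
        · exact ⟨-1, by norm_num, by norm_num, by convert Int.dvd_sub h1 h2 using 1; ring⟩
        · exact ⟨0, by norm_num, by norm_num, by convert Int.dvd_sub h1 h2 using 1; ring⟩
      rcases (hΓ γ).1 hγ with h | ⟨i, j, a, b, h, rfl⟩
      · rcases (mem_fixedRules _ _ _).1 h with ⟨c, h1, h2, h3, rfl⟩ | ⟨t, h1, h2, h3, rfl⟩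
        · simp only [Prod.mk_sub_mk, sub_zero] at hin hb
          have hb1 : 0 ≤ x - c := hb.1
          rw [ih _ _ hb1 hy (by push_cast at hN; omega)] at hin
          obtain ⟨e, he, he', hd⟩ := aux _ hin
          exact not_dvd_of (by omega) (by omega) hd
        · have := hb.2.2
          simp at this
      · have hp := edge_pos hlt hE h
        simp only [evec, Prod.mk_sub_mk, sub_zero] at hin hb
        rw [ih _ _ hb.1 hb.2.1 (by push_cast at hN; rw [mul_sub]; omega)] at hin
        obtain ⟨e, he, he', hd⟩ := aux _ hin
        exact edge_not_dvd hlt hE hinj h e he he' hd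

theorem layer_one_off (hinj : Function.Injective idx) (hlt : ∀ i, idx i < G)
    (hE : ∀ i j a b, Edge i j a b → i ≠ j ∧ (a = 0 → b = 0 → idx j < idx i))
    (hΓ : ∀ γ, γ ∈ Γ ↔ γ ∈ fixedRules idx G ∨
      ∃ i j a b, Edge i j a b ∧ γ = evec idx G i j a b) {P : Set (ℤ × ℤ × ℤ)} (hP : PPosProperty Γ P) (x y : ℤ) (hx : 0 ≤ x)
    (hy : 0 ≤ y) (hno : ∀ i, ¬ gmod G ∣ x - gpos (idx i)) : (x, y, 1) ∉ P := by
  obtain ⟨m4, hm4, hm4'⟩ := gmod_four G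
  rw [hP.2 (x, y, 1) ⟨hx, hy, by norm_num⟩]
  intro H
  obtain ⟨c, hc0, hcm, hcx, hd⟩ := exists_mod (gmod G) x (by omega) hx
  have hc : ∀ i, c ≠ gpos (idx i) := by
    rintro i rfl
    exact hno i hd
  have goal : ∀ t : ℤ, 0 ≤ t → t < gmod G → t ≤ x →
      (∀ i, t ≠ gpos (idx i) ∧ t + 1 ≠ gpos (idx i)) →
      (gmod G ∣ x - t ∨ gmod G ∣ x - t - 1) → False := by
    intro t h0 h1 h2 h3 h4
    have hm : ((t, 0, 1) : ℤ × ℤ × ℤ) ∈ Γ :=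
      (hΓ _).2 (Or.inl ((mem_fixedRules _ _ _).2 (Or.inr ⟨t, h0, h1, h3, rfl⟩)))
    refine H _ hm ⟨?_, ?_, ?_⟩ ?_
    · simp; omega
    · simpa using hy
    · simp
    · simp only [Prod.mk_sub_mk, sub_zero, sub_self]
      exact (layer_zero hinj hlt hE hΓ hP _ _ (by omega) hy).2 h4
  by_cases h1 : ∃ i, c + 1 = gpos (idx i)
  · obtain ⟨i, hi⟩ := h1
    obtain ⟨a1, e1, f1⟩ := gpos_four (idx i)
    refine goal (c - 1) (by omega) (by omega) (by omega) (fun j => ?_) (Or.inr ?_)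
    · obtain ⟨a2, e2, f2⟩ := gpos_four (idx j)
      exact ⟨by omega, by omega⟩
    · convert hd using 1
      ring
  · push Not at h1
    exact goal c hc0 hcm hcx (fun i => ⟨hc i, h1 i⟩) (Or.inl hd)

theorem circuit_rec (hinj : Function.Injective idx) (hlt : ∀ i, idx i < G)
    (hE : ∀ i j a b, Edge i j a b → i ≠ j ∧ (a = 0 → b = 0 → idx j < idx i))
    (hΓ : ∀ γ, γ ∈ Γ ↔ γ ∈ fixedRules idx G ∨
      ∃ i j a b, Edge i j a b ∧ γ = evec idx G i j a b) {P : Set (ℤ × ℤ × ℤ)} (hP : PPosProperty Γ P) (i : ι) (I J : ℕ) :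
    ((gmod G * I + gpos (idx i), (J : ℤ), (1 : ℤ)) ∈ P) ↔
      ∀ j a b, Edge i j a b → a ≤ I → b ≤ J →
        (gmod G * ((I - a : ℕ) : ℤ) + gpos (idx j), ((J - b : ℕ) : ℤ), (1 : ℤ)) ∉ P := by
  obtain ⟨m4, hm4, hm4'⟩ := gmod_four G
  have hi := gpos_lt (hlt i)
  obtain ⟨a1, e1, f1⟩ := gpos_four (idx i)
  have hI : 0 ≤ gmod G * (I : ℤ) := mul_nonneg (by omega) (by omega)
  rw [hP.2 _ ⟨by simp only; omega, by simp, by simp⟩]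
  constructor
  · intro H j a b hab ha hb
    have hm : evec idx G i j a b ∈ Γ := (hΓ _).2 (Or.inr ⟨i, j, a, b, hab, rfl⟩)
    have hj := (gpos_four (idx j))
    obtain ⟨a2, e2, f2⟩ := hj
    have heq : ((gmod G * I + gpos (idx i), (J : ℤ), (1 : ℤ)) - evec idx G i j a b : ℤ × ℤ × ℤ)
        = (gmod G * ((I - a : ℕ) : ℤ) + gpos (idx j), ((J - b : ℕ) : ℤ), (1 : ℤ)) := by
      simp only [evec, Prod.mk_sub_mk, sub_zero]
      push_cast [ha, hb]
      ring_nf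
    have := H _ hm
    rw [heq] at this
    refine this ⟨?_, ?_, ?_⟩
    · have : 0 ≤ gmod G * ((I - a : ℕ) : ℤ) := mul_nonneg (by omega) (by omega)
      simp only
      omega
    · simp
    · simp
  · intro H γ hγ hb hin
    rcases (hΓ γ).1 hγ with h | ⟨k, l, a, b, h, rfl⟩
    · rcases (mem_fixedRules _ _ _).1 h with ⟨c, h1, h2, h3, rfl⟩ | ⟨t, h1, h2, h3, rfl⟩
      · simp only [Prod.mk_sub_mk, sub_zero] at hin hb
        refine layer_one_off hinj hlt hE hΓ hP _ _ hb.1 hb.2.1 (fun j hd => ?_) hin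
        obtain ⟨a2, e2, f2⟩ := gpos_four (idx j)
        have h4 := dvd_trans ⟨m4, hm4⟩ hd
        have h5 : (4 : ℤ) ∣ gmod G * I := dvd_mul_of_dvd_left ⟨m4, hm4⟩ _
        omega
      · simp only [Prod.mk_sub_mk, sub_zero, sub_self] at hin hb
        rw [layer_zero hinj hlt hE hΓ hP _ _ hb.1 hb.2.1] at hin
        have aux : ∀ e : ℤ, 0 ≤ e → e ≤ 1 → t + e ≠ gpos (idx i) →
            gmod G ∣ gmod G * I + gpos (idx i) - t - e → False := by
          intro e he he' hne hd
          have hd2 := Int.dvd_sub hd (Int.dvd_mul_right (gmod G) I)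
          have hd3 : gmod G ∣ gpos (idx i) - t - e := by
            convert hd2 using 1
            ring
          have := Int.eq_zero_of_abs_lt_dvd hd3 (by rw [abs_lt]; constructor <;> omega)
          omega
        rcases hin with hin | hin
        · exact aux 0 le_rfl (by norm_num) (by simpa using (h3 i).1) (by simpa using hin)
        · exact aux 1 (by norm_num) le_rfl (h3 i).2 hin
    · simp only [evec, Prod.mk_sub_mk, sub_zero] at hin hb
      by_cases hg : ∃ j, gmod G ∣ gmod G * I + gpos (idx i) - (gpos (idx k) - gpos (idx l) + gmod G * a)
          - gpos (idx j)
      · obtain ⟨j, hd⟩ := hg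
        have hne := (hE _ _ _ _ h).1
        have hd2 := Int.dvd_sub hd (Int.dvd_mul_right (gmod G) (I - a))
        have hs := gpos_sidon (hlt k) (hlt l) (hlt i) (hlt j) (fun e => hne (hinj e)) (by
          rw [← Int.dvd_neg]
          convert hd2 using 1
          ring)
        have hki : k = i := hinj hs.1
        have hlj : l = j := hinj hs.2
        subst hki hlj
        have hb1 := hb.1
        have hb2 := hb.2.1
        simp only at hb1 hb2
        have hl4 := gpos_lt (hlt l)
        have haI : a ≤ I := by
          by_contra hlt'
          have h6 : gmod G * (I + 1 : ℤ) ≤ gmod G * a :=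
            mul_le_mul_of_nonneg_left (by omega) (by omega)
          rw [mul_add] at h6
          omega
        have hbJ : b ≤ J := by omega
        refine H l a b h haI hbJ ?_
        convert hin using 2
        · push_cast [haI]
          ring
        · push_cast [hbJ]
          rfl
      · push Not at hg
        exact layer_one_off hinj hlt hE hΓ hP _ _ hb.1 hb.2.1 hg hin

end circuit

end LGame

/-! ## Stage 2: a one-dimensional cellular automaton as a circuit of NOR gates -/

namespace LGame

/-- The gates needed to run a cellular automaton with set of states `A`. -/
inductive Gate (A : Type) : Type
  | one : Gate A
  | c0 : Gate A
  | c2 : Gate A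
  | n (k : Fin 3) (a : A) : Gate A
  | t (b : Fin 3 → A) : Gate A
  | w (a : A) : Gate A
  | v (a : A) : Gate A
  | hn : Gate A
  | h : Gate A

/-- The level of a gate: inside of a block, a gate only reads gates of smaller level. -/
def Gate.lev {A : Type} : Gate A → Fin 9
  | one => 0
  | c0 => 1
  | c2 => 2
  | n _ _ => 3
  | t _ => 4
  | w _ => 5
  | v _ => 6
  | hn => 7
  | h => 8

/-- auxiliary code of a gate -/
def Gate.code {A : Type} (o : A) : Gate A → Fin 9 × Fin 3 × A × (Fin 3 → A)
  | one => (0, 0, o, fun _ => o)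
  | c0 => (1, 0, o, fun _ => o)
  | c2 => (2, 0, o, fun _ => o)
  | n k a => (3, k, a, fun _ => o)
  | t b => (4, 0, o, b)
  | w a => (5, 0, a, fun _ => o)
  | v a => (6, 0, a, fun _ => o)
  | hn => (7, 0, o, fun _ => o)
  | h => (8, 0, o, fun _ => o)

theorem Gate.code_injective {A : Type} (o : A) : Function.Injective (Gate.code o) := by
  intro x y hxy
  cases x <;> cases y <;> simp [Gate.code] at hxy ⊢ <;> exact hxy

theorem Gate.finite {A : Type} [Finite A] (o : A) : Finite (Gate A) :=
  Finite.of_injective _ (Gate.code_injective o)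

/-- The wires that do not depend on the input. -/
inductive Wire {A : Type} (o X Z : A) (H : Set A) (f : (Fin 3 → A) → A) :
    Gate A → Gate A → ℕ → ℕ → Prop
  | c0a : Wire o X Z H f .c0 .one 0 1
  | c0b : Wire o X Z H f .c0 .one 1 0
  | c2a : Wire o X Z H f .c2 .one 0 1
  | c2b : Wire o X Z H f .c2 .c0 0 0
  | n (k : Fin 3) (a : A) : Wire o X Z H f (.n k a) (.v a) k 1
  | tn (b : Fin 3 → A) (k : Fin 3) (h : b k ≠ o) : Wire o X Z H f (.t b) (.n k (b k)) 0 0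
  | tv (b : Fin 3 → A) (k : Fin 3) (a : A) (h : a ≠ o) (h' : a ≠ b k) :
      Wire o X Z H f (.t b) (.v a) k 1
  | wt (b : Fin 3 → A) : Wire o X Z H f (.w (f b)) (.t b) 0 0
  | wX : Wire o X Z H f (.w X) .c0 0 0
  | wZ : Wire o X Z H f (.w Z) .c2 0 0
  | v (a : A) : Wire o X Z H f (.v a) (.w a) 0 0
  | hn (a : A) (h : a ∈ H) : Wire o X Z H f .hn (.v a) 0 0
  | h : Wire o X Z H f .h .hn 0 0

/-- All wires. -/
def WireL {A : Type} (o X Z : A) (H : Set A) (f : (Fin 3 → A) → A) (L : ℕ)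
    (i j : Gate A) (a b : ℕ) : Prop :=
  Wire o X Z H f i j a b ∨ (i = .c2 ∧ j = .one ∧ a = L ∧ b = 0)

theorem wire_lev {A : Type} {o X Z : A} {H : Set A} {f : (Fin 3 → A) → A} {i j : Gate A} {a b : ℕ}
    (h : Wire o X Z H f i j a b) : i ≠ j ∧ (a = 0 → b = 0 → j.lev < i.lev) ∧ a < 3 ∧ b < 2 := by
  cases h <;> refine ⟨by simp, ?_, ?_, ?_⟩ <;> first | decide | omega | simp [Gate.lev]

theorem wireL_lev {A : Type} {o X Z : A} {H : Set A} {f : (Fin 3 → A) → A} {L : ℕ} {i j : Gate A}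
    {a b : ℕ} (h : WireL o X Z H f L i j a b) : i ≠ j ∧ (a = 0 → b = 0 → j.lev < i.lev) := by
  rcases h with h | ⟨rfl, rfl, rfl, rfl⟩
  · exact ⟨(wire_lev h).1, (wire_lev h).2.1⟩
  · exact ⟨by simp, fun _ _ => by simp [Gate.lev]⟩

section sim

variable {A : Type} {o X Z : A} {H : Set A} {f : (Fin 3 → A) → A} {L : ℕ}
  {val : Gate A → ℕ → ℕ → Prop}

theorem val_one (hrec : ∀ i I J, val i I J ↔ ∀ j a b, WireL o X Z H f L i j a b → a ≤ I → b ≤ J →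
    ¬ val j (I - a) (J - b)) (I J : ℕ) : val .one I J := by
  rw [hrec]
  rintro j a b (h | ⟨h, -⟩)
  · cases h
  · cases h

theorem val_c0 (hrec : ∀ i I J, val i I J ↔ ∀ j a b, WireL o X Z H f L i j a b → a ≤ I → b ≤ J →
    ¬ val j (I - a) (J - b)) (I J : ℕ) : val .c0 I J ↔ I = 0 ∧ J = 0 := by
  rw [hrec]
  constructor
  · intro h
    have h1 := h _ _ _ (Or.inl .c0a)
    have h2 := h _ _ _ (Or.inl .c0b)
    simp only [val_one hrec] at h1 h2
    simp at h1 h2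
    omega
  · rintro ⟨rfl, rfl⟩ j a b (h | ⟨h, -⟩)
    · cases h
      · simp
      · simp
    · cases h

theorem val_c2 (hrec : ∀ i I J, val i I J ↔ ∀ j a b, WireL o X Z H f L i j a b → a ≤ I → b ≤ J →
    ¬ val j (I - a) (J - b)) (I J : ℕ) : val .c2 I J ↔ J = 0 ∧ 0 < I ∧ I < L := by
  rw [hrec]
  constructor
  · intro h
    have h1 := h _ _ _ (Or.inl .c2a)
    have h2 := h _ _ _ (Or.inl .c2b)
    have h3 := h _ _ _ (Or.inr ⟨rfl, rfl, rfl, rfl⟩)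
    simp only [val_one hrec, val_c0 hrec] at h1 h2 h3
    simp at h1 h2 h3
    omega
  · rintro ⟨rfl, h0, hL⟩ j a b (h | ⟨-, h, rfl, rfl⟩)
    · cases h
      · simp
      · rw [val_c0 hrec]
        omega
    · omega

/-- the neighbourhood read by a cell -/
def nbhd (o : A) (cc : ℕ → ℤ → A) : ℕ → ℤ → Fin 3 → A
  | 0, _, _ => o
  | J + 1, I, k => cc J (I - (k : ℕ))

theorem sim_step (hrec : ∀ i I J, val i I J ↔ ∀ j a b, WireL o X Z H f L i j a b → a ≤ I → b ≤ J →
    ¬ val j (I - a) (J - b)) (cc : ℕ → ℤ → A) (J : ℕ)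
    (hn : ∀ (I : ℕ) (k : Fin 3) (a : A), a ≠ o →
      (((k : ℕ) ≤ I ∧ 1 ≤ J ∧ val (.v a) (I - k) (J - 1)) ↔ nbhd o cc J I k = a))
    (I : ℕ) (a : A) : val (.v a) I J ↔ (f (nbhd o cc J I) = a ∨ (a = X ∧ I = 0 ∧ J = 0) ∨
      (a = Z ∧ J = 0 ∧ 0 < I ∧ I < L)) := by
  have vn : ∀ k a, a ≠ o → (val (.n k a) I J ↔ nbhd o cc J I k ≠ a) := by
    intro k a ha
    rw [hrec, ne_eq, ← hn I k a ha]
    constructor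
    · rintro h ⟨h1, h2, h3⟩
      exact h _ _ _ (Or.inl (.n k a)) h1 h2 h3
    · rintro h j a' b (hw | ⟨hw, -⟩) h1 h2 h3
      · cases hw
        exact h ⟨h1, h2, h3⟩
      · cases hw
  have vt : ∀ b, val (.t b) I J ↔ nbhd o cc J I = b := by
    intro b
    rw [hrec]
    constructor
    · intro h
      funext k
      by_contra hne
      by_cases hbo : b k = o
      · have h1 := (hn I k _ (by rwa [hbo] at hne)).2 rfl
        exact h _ _ _ (Or.inl (.tv b k (nbhd o cc J I k) (by rwa [hbo] at hne) hne)) h1.1 h1.2.1 h1.2.2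
      · exact h _ _ _ (Or.inl (.tn b k hbo)) (Nat.zero_le _) (Nat.zero_le _) ((vn k _ hbo).2 hne)
    · rintro rfl j a' b' (hw | ⟨hw, -⟩) h1 h2 h3
      · cases hw with
        | tn _ k hk => exact (vn k _ hk).1 h3 rfl
        | tv _ k a' ha ha' => exact ha' ((hn I k a' ha).1 ⟨h1, h2, h3⟩).symm
      · cases hw
  have vw : val (.w a) I J ↔ ¬ (f (nbhd o cc J I) = a ∨ (a = X ∧ I = 0 ∧ J = 0) ∨
      (a = Z ∧ J = 0 ∧ 0 < I ∧ I < L)) := by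
    rw [hrec]
    constructor
    · rintro h (rfl | ⟨rfl, h1⟩ | ⟨rfl, h1⟩)
      · exact h _ _ _ (Or.inl (.wt _)) (Nat.zero_le _) (Nat.zero_le _) ((vt _).2 rfl)
      · exact h _ _ _ (Or.inl .wX) (Nat.zero_le _) (Nat.zero_le _) ((val_c0 hrec _ _).2 h1)
      · exact h _ _ _ (Or.inl .wZ) (Nat.zero_le _) (Nat.zero_le _) ((val_c2 hrec _ _).2 h1)
    · rintro h j a' b' (hw | ⟨hw, -⟩) h1 h2 h3
      · apply h
        cases hw with
        | wt b => exact Or.inl (by rw [(vt b).1 h3])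
        | wX => exact Or.inr (Or.inl ⟨rfl, (val_c0 hrec _ _).1 h3⟩)
        | wZ => exact Or.inr (Or.inr ⟨rfl, (val_c2 hrec _ _).1 h3⟩)
      · cases hw
  rw [hrec]
  constructor
  · intro h
    by_contra hne
    exact h _ _ _ (Or.inl (.v a)) (Nat.zero_le _) (Nat.zero_le _) (vw.2 hne)
  · rintro h j a' b' (hw | ⟨hw, -⟩) h1 h2 h3
    · cases hw
      exact vw.1 h3 h
    · cases hw

theorem sim (hrec : ∀ i I J, val i I J ↔ ∀ j a b, WireL o X Z H f L i j a b → a ≤ I → b ≤ J →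
    ¬ val j (I - a) (J - b)) (cc : ℕ → ℤ → A) (hf : f (fun _ => o) = o)
    (h0 : ∀ I : ℤ, cc 0 I = if I = 0 then X else if 0 < I ∧ I < L then Z else o)
    (hs : ∀ (J : ℕ) (I : ℤ), cc (J + 1) I = f (fun k => cc J (I - (k : ℕ)))) :
    ∀ (J I : ℕ) (a : A), a ≠ o → (val (.v a) I J ↔ cc J I = a) := by
  have hneg : ∀ (J : ℕ) (I : ℤ), I < 0 → cc J I = o := by
    intro J
    induction J with
    | zero =>
      intro I hI
      rw [h0, if_neg (by omega), if_neg (by omega)]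
    | succ J ih =>
      intro I hI
      rw [hs]
      convert hf using 2
      funext k
      exact ih _ (by omega)
  intro J
  induction J with
  | zero =>
    intro I a ha
    rw [sim_step hrec cc 0 (fun I k a ha => by simp [nbhd, ha.symm])]
    have : nbhd o cc 0 I = fun _ => o := rfl
    rw [this, hf, h0]
    simp only [ha.symm, false_or]
    by_cases h1 : I = 0
    · subst h1
      simp [eq_comm]
    · by_cases h2 : I < L
      · have : (0 : ℤ) < I ∧ (I : ℤ) < L := by omega
        simp [h1, h2, this, eq_comm, Nat.pos_of_ne_zero h1]
      · simp [h1, h2, ha.symm]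
  | succ J ih =>
    intro I a ha
    rw [sim_step hrec cc (J + 1)]
    · simp only [Nat.add_eq_zero_iff, one_ne_zero, and_false, false_and, or_false, hs]
      rfl
    · intro I k a ha
      simp only [nbhd, Nat.add_sub_cancel, Nat.le_add_left, true_and]
      by_cases hk : (k : ℕ) ≤ I
      · rw [ih _ _ ha]
        simp [hk]
      · rw [hneg J _ (by omega)]
        simp [hk, ha.symm]

theorem sim_h (hrec : ∀ i I J, val i I J ↔ ∀ j a b, WireL o X Z H f L i j a b → a ≤ I → b ≤ J →
    ¬ val j (I - a) (J - b)) (cc : ℕ → ℤ → A) (hf : f (fun _ => o) = o) (hH : o ∉ H)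
    (h0 : ∀ I : ℤ, cc 0 I = if I = 0 then X else if 0 < I ∧ I < L then Z else o)
    (hs : ∀ (J : ℕ) (I : ℤ), cc (J + 1) I = f (fun k => cc J (I - (k : ℕ)))) (J I : ℕ) :
    val .h I J ↔ cc J I ∈ H := by
  have hv := sim hrec cc hf h0 hs
  have h1 : val .hn I J ↔ cc J I ∉ H := by
    rw [hrec]
    constructor
    · intro h hin
      refine h _ _ _ (Or.inl (.hn _ hin)) (Nat.zero_le _) (Nat.zero_le _) ?_
      rw [hv]
      · rfl
      · intro h; exact hH (h ▸ hin)
    · rintro h j a' b' (hw | ⟨hw, -⟩) h1 h2 h3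
      · cases hw with
        | hn a ha =>
          rw [hv _ _ _ (fun e => hH (e ▸ ha))] at h3
          have h4 : cc J I = a := h3
          exact h (by rwa [h4])
      · cases hw
  rw [hrec]
  constructor
  · intro h
    by_contra hne
    exact h _ _ _ (Or.inl .h) (Nat.zero_le _) (Nat.zero_le _) (h1.2 hne)
  · rintro h j a' b' (hw | ⟨hw, -⟩) h2 h3 h4
    · cases hw
      exact h1.1 h4 h
    · cases hw

end sim

end LGame

/-! ## Stage 3: a Turing machine as a cellular automaton -/

namespace LGame

open Turing

section tm

variable {S Q : Type} [Inhabited S] [Inhabited Q] (M : TM0.Machine S Q)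

/-- new symbol in a cell -/
def caSym (c : S × Option Q) : S :=
  match c.2 with
  | none => c.1
  | some q => match M q c.1 with
    | some (_, TM0.Stmt.write b) => b
    | _ => c.1

/-- the head leaves the cell `c` in direction `d` -/
def caMove (d : Dir) (c : S × Option Q) : Option Q :=
  match c.2 with
  | none => none
  | some q => match M q c.1 with
    | some (q', TM0.Stmt.move d') => if d' = d then some q' else none
    | _ => none

/-- the head stays in the cell `c` -/
def caStay (c : S × Option Q) : Option Q :=
  match c.2 with
  | none => none
  | some q => match M q c.1 with
    | some (q', TM0.Stmt.write _) => some q'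
    | some (_, TM0.Stmt.move _) => none
    | none => some q

/-- the local rule -/
def caRule (b : Fin 3 → S × Option Q) : S × Option Q :=
  (caSym M (b 1),
    (caStay M (b 1)).or ((caMove M Dir.right (b 2)).or (caMove M Dir.left (b 0))))

/-- One step, remembering the absolute position of the head. -/
def posStep (s : TM0.Cfg S Q × ℤ) : TM0.Cfg S Q × ℤ :=
  match M s.1.q s.1.Tape.head with
  | none => s
  | some (q', TM0.Stmt.write a) => (⟨q', s.1.Tape.write a⟩, s.2)
  | some (q', TM0.Stmt.move Dir.left) => (⟨q', s.1.Tape.move Dir.left⟩, s.2 - 1)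
  | some (q', TM0.Stmt.move Dir.right) => (⟨q', s.1.Tape.move Dir.right⟩, s.2 + 1)

/-- The content of a cell. -/
def cellOf (s : TM0.Cfg S Q × ℤ) (p : ℤ) : S × Option Q :=
  (s.1.Tape.nth (p - s.2), if p = s.2 then some s.1.q else none)

theorem cellOf_step (s : TM0.Cfg S Q × ℤ) (p : ℤ) :
    cellOf (posStep M s) p = caRule M (fun k => cellOf s (p + 1 - (k : ℕ))) := by
  obtain ⟨⟨q, T⟩, h⟩ := s
  have e0 : T.nth 0 = T.head := rfl
  have n1 : ((1 : Fin 3) : ℕ) = 1 := rfl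
  have n2 : ((2 : Fin 3) : ℕ) = 2 := rfl
  have n0 : ((0 : Fin 3) : ℕ) = 0 := rfl
  obtain ⟨d, rfl⟩ : ∃ d, p = h + d := ⟨p - h, by ring⟩
  simp only [caRule, n1, n2, n0]
  have d1 : h + d + 1 - ((1 : ℕ) : ℤ) = h + d := by push_cast; ring
  have d2 : h + d + 1 - ((2 : ℕ) : ℤ) = h + (d - 1) := by push_cast; ring
  have d0 : h + d + 1 - ((0 : ℕ) : ℤ) = h + (d + 1) := by push_cast; ring
  rw [d1, d2, d0]
  have cell : ∀ e, cellOf (⟨q, T⟩, h) (h + e) = (T.nth e, if e = 0 then some q else none) := by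
    intro e
    simp [cellOf]
  rw [cell, cell, cell]
  have hw : ∀ a, (Tape.write a T).head = a := fun a => rfl
  have hr : (Tape.move Dir.right T).head = T.nth 1 := Tape.move_right_nth T 0
  have hl : (Tape.move Dir.left T).head = T.nth (-1) := Tape.move_left_nth T 0
  by_cases c0 : d = 0
  · subst c0
    rcases hM : M q T.head with _ | ⟨q', ⟨_ | _⟩ | a⟩ <;>
      simp [posStep, hM, cellOf, caSym, caStay, caMove, e0, hw, hr, hl] <;> omega
  by_cases c1 : d = 1
  · subst c1
    rcases hM : M q T.head with _ | ⟨q', ⟨_ | _⟩ | a⟩ <;>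
      simp [posStep, hM, cellOf, caSym, caStay, caMove, e0, hw, hr, hl] <;> omega
  by_cases c2 : d = -1
  · subst c2
    rcases hM : M q T.head with _ | ⟨q', ⟨_ | _⟩ | a⟩ <;>
      simp [posStep, hM, cellOf, caSym, caStay, caMove, e0, hw, hr, hl] <;> omega
  have c1' : ¬ d - 1 = 0 := by omega
  have c2' : ¬ d + 1 = 0 := by omega
  rcases hM : M q T.head with _ | ⟨q', ⟨_ | _⟩ | a⟩ <;>
    simp [posStep, hM, cellOf, caSym, caStay, caMove, c0, c1', c2'] <;> omega

theorem posStep_of_none (s : TM0.Cfg S Q × ℤ) (h : TM0.step M s.1 = none) :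
    posStep M s = s := by
  obtain ⟨⟨q, T⟩, h⟩ := s
  simp only [TM0.step, Option.map_eq_none_iff] at h
  simp [posStep, h]

theorem posStep_of_some (s : TM0.Cfg S Q × ℤ) (c) (h : TM0.step M s.1 = some c) :
    (posStep M s).1 = c := by
  obtain ⟨⟨q, T⟩, p⟩ := s
  simp only [TM0.step] at h
  rcases hM : M q T.head with _ | ⟨q', ⟨_ | _⟩ | a⟩ <;> simp [hM] at h <;> simp [posStep, hM, h]

theorem eval_dom_iff (s : TM0.Cfg S Q × ℤ) :
    (StateTransition.eval (TM0.step M) s.1).Dom ↔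
      ∃ t, TM0.step M ((posStep M)^[t] s).1 = none := by
  constructor
  · intro h
    obtain ⟨b, hb⟩ := Part.dom_iff_mem.1 h
    obtain ⟨h1, h2⟩ := StateTransition.mem_eval.1 hb
    have : ∀ b, StateTransition.Reaches (TM0.step M) s.1 b →
        ∃ t, ((posStep M)^[t] s).1 = b := by
      intro b hb
      induction hb with
      | refl => exact ⟨0, rfl⟩
      | tail _ h ih =>
        obtain ⟨t, ht⟩ := ih
        refine ⟨t + 1, ?_⟩
        rw [Function.iterate_succ_apply']
        exact posStep_of_some M _ _ (by rw [ht]; exact h)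
    obtain ⟨t, ht⟩ := this b h1
    exact ⟨t, by rw [ht]; exact h2⟩
  · rintro ⟨t, ht⟩
    have : ∀ t, StateTransition.Reaches (TM0.step M) s.1 ((posStep M)^[t] s).1 := by
      intro t
      induction t with
      | zero => exact Relation.ReflTransGen.refl
      | succ t ih =>
        rw [Function.iterate_succ_apply']
        rcases hs : TM0.step M ((posStep M)^[t] s).1 with _ | c
        · rw [posStep_of_none M _ hs]
          exact ih
        · rw [posStep_of_some M _ _ hs]
          exact ih.tail hs
    exact Part.dom_iff_mem.2 ⟨_, StateTransition.mem_eval.2 ⟨this t, ht⟩⟩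

theorem halt_mono (s : TM0.Cfg S Q × ℤ) {t t' : ℕ} (h : t ≤ t')
    (ht : TM0.step M ((posStep M)^[t] s).1 = none) :
    TM0.step M ((posStep M)^[t'] s).1 = none := by
  induction t', h using Nat.le_induction with
  | base => exact ht
  | succ n _ ih =>
    rw [Function.iterate_succ_apply', posStep_of_none M _ ih]
    exact ih

theorem head_ge (s : TM0.Cfg S Q × ℤ) (hs : 0 ≤ s.2) (t : ℕ) :
    -(t : ℤ) ≤ ((posStep M)^[t] s).2 := by
  induction t with
  | zero => simpa using hs
  | succ t ih =>
    rw [Function.iterate_succ_apply']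
    generalize (posStep M)^[t] s = s' at ih ⊢
    unfold posStep
    split <;> (try simp only) <;> (try push_cast) <;> omega

theorem init_nth (X Z : S) (n : ℕ) (i : ℤ) :
    (Tape.mk₁ (X :: List.replicate n Z)).nth i =
      if i = 0 then X else if 0 < i ∧ i < (n + 1 : ℕ) then Z else default := by
  rcases i with i | i
  · have : (Tape.mk₁ (X :: List.replicate n Z)).nth (Int.ofNat i) =
      (ListBlank.mk (X :: List.replicate n Z)).nth i := Tape.mk'_nth_nat _ _ _
    rw [this, ListBlank.nth_mk]
    rcases i with _ | i
    · simp
    · rw [if_neg (by simp only [Int.ofNat_eq_natCast]; omega)]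
      by_cases h : i < n
      · rw [if_pos (by simp only [Int.ofNat_eq_natCast]; omega)]
        simp [List.getI_eq_getElem, h]
      · rw [if_neg (by simp only [Int.ofNat_eq_natCast]; omega)]
        rw [List.getI_eq_default]
        simpa using h
  · rw [if_neg (by simp), if_neg (by simp)]
    rfl

theorem tm_ca (X0 Z0 : S) [Finite S] [Finite Q] :
    ∃ (A : Type) (_ : Finite A) (o X Z : A) (H : Set A) (f : (Fin 3 → A) → A),
      f (fun _ => o) = o ∧ o ∉ H ∧ ∀ n : ℕ, ∃ cc : ℕ → ℤ → A,
        (∀ I : ℤ, cc 0 I = if I = 0 then X else if 0 < I ∧ I < (n + 1 : ℕ) then Z else o) ∧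
        (∀ (J : ℕ) (I : ℤ), cc (J + 1) I = f (fun k => cc J (I - (k : ℕ)))) ∧
        ∀ m : ℕ, 0 < m → ((∃ i j : ℕ, cc (m * j) i ∈ H) ↔
          (TM0.eval M (X0 :: List.replicate n Z0)).Dom) := by
  refine ⟨S × Option Q, inferInstance, (default, none), (X0, some default), (Z0, none),
    {a | ∃ q, a.2 = some q ∧ M q a.1 = none}, caRule M, ?_, ?_, fun n => ?_⟩
  · simp [caRule, caSym, caStay, caMove]
  · simp
  let s0 : TM0.Cfg S Q × ℤ := (TM0.init (X0 :: List.replicate n Z0), 0)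
  refine ⟨fun J I => cellOf ((posStep M)^[J] s0) (I - J), ?_, ?_, ?_⟩
  · intro I
    simp only [Function.iterate_zero, id, Nat.cast_zero, sub_zero, cellOf, s0, TM0.init]
    rw [init_nth]
    split_ifs <;> rfl
  · intro J I
    simp only [Function.iterate_succ_apply', cellOf_step]
    congr 1
    funext k
    congr 1
    push_cast
    ring
  · intro m hm
    have key : ∀ J (I : ℤ), (cellOf ((posStep M)^[J] s0) (I - J) ∈
        {a : S × Option Q | ∃ q, a.2 = some q ∧ M q a.1 = none}) ↔
        (I - J = ((posStep M)^[J] s0).2 ∧ TM0.step M ((posStep M)^[J] s0).1 = none) := by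
      intro J I
      generalize (posStep M)^[J] s0 = s
      obtain ⟨⟨q, T⟩, h⟩ := s
      have e0 : T.nth 0 = T.head := rfl
      simp only [cellOf, TM0.step]
      by_cases hI : I - J = h
      · simp [hI, e0]
      · simp [hI]
    have hd : (TM0.eval M (X0 :: List.replicate n Z0)).Dom ↔
        (StateTransition.eval (TM0.step M) s0.1).Dom := Iff.rfl
    rw [hd, eval_dom_iff]
    constructor
    · rintro ⟨i, j, h⟩
      exact ⟨_, ((key _ _).1 h).2⟩
    · rintro ⟨t, ht⟩
      have h1 := halt_mono M s0 (Nat.le_mul_of_pos_left t hm) ht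
      have h2 := head_ge M s0 le_rfl (m * t)
      refine ⟨(((posStep M)^[m * t] s0).2 + (m * t : ℕ)).toNat, t, (key _ _).2 ⟨?_, h1⟩⟩
      omega

end tm

end LGame

/-! ## Stage 4: existence of the Turing machine -/

namespace LGame

open Turing

theorem finite_states {S Q : Type} [Inhabited S] [Inhabited Q] (M : TM0.Machine S Q)
    (T : Finset Q) (hT : TM0.Supports M (T : Set Q)) :
    ∃ (Q' : Type) (_ : Inhabited Q') (_ : Finite Q') (M' : TM0.Machine S Q'),
      ∀ l, (TM0.eval M' l).Dom ↔ (TM0.eval M l).Dom := by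
  classical
  let i0 : Inhabited {q // q ∈ T} := ⟨⟨default, hT.1⟩⟩
  let g : Q → {q // q ∈ T} := fun q => if h : q ∈ T then ⟨q, h⟩ else ⟨default, hT.1⟩
  have hg : ∀ q ∈ T, (g q).1 = q := fun q h => by simp [g, h]
  have hp : g default = default := by
    apply Subtype.ext
    rw [hg _ hT.1]; rfl
  let g₁ : PointedMap Q {q // q ∈ T} := ⟨g, hp⟩
  let f : PointedMap S S := ⟨id, rfl⟩
  refine ⟨{q // q ∈ T}, i0, inferInstance, M.map f f g₁ Subtype.val, fun l => ?_⟩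
  have := StateTransition.tr_eval_dom
    (TM0.Machine.map_respects M f f g₁ Subtype.val hT (fun _ => rfl) hg)
    (a₁ := TM0.init l) (a₂ := TM0.init l) ⟨hT.1, by
      rw [TM0.map_init]; congr 1; exact List.map_id l⟩
  exact this

theorem trNat_ones (n : ℕ) :
    PartrecToTM2.trNat (2 ^ n - 1) = List.replicate n PartrecToTM2.Γ'.bit1 := by
  induction n with
  | zero => simp
  | succ n ih =>
    have h : 2 ^ (n + 1) - 1 = (2 ^ n - 1) + (2 ^ n - 1) + 1 := by
      have := Nat.one_le_two_pow (n := n)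
      rw [pow_succ]
      omega
    rw [List.replicate_succ, ← ih, h, PartrecToTM2.trNat, PartrecToTM2.trNat]
    push_cast
    generalize ((2 ^ n - 1 : ℕ) : Num) = x
    rw [Num.bit1_of_bit1]
    cases x <;> rfl

instance finite_K' : Finite PartrecToTM2.K' := by
  refine Finite.of_surjective (α := Fin 4)
    (fun i => match i with
      | 0 => .main | 1 => .rev | 2 => .aux | 3 => .stack) ?_
  rintro (_ | _ | _ | _)
  · exact ⟨0, rfl⟩
  · exact ⟨1, rfl⟩
  · exact ⟨2, rfl⟩
  · exact ⟨3, rfl⟩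

theorem exists_code_ones (p : ℕ →. ℕ) (hp : Partrec p) :
    ∃ c : ToPartrec.Code, ∀ n, (c.eval [2 ^ n - 1]).Dom ↔ (p n).Dom := by
  have hpow : Primrec (fun k : ℕ => 2 ^ k - 1) := by
    have h : Primrec (fun k : ℕ => Nat.rec (motive := fun _ => ℕ) 0 (fun _ r => 2 * r + 1) k) :=
      Primrec.nat_rec' (f := id) (g := fun _ => 0) (h := fun _ r => 2 * r.2 + 1)
        Primrec.id (Primrec.const 0)
        (Primrec.succ.comp (Primrec.nat_mul.comp (Primrec.const 2)
          (Primrec.snd.comp Primrec.snd))).to₂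
    refine h.of_eq fun k => ?_
    induction k with
    | zero => rfl
    | succ k ih =>
      simp only [ih, pow_succ]
      have := Nat.one_le_two_pow (n := k)
      omega
  have hfg : Primrec (fun x : ℕ => Nat.findGreatest (fun k => 2 ^ k - 1 ≤ x) x) :=
    Primrec.nat_findGreatest (f := id) (p := fun x k => 2 ^ k - 1 ≤ x) Primrec.id
      (Primrec.nat_le.comp (hpow.comp Primrec.snd) Primrec.fst)
  have hq : Partrec (fun x : ℕ => p (Nat.findGreatest (fun k => 2 ^ k - 1 ≤ x) x)) :=
    hp.comp hfg.to_comp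
  obtain ⟨c, hc⟩ := ToPartrec.Code.exists_code (Nat.Partrec'.part_iff₁.2 hq)
  refine ⟨c, fun n => ?_⟩
  have h1 := hc (⟨[2 ^ n - 1], rfl⟩ : List.Vector ℕ 1)
  have h2 : Nat.findGreatest (fun k => 2 ^ k - 1 ≤ 2 ^ n - 1) (2 ^ n - 1) = n := by
    have hn : n < 2 ^ n := Nat.lt_two_pow_self
    rw [Nat.findGreatest_eq_iff]
    refine ⟨by omega, fun _ => le_rfl, fun k hk _ h => ?_⟩
    have : 2 ^ n < 2 ^ k := Nat.pow_lt_pow_right (by norm_num) hk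
    omega
  have h3 : (c.eval [2 ^ n - 1]).Dom ↔
      (p (Nat.findGreatest (fun k => 2 ^ k - 1 ≤ 2 ^ n - 1) (2 ^ n - 1))).Dom :=
    iff_of_eq (congrArg Part.Dom h1)
  rw [h3, h2]

theorem tm2_dom (c : ToPartrec.Code) :
    ∃ (S Q : Type) (_ : Inhabited S) (_ : Inhabited Q) (_ : Finite S) (M : TM0.Machine S Q)
      (T : Finset Q) (X0 Z0 : S), TM0.Supports M (T : Set Q) ∧
      ∀ n : ℕ, (TM0.eval M (X0 :: List.replicate n Z0)).Dom ↔ (c.eval [2 ^ n - 1]).Dom := by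
  classical
  let i1 : Inhabited PartrecToTM2.Λ' :=
    ⟨PartrecToTM2.trNormal c PartrecToTM2.Cont'.halt⟩
  have s2 : TM2.Supports PartrecToTM2.tr
    (PartrecToTM2.codeSupp c PartrecToTM2.Cont'.halt) := PartrecToTM2.tr_supports c _
  have s1 := TM2to1.tr_supports _ s2
  have s0 := TM1to0.tr_supports _ s1
  refine ⟨TM2to1.Γ' PartrecToTM2.K' (fun _ => PartrecToTM2.Γ'), _, inferInstance, inferInstance,
    (inferInstance : Finite (Bool × ∀ _ : PartrecToTM2.K', Option PartrecToTM2.Γ')),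
    TM1to0.tr (TM2to1.tr PartrecToTM2.tr), _,
    (true, Function.update (fun _ => none) PartrecToTM2.K'.main (some PartrecToTM2.Γ'.cons)),
    (false, Function.update (fun _ => none) PartrecToTM2.K'.main (some PartrecToTM2.Γ'.bit1)),
    s0, fun n => ?_⟩
  rw [TM1to0.tr_eval]
  have h := TM2to1.tr_eval_dom PartrecToTM2.tr PartrecToTM2.K'.main
    (PartrecToTM2.trList [2 ^ n - 1])
  have e : TM2to1.trInit PartrecToTM2.K'.main (PartrecToTM2.trList [2 ^ n - 1]) =
    (true, Function.update (fun _ => none) PartrecToTM2.K'.main (some PartrecToTM2.Γ'.cons)) ::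
    List.replicate n
    ((false, Function.update (fun _ => none) PartrecToTM2.K'.main (some PartrecToTM2.Γ'.bit1)) :
      TM2to1.Γ' PartrecToTM2.K' (fun _ => PartrecToTM2.Γ')) := by
    simp only [PartrecToTM2.trList, trNat_ones, TM2to1.trInit]
    simp
    exact congrArg (List.cons _) List.map_replicate
  rw [e] at h
  refine h.trans ?_
  have e2 : (TM2.init PartrecToTM2.K'.main (PartrecToTM2.trList [2 ^ n - 1]) : PartrecToTM2.Cfg') =
      PartrecToTM2.init c [2 ^ n - 1] := by
    unfold TM2.init PartrecToTM2.init
    congr 1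
    funext k
    cases k <;> rfl
  have h3 := PartrecToTM2.tr_eval c [2 ^ n - 1]
  rw [← e2] at h3
  change (StateTransition.eval (TM2.step PartrecToTM2.tr) (TM2.init PartrecToTM2.K'.main _)).Dom ↔ _
  rw [h3]
  rfl

theorem exists_machine (p : ℕ →. ℕ) (hp : Partrec p) :
    ∃ (S Q : Type) (_ : Inhabited S) (_ : Inhabited Q) (_ : Finite S) (_ : Finite Q)
      (M : TM0.Machine S Q) (X0 Z0 : S),
      ∀ n : ℕ, (TM0.eval M (X0 :: List.replicate n Z0)).Dom ↔ (p n).Dom := by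
  obtain ⟨c, hc⟩ := exists_code_ones p hp
  obtain ⟨S, Q, iS, iQ, fS, M, T, X0, Z0, hT, h⟩ := tm2_dom c
  obtain ⟨Q', iQ', fQ', M', h'⟩ := finite_states M T hT
  exact ⟨S, Q', iS, iQ', fS, fQ', M', X0, Z0, fun n => (h' _).trans ((h n).trans (hc n))⟩

end LGame

/-! ## Stage 5: computability of the reduction -/

namespace LGame

open Encodable

theorem lower'_append (l : List ℕ) (n : ℕ) :
    ∃ c, ∀ x, Denumerable.lower' (l ++ [x]) n = Denumerable.lower' l n ++ [x - c] := by
  induction l generalizing n with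
  | nil => exact ⟨n, fun x => rfl⟩
  | cons m l ih =>
    obtain ⟨c, hc⟩ := ih (m + 1)
    exact ⟨c, fun x => by simp [Denumerable.lower', hc]⟩

theorem encode_insert (F : Finset (ℤ × ℤ × ℤ)) : ∃ (l : List ℕ) (c : ℕ), ∀ x : ℤ × ℤ × ℤ,
    (∀ y ∈ F, encode y < encode x) →
      @encode (Finset (ℤ × ℤ × ℤ)) (Primcodable.ofDenumerable _).toEncodable (insert x F) =
         encode (l ++ [encode x - c]) := by
  obtain ⟨c, hc⟩ := lower'_append (F.map (Denumerable.eqv (ℤ × ℤ × ℤ)).toEmbedding).sort 0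
  refine ⟨Denumerable.lower' (F.map (Denumerable.eqv (ℤ × ℤ × ℤ)).toEmbedding).sort 0, c,
    fun x hx => ?_⟩
  rw [← hc]
  change encode (Denumerable.lower'
    ((insert x F).map (Denumerable.eqv (ℤ × ℤ × ℤ)).toEmbedding).sort 0) = _
  congr 2
  have hlt : ∀ y ∈ F.map (Denumerable.eqv (ℤ × ℤ × ℤ)).toEmbedding, y < encode x := by
    intro y hy
    obtain ⟨z, hz, rfl⟩ := Finset.mem_map.1 hy
    exact hx z hz
  have e : (insert x F).map (Denumerable.eqv (ℤ × ℤ × ℤ)).toEmbedding =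
      insert (encode x) (F.map (Denumerable.eqv (ℤ × ℤ × ℤ)).toEmbedding) := by
    rw [Finset.map_insert]; rfl
  rw [e]
  generalize F.map (Denumerable.eqv (ℤ × ℤ × ℤ)).toEmbedding = s at hlt
  generalize encode x = y at hlt
  have hn : y ∉ s := fun h => (hlt y h).ne rfl
  apply List.Perm.eq_of_pairwise (le := (· ≤ ·))
  · intro a b _ _; exact le_antisymm
  · exact Finset.pairwise_sort _ _
  · rw [List.pairwise_append]
    refine ⟨Finset.pairwise_sort _ _, by simp, ?_⟩
    intro a ha b hb
    simp only [List.mem_singleton] at hb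
    subst hb
    exact (hlt a ((Finset.mem_sort _).1 ha)).le
  · rw [← Multiset.coe_eq_coe, Finset.sort_eq, Finset.insert_val_of_notMem hn,
      ← Multiset.coe_add, Finset.sort_eq, add_comm]
    rfl

theorem encode_natCast (h : ℕ) :
    encode (((h : ℤ), 0, 0) : ℤ × ℤ × ℤ) = Nat.pair (2 * h) (encode ((0, 0) : ℤ × ℤ)) := rfl

theorem computable_insert (F : Finset (ℤ × ℤ × ℤ)) : ∃ B : ℕ, ∀ {α : Type} [Primcodable α]
    (h : α → ℕ), Computable h → (∀ a, B < h a) →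
      Computable (fun a => (insert ((h a : ℤ), (0 : ℤ), (0 : ℤ)) F : Finset (ℤ × ℤ × ℤ))) := by
  obtain ⟨l, c, hl⟩ := encode_insert F
  refine ⟨F.sup encode, fun h hh hB => ?_⟩
  apply Computable.encode_iff.1
  have h1 : ∀ a, @encode (Finset (ℤ × ℤ × ℤ)) (Primcodable.ofDenumerable _).toEncodable
      (insert ((h a : ℤ), (0 : ℤ), (0 : ℤ)) F : Finset (ℤ × ℤ × ℤ)) =
      encode (l ++ [Nat.pair (2 * h a) (encode ((0, 0) : ℤ × ℤ)) - c]) := by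
    intro a
    rw [hl _ ?_, encode_natCast]
    intro y hy
    have h2 := Finset.le_sup (f := encode) hy
    have h3 := hB a
    have h4 := Nat.left_le_pair (2 * h a) (encode ((0, 0) : ℤ × ℤ))
    rw [encode_natCast]
    omega
  refine Computable.of_eq ?_ fun a => (h1 a).symm
  apply Computable.encode.comp
  refine (Primrec.list_append.to_comp).comp (Computable.const l) ?_
  refine (Primrec.list_cons.to_comp).comp ?_ (Computable.const [])
  refine (Primrec.nat_sub.to_comp).comp ?_ (Computable.const c)
  refine (Primrec₂.natPair.to_comp).comp ?_ (Computable.const _)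
  exact (Primrec.nat_mul.to_comp).comp (Computable.const 2) hh

end LGame

/-! ## Stage 6: the reduction -/

namespace LGame

/-- The index of a gate. -/
noncomputable def gidx {A : Type} (K : ℕ) (e : Gate A ≃ Fin K) (i : Gate A) : ℕ :=
  (i.lev : ℕ) * K + (e i : ℕ)

theorem gidx_inj {A : Type} {K : ℕ} (e : Gate A ≃ Fin K) : Function.Injective (gidx K e) := by
  intro i j h
  have h1 : gidx K e i % K = gidx K e j % K := by rw [h]
  simp only [gidx, Nat.mul_add_mod_self_right, Nat.mod_eq_of_lt (e i).2,
    Nat.mod_eq_of_lt (e j).2] at h1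
  exact e.injective (Fin.ext h1)

theorem gidx_lt {A : Type} {K : ℕ} (e : Gate A ≃ Fin K) (i : Gate A) : gidx K e i < 9 * K := by
  have h1 : ((i.lev : ℕ) + 1) * K ≤ 9 * K := Nat.mul_le_mul_right _ i.lev.2
  have h2 := (e i).2
  rw [add_mul] at h1
  simp only [gidx]
  omega

theorem gidx_mono {A : Type} {K : ℕ} (e : Gate A ≃ Fin K) {i j : Gate A} (h : i.lev < j.lev) :
    gidx K e i < gidx K e j := by
  have h1 : ((i.lev : ℕ) + 1) * K ≤ (j.lev : ℕ) * K := Nat.mul_le_mul_right _ h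
  have h2 := (e i).2
  rw [add_mul] at h1
  simp only [gidx]
  omega

theorem reduction (p : ℕ →. ℕ) (hp : Partrec p) :
    ∃ (F : Finset (ℤ × ℤ × ℤ)) (u m a : ℕ), 0 < m ∧ ∀ n : ℕ,
      PointedRuleset (insert (((u + m * (n + 1) : ℕ) : ℤ), (0 : ℤ), (0 : ℤ)) F) ∧
      ∀ P, PPosProperty (insert (((u + m * (n + 1) : ℕ) : ℤ), (0 : ℤ), (0 : ℤ)) F) P →
        ((∃ i j : ℕ, ((m * i + a : ℤ), (m * j + (0 : ℕ) : ℤ), (1 : ℤ)) ∈ P) ↔ (p n).Dom) := by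
  classical
  obtain ⟨S, Q, iS, iQ, fS, fQ, M, X0, Z0, hM⟩ := exists_machine p hp
  obtain ⟨A, fA, o, X, Z, H, f, hf, hH, hcc⟩ := tm_ca M X0 Z0
  have fG : Finite (Gate A) := Gate.finite o
  obtain ⟨K, ⟨e⟩⟩ := Finite.exists_equiv_fin (Gate A)
  let idx := gidx K e
  let G := 9 * K
  have hinj : Function.Injective idx := gidx_inj e
  have hlt : ∀ i, idx i < G := gidx_lt e
  have hfin : {γ : ℤ × ℤ × ℤ | ∃ i j a b, Wire o X Z H f i j a b ∧ γ = evec idx G i j a b}.Finite := by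
    have h1 : (Set.univ : Set (Gate A × Gate A × Fin 3 × Fin 2)).Finite := Set.finite_univ
    refine (h1.image (fun q => evec idx G q.1 q.2.1 q.2.2.1 q.2.2.2)).subset ?_
    rintro γ ⟨i, j, a, b, h, rfl⟩
    obtain ⟨-, -, ha, hb⟩ := wire_lev h
    exact ⟨(i, j, ⟨a, ha⟩, ⟨b, hb⟩), trivial, rfl⟩
  have hmc : ((2 ^ (G + 3) : ℕ) : ℤ) = gmod G := by simp [gmod]
  have hac : ((2 ^ (idx .h + 2) : ℕ) : ℤ) = gpos (idx .h) := by simp [gpos]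
  have hu : (((gpos (idx .c2) - gpos (idx .one)).toNat : ℕ) : ℤ) =
      gpos (idx .c2) - gpos (idx .one) := by
    apply Int.toNat_of_nonneg
    have := gpos_mono (gidx_mono e (i := .one) (j := .c2) (by simp [Gate.lev]))
    change 0 ≤ gpos (gidx K e .c2) - gpos (gidx K e .one)
    omega
  refine ⟨fixedRules idx G ∪ hfin.toFinset, (gpos (idx .c2) - gpos (idx .one)).toNat, 2 ^ (G + 3),
    2 ^ (idx .h + 2), by positivity, fun n => ?_⟩
  have hE : ∀ i j a b, WireL o X Z H f (n + 1) i j a b →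
      i ≠ j ∧ (a = 0 → b = 0 → idx j < idx i) := fun i j a b h =>
    ⟨(wireL_lev h).1, fun h1 h2 => gidx_mono e ((wireL_lev h).2 h1 h2)⟩
  have hev : ((((gpos (idx .c2) - gpos (idx .one)).toNat + 2 ^ (G + 3) * (n + 1) : ℕ) : ℤ),
      (0 : ℤ), (0 : ℤ)) = evec idx G .c2 .one (n + 1) 0 := by
    rw [Nat.cast_add, Nat.cast_mul, hu, hmc]
    simp [evec]
  rw [hev]
  have hΓ : ∀ γ, γ ∈ insert (evec idx G .c2 .one (n + 1) 0) (fixedRules idx G ∪ hfin.toFinset) ↔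
      γ ∈ fixedRules idx G ∨
        ∃ i j a b, WireL o X Z H f (n + 1) i j a b ∧ γ = evec idx G i j a b := by
    intro γ
    simp only [Finset.mem_insert, Finset.mem_union, Set.Finite.mem_toFinset, Set.mem_setOf_eq]
    constructor
    · rintro (rfl | h | ⟨i, j, a, b, h, rfl⟩)
      · exact Or.inr ⟨_, _, _, _, Or.inr ⟨rfl, rfl, rfl, rfl⟩, rfl⟩
      · exact Or.inl h
      · exact Or.inr ⟨i, j, a, b, Or.inl h, rfl⟩
    · rintro (h | ⟨i, j, a, b, h | ⟨rfl, rfl, rfl, rfl⟩, rfl⟩)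
      · exact Or.inr (Or.inl h)
      · exact Or.inr (Or.inr ⟨i, j, a, b, h, rfl⟩)
      · exact Or.inl rfl
  refine ⟨circuit_pointed hlt hE hΓ, fun P hP => ?_⟩
  obtain ⟨cc, h0, hs, hh⟩ := hcc n
  have hsim := sim_h (L := n + 1)
    (val := fun i I J => (gmod G * (I : ℕ) + gpos (idx i), ((J : ℕ) : ℤ), (1 : ℤ)) ∈ P)
    (fun i I J => circuit_rec hinj hlt hE hΓ hP i I J) cc hf hH h0 hs
  rw [← hM n, ← hh (2 ^ (G + 3)) (by positivity)]
  refine exists_congr fun i => exists_congr fun j => ?_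
  rw [← hsim, hmc, hac]
  simp only [Nat.cast_zero, add_zero, Nat.cast_mul, hmc]

end LGame

theorem lattice_game_undecidability :
    ¬ ∃ d : Finset (ℤ × ℤ × ℤ) × ℕ × ℕ × ℕ → Bool, Computable d ∧
      ∀ (Γ : Finset (ℤ × ℤ × ℤ)), PointedRuleset Γ →
        ∀ (m a b : ℕ) (P : Set (ℤ × ℤ × ℤ)), PPosProperty Γ P →
          (d (Γ, m, a, b) = true ↔
            ∃ i j : ℕ, ((m * i + a : ℤ), (m * j + b : ℤ), (1 : ℤ)) ∈ P) := by
  rintro ⟨d, hd, hspec⟩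
  have hp : Partrec (fun n : ℕ => (Denumerable.ofNat Nat.Partrec.Code n.unpair.2).eval 0) :=
    Nat.Partrec.Code.eval_part.comp
      ((Computable.ofNat Nat.Partrec.Code).comp (Computable.snd.comp Computable.unpair))
      (Computable.const 0)
  obtain ⟨F, u, m, a, hm, hred⟩ := LGame.reduction _ hp
  obtain ⟨B, hB⟩ := LGame.computable_insert F
  have hh : Computable (fun c : Nat.Partrec.Code =>
      u + m * (Nat.pair B (Encodable.encode c) + 1)) :=
    Primrec.nat_add.to_comp.comp (Computable.const u)
      (Primrec.nat_mul.to_comp.comp (Computable.const m)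
        (Computable.succ.comp
          (Primrec₂.natPair.to_comp.comp (Computable.const B) Computable.encode)))
  have hc := hB _ hh (fun c => by
    have h1 := Nat.left_le_pair B (Encodable.encode c)
    have h2 : 1 * (Nat.pair B (Encodable.encode c) + 1) ≤
      m * (Nat.pair B (Encodable.encode c) + 1) := Nat.mul_le_mul_right _ hm
    omega)
  apply ComputablePred.halting_problem 0
  rw [ComputablePred.computable_iff]
  refine ⟨_, hd.comp (hc.pair (Computable.const (m, a, 0))), ?_⟩
  funext c
  obtain ⟨h1, h2⟩ := hred (Nat.pair B (Encodable.encode c))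
  obtain ⟨P, hP⟩ := LGame.exists_ppos _ h1
  have h3 := hspec _ h1 m a 0 P hP
  rw [h2 P hP] at h3
  simp only [Nat.unpair_pair, Denumerable.ofNat_encode] at h3
  exact propext h3.symm
end

section
/- Let Γ′ ⊆ ℤ³ be the 28-element set consisting of (1,1,0), (5,−2,0), (−1,4,0), (3,−2,0), (−3,4,0), (1,2,0), (2,1,0), (0,2,0), (0,4,0), (1,4,0), (2,2,0), (2,4,0), (3,0,0), (3,1,0), (3,3,0), (3,5,0), (4,2,0), (4,4,0), (−2,1,1), (−1,−1,1), (−1,2,1), (0,3,1), (1,−1,1), (1,4,1), (2,0,1), (2,1,1), (3,2,1), (4,3,1). Then every set 𝒫 ⊆ ℕ³ satisfying the P-position property for Γ′ does not admit an affine stratification: 𝒫 is not a finite union of sets of the form w + Λ with w ∈ ℤ³ and Λ a finitely generated additive submonoid of ℤ³. -/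
/-- The explicit 28-element ruleset `Γ′`. -/
def gammaPrime : Finset (ℤ × ℤ × ℤ) :=
  {(1,1,0), (5,-2,0), (-1,4,0), (3,-2,0), (-3,4,0), (1,2,0), (2,1,0),
   (0,2,0), (0,4,0), (1,4,0), (2,2,0), (2,4,0), (3,0,0), (3,1,0),
   (3,3,0), (3,5,0), (4,2,0), (4,4,0),
   (-2,1,1), (-1,-1,1), (-1,2,1), (0,3,1), (1,-1,1), (1,4,1),
   (2,0,1), (2,1,1), (3,2,1), (4,3,1)}

namespace GammaPrimeProof

/-- The Sierpinski pattern on `ℤ²`: odd binomial coefficients in the first quadrant. -/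
def A (i j : ℤ) : Prop := 0 ≤ i ∧ 0 ≤ j ∧ ((i.toNat + j.toNat).choose i.toNat) % 2 = 1

lemma A_row (i : ℤ) (hi : 0 ≤ i) : A i 0 := by
  refine ⟨hi, le_refl _, ?_⟩
  simp

lemma A_col (j : ℤ) (hj : 0 ≤ j) : A 0 j := by
  refine ⟨le_refl _, hj, ?_⟩
  simp

/-- Pascal's rule. -/
lemma A_rec (i j : ℤ) (hi : 0 ≤ i) (hj : 0 ≤ j) :
    A (i + 1) (j + 1) ↔ ¬ (A i (j + 1) ↔ A (i + 1) j) := by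
  lift i to ℕ using hi
  lift j to ℕ using hj
  have e1 : ((i : ℤ) + 1).toNat = i + 1 := by omega
  have e2 : ((j : ℤ) + 1).toNat = j + 1 := by omega
  have h := Nat.choose_succ_succ (i + j + 1) i
  have p1 : i + 1 + (j + 1) = (i + j + 1).succ := by simp; omega
  have p2 : i + (j + 1) = i + j + 1 := by omega
  have p3 : i + 1 + j = i + j + 1 := by omega
  unfold A
  simp only [e1, e2, Int.toNat_natCast, p1, p2, p3]
  rw [← Nat.succ_eq_add_one i, h]
  have a1 : (0 : ℤ) ≤ (i : ℤ) := by omega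
  have a2 : (0 : ℤ) ≤ (j : ℤ) := by omega
  have a3 : (0 : ℤ) ≤ (i : ℤ) + 1 := by omega
  have a4 : (0 : ℤ) ≤ (j : ℤ) + 1 := by omega
  simp only [a1, a2, a3, a4, true_and]
  omega

/-- The bottom layer of the P-positions. -/
def Q0 (x y : ℤ) : Prop :=
  0 ≤ x ∧ 0 ≤ y ∧ ((y % 6 = 0 ∧ x % 6 ≤ 2) ∨ (y % 6 = 1 ∧ x % 6 = 0))

/-- The second layer of the P-positions. -/
def Q1 (x y : ℤ) : Prop :=
  ∃ i j : ℤ, 0 ≤ i ∧ 0 ≤ j ∧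
    ((x = 6 * i ∧ y = 6 * j ∧ A i j) ∨
     (x = 6 * i + 1 ∧ y = 6 * j + 1 ∧ ¬ A i j) ∨
     (x = 6 * i + 4 ∧ y = 6 * j + 5 ∧ A (i + 1) j ∧ A i (j + 1)) ∨
     (x = 6 * i + 5 ∧ y = 6 * j + 4 ∧ ¬ A (i + 1) j ∧ ¬ A i (j + 1)))

/-- The first two layers together. -/
def Q (p : ℤ × ℤ × ℤ) : Prop := (p.2.2 = 0 ∧ Q0 p.1 p.2.1) ∨ (p.2.2 = 1 ∧ Q1 p.1 p.2.1)

lemma Q1_00 (i j : ℤ) (hi : 0 ≤ i) (hj : 0 ≤ j) : Q1 (6 * i) (6 * j) ↔ A i j := by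
  constructor
  · rintro ⟨i', j', _, _, h⟩
    rcases h with ⟨h1, h2, h3⟩ | ⟨h1, h2, _⟩ | ⟨h1, h2, _⟩ | ⟨h1, h2, _⟩
    · have : i = i' := by omega
      have : j = j' := by omega
      subst_vars
      assumption
    all_goals omega
  · intro h
    exact ⟨i, j, hi, hj, Or.inl ⟨rfl, rfl, h⟩⟩

/-- Residue classes met by the second layer. -/
lemma Q1_res {x y : ℤ} (h : Q1 x y) : 0 ≤ x ∧ 0 ≤ y ∧
    ((x % 6 = 0 ∧ y % 6 = 0) ∨ (x % 6 = 1 ∧ y % 6 = 1) ∨ (x % 6 = 4 ∧ y % 6 = 5) ∨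
      (x % 6 = 5 ∧ y % 6 = 4)) := by
  obtain ⟨i, j, hi, hj, h⟩ := h
  rcases h with ⟨h1, h2, _⟩ | ⟨h1, h2, _⟩ | ⟨h1, h2, _⟩ | ⟨h1, h2, _⟩ <;> omega

lemma Q1_stable {x y a b : ℤ} (hab : (a, b, (0 : ℤ)) ∈ gammaPrime) (h : Q1 x y)
    (h' : Q1 (x - a) (y - b)) : False := by
  obtain ⟨i, j, hi, hj, h⟩ := h
  obtain ⟨i', j', hi', hj', h'⟩ := h'
  have r := A_rec i' j' hi' hj'
  simp [gammaPrime] at hab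
  rcases h with ⟨h1, h2, h3⟩ | ⟨h1, h2, h3⟩ | ⟨h1, h2, h3⟩ | ⟨h1, h2, h3⟩ <;>
  rcases h' with ⟨h4, h5, h6⟩ | ⟨h4, h5, h6⟩ | ⟨h4, h5, h6⟩ | ⟨h4, h5, h6⟩ <;>
  first
  | omega
  | (have e1 : i = i' := by omega
     have e2 : j = j' := by omega
     subst e1 e2; tauto)
  | (have e1 : i = i' + 1 := by omega
     have e2 : j = j' + 1 := by omega
     subst e1 e2; tauto)
  | (have e : (i' = i ∧ j' = j + 1) ∨ (i' = i + 1 ∧ j' = j) := by omega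
     rcases e with ⟨e1, e2⟩ | ⟨e1, e2⟩ <;> subst e1 e2 <;> tauto)

lemma Q_stable {p γ : ℤ × ℤ × ℤ} (hγ : γ ∈ gammaPrime) (h : Q p) (h' : Q (p - γ)) : False := by
  obtain ⟨x, y, z⟩ := p
  obtain ⟨a, b, c⟩ := γ
  simp only [Q, Prod.mk_sub_mk] at h h'
  rcases h with ⟨hz, h⟩ | ⟨hz, h⟩ <;> rcases h' with ⟨hc, h'⟩ | ⟨hc, h'⟩
  · have : c = 0 := by omega
    subst this
    unfold Q0 at h h'
    simp [gammaPrime] at hγ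
    omega
  · have : c = -1 := by omega
    subst this
    simp [gammaPrime] at hγ
  · have : c = 1 := by omega
    subst this
    have := Q1_res h
    unfold Q0 at h'
    simp [gammaPrime] at hγ
    omega
  · have : c = 0 := by omega
    subst this
    exact Q1_stable hγ h h'

set_option maxHeartbeats 4000000 in
lemma Q0_absorb {x y : ℤ} (hx : 0 ≤ x) (hy : 0 ≤ y) (h : ¬ Q0 x y) :
    ∃ a b : ℤ, (a, b, (0 : ℤ)) ∈ gammaPrime ∧ Q0 (x - a) (y - b) := by
  by_contra! hc
  simp only [gammaPrime, Finset.mem_insert, Finset.mem_singleton, Prod.mk.injEq] at hc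
  have c1 := hc 0 2 (by simp)
  have c2 := hc (-1) 4 (by simp)
  have c3 := hc 0 4 (by simp)
  have c4 := hc 1 1 (by simp)
  have c5 := hc 1 2 (by simp)
  have c6 := hc 1 4 (by simp)
  have c7 := hc 2 2 (by simp)
  have c8 := hc 2 4 (by simp)
  have c9 := hc 3 0 (by simp)
  have c10 := hc 3 3 (by simp)
  have c11 := hc 3 (-2) (by simp)
  have c12 := hc 2 1 (by simp)
  have c13 := hc 3 5 (by simp)
  have c14 := hc 3 1 (by simp)
  have c15 := hc 4 2 (by simp)
  have c16 := hc 5 (-2) (by simp)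
  clear hc
  have hr : 0 ≤ x % 6 ∧ x % 6 < 6 := by omega
  have hs : 0 ≤ y % 6 ∧ y % 6 < 6 := by omega
  obtain ⟨r, hr'⟩ : ∃ r, r = x % 6 := ⟨_, rfl⟩
  obtain ⟨s, hs'⟩ : ∃ s, s = y % 6 := ⟨_, rfl⟩
  rw [← hr'] at hr
  rw [← hs'] at hs
  obtain ⟨hr1, hr2⟩ := hr
  obtain ⟨hs1, hs2⟩ := hs
  interval_cases r <;> interval_cases s <;>
  first
  | exact h (by unfold Q0; omega)
  | exact c1 (by unfold Q0; omega)
  | exact c2 (by unfold Q0; omega)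
  | exact c3 (by unfold Q0; omega)
  | exact c4 (by unfold Q0; omega)
  | exact c5 (by unfold Q0; omega)
  | exact c6 (by unfold Q0; omega)
  | exact c7 (by unfold Q0; omega)
  | exact c8 (by unfold Q0; omega)
  | exact c9 (by unfold Q0; omega)
  | exact c10 (by unfold Q0; omega)
  | exact c11 (by unfold Q0; omega)
  | exact c12 (by unfold Q0; omega)
  | exact c13 (by unfold Q0; omega)
  | exact c14 (by unfold Q0; omega)
  | exact c15 (by unfold Q0; omega)
  | exact c16 (by unfold Q0; omega)

set_option maxHeartbeats 4000000 in
/-- Outside the four special residue classes there is a move to the bottom layer. -/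
lemma Q1_absorb_down {x y : ℤ} (hx : 0 ≤ x) (hy : 0 ≤ y)
    (h : ¬ ((x % 6 = 0 ∧ y % 6 = 0) ∨ (x % 6 = 1 ∧ y % 6 = 1) ∨ (x % 6 = 4 ∧ y % 6 = 5) ∨
      (x % 6 = 5 ∧ y % 6 = 4))) :
    ∃ a b : ℤ, (a, b, (1 : ℤ)) ∈ gammaPrime ∧ Q0 (x - a) (y - b) := by
  by_contra! hc
  simp only [gammaPrime, Finset.mem_insert, Finset.mem_singleton, Prod.mk.injEq] at hc
  have c1 := hc (-2) 1 (by simp)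
  have c2 := hc (-1) (-1) (by simp)
  have c3 := hc (-1) 2 (by simp)
  have c4 := hc 0 3 (by simp)
  have c5 := hc 1 (-1) (by simp)
  have c6 := hc 1 4 (by simp)
  have c7 := hc 2 0 (by simp)
  have c8 := hc 2 1 (by simp)
  have c9 := hc 3 2 (by simp)
  have c10 := hc 4 3 (by simp)
  clear hc
  have hr : 0 ≤ x % 6 ∧ x % 6 < 6 := by omega
  have hs : 0 ≤ y % 6 ∧ y % 6 < 6 := by omega
  obtain ⟨r, hr'⟩ : ∃ r, r = x % 6 := ⟨_, rfl⟩
  obtain ⟨s, hs'⟩ : ∃ s, s = y % 6 := ⟨_, rfl⟩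
  rw [← hr'] at hr h
  rw [← hs'] at hs h
  obtain ⟨hr1, hr2⟩ := hr
  obtain ⟨hs1, hs2⟩ := hs
  interval_cases r <;> interval_cases s <;>
  first
  | exact h (by omega)
  | exact c1 (by unfold Q0; omega)
  | exact c2 (by unfold Q0; omega)
  | exact c3 (by unfold Q0; omega)
  | exact c4 (by unfold Q0; omega)
  | exact c5 (by unfold Q0; omega)
  | exact c6 (by unfold Q0; omega)
  | exact c7 (by unfold Q0; omega)
  | exact c8 (by unfold Q0; omega)
  | exact c9 (by unfold Q0; omega)
  | exact c10 (by unfold Q0; omega)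

lemma Q1_absorb {x y : ℤ} (hx : 0 ≤ x) (hy : 0 ≤ y) (h : ¬ Q1 x y)
    (hr : (x % 6 = 0 ∧ y % 6 = 0) ∨ (x % 6 = 1 ∧ y % 6 = 1) ∨ (x % 6 = 4 ∧ y % 6 = 5) ∨
      (x % 6 = 5 ∧ y % 6 = 4)) :
    ∃ a b : ℤ, (a, b, (0 : ℤ)) ∈ gammaPrime ∧ Q1 (x - a) (y - b) := by
  obtain ⟨i, hi⟩ : ∃ i, i = x / 6 := ⟨_, rfl⟩
  obtain ⟨j, hj⟩ : ∃ j, j = y / 6 := ⟨_, rfl⟩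
  have hi0 : 0 ≤ i := by omega
  have hj0 : 0 ≤ j := by omega
  rcases hr with hr | hr | hr | hr
  · have e1 : x = 6 * i := by omega
    have e2 : y = 6 * j := by omega
    have hA : ¬ A i j := fun hA => h ⟨i, j, hi0, hj0, Or.inl ⟨e1, e2, hA⟩⟩
    have hi1 : 1 ≤ i := by
      by_contra hlt
      have : i = 0 := by omega
      subst this
      exact hA (A_col j hj0)
    have hj1 : 1 ≤ j := by
      by_contra hlt
      have : j = 0 := by omega
      subst this
      exact hA (A_row i hi0)
    obtain ⟨i', rfl⟩ : ∃ i', i = i' + 1 := ⟨i - 1, by omega⟩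
    obtain ⟨j', rfl⟩ : ∃ j', j = j' + 1 := ⟨j - 1, by omega⟩
    have r := A_rec i' j' (by omega) (by omega)
    by_cases hB : A i' (j' + 1)
    · refine ⟨2, 1, by simp [gammaPrime], i', j', by omega, by omega, ?_⟩
      refine Or.inr (Or.inr (Or.inl ⟨by omega, by omega, by tauto, hB⟩))
    · refine ⟨1, 2, by simp [gammaPrime], i', j', by omega, by omega, ?_⟩
      refine Or.inr (Or.inr (Or.inr ⟨by omega, by omega, by tauto, hB⟩))
  · have e1 : x = 6 * i + 1 := by omega
    have e2 : y = 6 * j + 1 := by omega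
    have hA : A i j := by
      by_contra hA
      exact h ⟨i, j, hi0, hj0, Or.inr (Or.inl ⟨e1, e2, hA⟩)⟩
    exact ⟨1, 1, by simp [gammaPrime], i, j, hi0, hj0, Or.inl ⟨by omega, by omega, hA⟩⟩
  · have e1 : x = 6 * i + 4 := by omega
    have e2 : y = 6 * j + 5 := by omega
    by_cases hB : A i (j + 1)
    · have hA : ¬ A (i + 1) j := fun hA =>
        h ⟨i, j, hi0, hj0, Or.inr (Or.inr (Or.inl ⟨e1, e2, hA, hB⟩))⟩
      exact ⟨-3, 4, by simp [gammaPrime], i + 1, j, by omega, hj0,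
        Or.inr (Or.inl ⟨by omega, by omega, hA⟩)⟩
    · exact ⟨3, -2, by simp [gammaPrime], i, j + 1, by omega, by omega,
        Or.inr (Or.inl ⟨by omega, by omega, hB⟩)⟩
  · have e1 : x = 6 * i + 5 := by omega
    have e2 : y = 6 * j + 4 := by omega
    by_cases hB : A i (j + 1)
    · exact ⟨5, -2, by simp [gammaPrime], i, j + 1, by omega, by omega,
        Or.inl ⟨by omega, by omega, hB⟩⟩
    · have hA : A (i + 1) j := by
        by_contra hA
        exact h ⟨i, j, hi0, hj0, Or.inr (Or.inr (Or.inr ⟨e1, e2, hA, hB⟩))⟩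
      exact ⟨-1, 4, by simp [gammaPrime], i + 1, j, by omega, hj0,
        Or.inl ⟨by omega, by omega, hA⟩⟩

lemma Q_absorb {p : ℤ × ℤ × ℤ} (hp : p ∈ board3) (hz : p.2.2 ≤ 1) (h : ¬ Q p) :
    ∃ γ ∈ gammaPrime, Q (p - γ) := by
  obtain ⟨x, y, z⟩ := p
  obtain ⟨hx, hy, hz0⟩ := hp
  simp only at hx hy hz hz0
  have : z = 0 ∨ z = 1 := by omega
  rcases this with rfl | rfl
  · have h0 : ¬ Q0 x y := fun h0 => h (Or.inl ⟨rfl, h0⟩)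
    obtain ⟨a, b, hab, hq⟩ := Q0_absorb hx hy h0
    exact ⟨(a, b, 0), hab, Or.inl ⟨by simp, hq⟩⟩
  · have h1 : ¬ Q1 x y := fun h1 => h (Or.inr ⟨rfl, h1⟩)
    by_cases hr : ((x % 6 = 0 ∧ y % 6 = 0) ∨ (x % 6 = 1 ∧ y % 6 = 1) ∨
      (x % 6 = 4 ∧ y % 6 = 5) ∨ (x % 6 = 5 ∧ y % 6 = 4))
    · obtain ⟨a, b, hab, hq⟩ := Q1_absorb hx hy h1 hr
      exact ⟨(a, b, 0), hab, Or.inr ⟨by simp, hq⟩⟩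
    · obtain ⟨a, b, hab, hq⟩ := Q1_absorb_down hx hy hr
      exact ⟨(a, b, 1), hab, Or.inl ⟨by simp, hq⟩⟩

lemma Q_board {p : ℤ × ℤ × ℤ} (h : Q p) : p ∈ board3 := by
  rcases h with ⟨hz, h⟩ | ⟨hz, h⟩
  · exact ⟨h.1, h.2.1, by omega⟩
  · have := Q1_res h
    exact ⟨this.1, this.2.1, by omega⟩

lemma gamma_pos : ∀ γ ∈ gammaPrime, 0 ≤ γ.2.2 ∧ 0 < 3 * γ.1 + 4 * γ.2.1 + 8 * γ.2.2 := by
  decide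

/-- The two bottom layers of the P-positions are described by `Q`. -/
lemma mem_P_iff {P : Set (ℤ × ℤ × ℤ)} (hP : PPosProperty gammaPrime P) (n : ℕ) :
    ∀ p ∈ board3, p.2.2 ≤ 1 → 3 * p.1 + 4 * p.2.1 + 8 * p.2.2 < n → (p ∈ P ↔ Q p) := by
  induction n with
  | zero =>
    rintro p ⟨hx, hy, hz⟩ _ h
    push_cast at h
    omega
  | succ n ih =>
    intro p hp hz hn
    push_cast at hn
    have key : ∀ γ ∈ gammaPrime, p - γ ∈ board3 → (p - γ ∈ P ↔ Q (p - γ)) := by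
      intro γ hγ hb
      obtain ⟨g1, g2⟩ := gamma_pos γ hγ
      apply ih _ hb
      · simp only [Prod.snd_sub]; omega
      · simp only [Prod.snd_sub, Prod.fst_sub]; omega
    rw [hP.2 p hp]
    constructor
    · intro h
      by_contra hq
      obtain ⟨γ, hγ, hq'⟩ := Q_absorb hp hz hq
      have hb := Q_board hq'
      exact h γ hγ hb ((key γ hγ hb).2 hq')
    · intro hq γ hγ hb hm
      exact Q_stable hγ hq ((key γ hγ hb).1 hm)

lemma layer_one {P : Set (ℤ × ℤ × ℤ)} (hP : PPosProperty gammaPrime P) (i j : ℤ)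
    (hi : 0 ≤ i) (hj : 0 ≤ j) : (6 * i, 6 * j, (1 : ℤ)) ∈ P ↔ A i j := by
  rw [mem_P_iff hP (18 * i + 24 * j + 9).toNat _ ⟨by simpa using hi, by simpa using hj, by simp⟩
    (by simp) (by simp only; omega), ← Q1_00 i j hi hj]
  simp [Q]

/-- Vanishing of binomial coefficients mod 2 just after row `2 ^ m`. -/
lemma choose_even (m r i : ℕ) (h1 : r < i) (h2 : i < 2 ^ m) : 2 ∣ (2 ^ m + r).choose i := by
  induction r generalizing i with
  | zero => exact Nat.prime_two.dvd_choose_pow (by omega) (by omega)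
  | succ r ih =>
    obtain ⟨i, rfl⟩ : ∃ i', i = i' + 1 := ⟨i - 1, by omega⟩
    rw [← add_assoc, Nat.choose_succ_succ]
    exact dvd_add (ih i (by omega) (by omega)) (ih (i + 1) (by omega) h2)

lemma choose_odd (m i : ℕ) (h : i < 2 ^ m) : (2 ^ m - 1).choose i % 2 = 1 := by
  induction i with
  | zero => simp
  | succ i ih =>
    have := ih (by omega)
    have e := choose_even m 0 (i + 1) (by omega) h
    obtain ⟨N, hN⟩ : ∃ N, 2 ^ m = N + 1 := ⟨2 ^ m - 1, by omega⟩
    rw [hN, add_zero, Nat.choose_succ_succ] at e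
    rw [hN] at this ⊢
    simp only [Nat.add_sub_cancel] at this ⊢
    simp only [Nat.succ_eq_add_one] at e
    omega

lemma A_tip (k : ℕ) : A (2 ^ k) (2 ^ k - 1) := by
  have hp : 0 < 2 ^ k := by positivity
  have h1 : ((2 : ℤ) ^ k).toNat = 2 ^ k := by
    have : ((2 : ℤ) ^ k) = ((2 ^ k : ℕ) : ℤ) := by push_cast; rfl
    rw [this, Int.toNat_natCast]
  have h2 : ((2 : ℤ) ^ k - 1).toNat = 2 ^ k - 1 := by omega
  have hp' : (0 : ℤ) < 2 ^ k := by positivity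
  refine ⟨by omega, by omega, ?_⟩
  rw [h1, h2]
  have := choose_odd (k + 1) (2 ^ k) (by rw [pow_succ]; omega)
  rwa [show 2 ^ k + (2 ^ k - 1) = 2 ^ (k + 1) - 1 by rw [pow_succ]; omega]

lemma not_A_tip_add (k : ℕ) (a b : ℤ) (ha : 0 ≤ a) (hb : 0 ≤ b) (hab : 0 < a + b)
    (ha' : a < 2 ^ k) (hb' : b < 2 ^ k) : ¬ A (2 ^ k + a) (2 ^ k - 1 + b) := by
  rintro ⟨_, _, h⟩
  lift a to ℕ using ha
  lift b to ℕ using hb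
  have hp : 0 < 2 ^ k := by positivity
  have h0 : ((2 : ℤ) ^ k) = ((2 ^ k : ℕ) : ℤ) := by push_cast; rfl
  rw [h0] at ha' hb' h
  have h1 : (((2 ^ k : ℕ) : ℤ) + a).toNat = 2 ^ k + a := by omega
  have h2 : (((2 ^ k : ℕ) : ℤ) - 1 + b).toNat = 2 ^ k - 1 + b := by omega
  rw [h1, h2] at h
  have := choose_even (k + 1) (a + b - 1) (2 ^ k + a) (by omega) (by rw [pow_succ]; omega)
  rw [show 2 ^ (k + 1) + (a + b - 1) = 2 ^ k + a + (2 ^ k - 1 + b) by rw [pow_succ]; omega] at this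
  omega

/-- Translates that stay in the board only have nonnegative directions. -/
lemma nonneg_of_mem {P : Set (ℤ × ℤ × ℤ)} (hP : PPosProperty gammaPrime P) (w : ℤ × ℤ × ℤ)
    (L : AddSubmonoid (ℤ × ℤ × ℤ)) (h : ∀ l ∈ L, w + l ∈ P) (l : ℤ × ℤ × ℤ) (hl : l ∈ L) :
    0 ≤ l.1 ∧ 0 ≤ l.2.1 ∧ 0 ≤ l.2.2 := by
  have aux : ∀ u v : ℤ, (∀ n : ℕ, 0 ≤ u + n * v) → 0 ≤ v := by
    intro u v huv
    by_contra! hv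
    have h1 := huv (u.natAbs + 1)
    push_cast at h1
    have h2 : u ≤ |u| := le_abs_self u
    have h3 : 0 ≤ |u| := abs_nonneg u
    nlinarith
  have hb : ∀ n : ℕ, w + n • l ∈ board3 := fun n => hP.1 (h _ (L.nsmul_mem hl n))
  refine ⟨aux w.1 _ fun n => ?_, aux w.2.1 _ fun n => ?_, aux w.2.2 _ fun n => ?_⟩
  · simpa using (hb n).1
  · simpa using (hb n).2.1
  · simpa using (hb n).2.2

/-- A finitely generated monoid without horizontal directions has bounded slope. -/
lemma bound_of_fg (L : AddSubmonoid (ℤ × ℤ × ℤ)) (hfg : L.FG)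
    (hn : ∀ l ∈ L, 0 ≤ l.1 ∧ 0 ≤ l.2.1 ∧ 0 ≤ l.2.2)
    (hc : ∀ h ∈ L, h.2.2 = 0 → h = 0) : ∃ B : ℤ, ∀ l ∈ L, l.1 ≤ B * l.2.2 := by
  obtain ⟨S, hS⟩ := hfg
  obtain ⟨B, hB⟩ := (S.image (fun g => g.1)).bddAbove
  refine ⟨B, fun l hl => ?_⟩
  rw [← hS] at hl
  induction hl using AddSubmonoid.closure_induction with
  | mem x hx =>
    have hxL : x ∈ L := hS ▸ AddSubmonoid.subset_closure hx
    have h1 : x.1 ≤ B := hB (by simpa using ⟨x.2.1, x.2.2, hx⟩)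
    obtain ⟨h2, _, h3⟩ := hn x hxL
    by_cases h0 : x.2.2 = 0
    · rw [hc x hxL h0]; simp
    · have : 1 ≤ x.2.2 := by omega
      nlinarith
  | zero => simp
  | add x y _ _ hx hy =>
    simp only [Prod.fst_add, Prod.snd_add]
    linarith

end GammaPrimeProof

theorem gammaPrime_no_affine_stratification
    (P : Set (ℤ × ℤ × ℤ)) (hP : PPosProperty gammaPrime P) :
    ¬ HasAffineStratification P := by
  rintro ⟨K, w, Λ, hfg, hPU⟩
  have hmem : ∀ t, ∀ l ∈ Λ t, w t + l ∈ P := by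
    intro t l hl
    rw [hPU]
    exact Set.mem_iUnion.2 ⟨t, l, hl, rfl⟩
  -- the tips of the Sierpinski triangles
  have htip : ∀ k : ℕ, ∃ t, ∃ l ∈ Λ t,
      w t + l = (6 * 2 ^ k, 6 * (2 ^ k - 1), (1 : ℤ)) := by
    intro k
    have hp' : (0 : ℤ) < 2 ^ k := by positivity
    have h := (GammaPrimeProof.layer_one hP (2 ^ k) (2 ^ k - 1) (by omega) (by omega)).2
      (GammaPrimeProof.A_tip k)
    rw [hPU] at h
    obtain ⟨t, l, hl, e⟩ := Set.mem_iUnion.1 h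
    exact ⟨t, l, hl, e⟩
  choose f l hl he using htip
  obtain ⟨t, ht⟩ := Finite.exists_infinite_fiber f
  have hinf : (Set.preimage f {t}).Infinite := Set.infinite_coe_iff.1 ht
  have hnonneg := fun x hx => GammaPrimeProof.nonneg_of_mem hP (w t) (Λ t) (hmem t) x hx
  -- there is a nonzero horizontal direction in the monoid
  obtain ⟨h, hh, hz, hne⟩ : ∃ h ∈ Λ t, h.2.2 = 0 ∧ h ≠ 0 := by
    by_contra! hc
    obtain ⟨B, hB⟩ := GammaPrimeProof.bound_of_fg (Λ t) (hfg t) hnonneg hc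
    obtain ⟨k, hk, hlt⟩ := hinf.exists_gt (B * (1 - (w t).2.2) + (w t).1).toNat
    have hk' : f k = t := hk
    have hb := hB (l k) (hk' ▸ hl k)
    have e := he k
    rw [hk'] at e
    have e1 := congrArg (fun q => q.1) e
    have e3 := congrArg (fun q => q.2.2) e
    simp only [Prod.fst_add, Prod.snd_add] at e1 e3
    have e3' : (l k).2.2 = 1 - (w t).2.2 := by omega
    rw [e3'] at hb
    have h2 : (k : ℤ) < 2 ^ k := by exact_mod_cast Nat.lt_two_pow_self
    omega
  obtain ⟨hx, hy, -⟩ := hnonneg h hh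
  obtain ⟨k, hk, hlt⟩ := hinf.exists_gt (h.1 + h.2.1).toNat
  have hk' : f k = t := hk
  have h2 : (k : ℤ) < 2 ^ k := by exact_mod_cast Nat.lt_two_pow_self
  have hpos : 0 < h.1 + h.2.1 := by
    by_contra hle
    apply hne
    ext <;> simp <;> omega
  have hm := hmem t (l k + 6 • h) ((Λ t).add_mem (hk' ▸ hl k) ((Λ t).nsmul_mem hh 6))
  have e := he k
  rw [hk'] at e
  rw [← add_assoc, e] at hm
  have e' : ((6 * 2 ^ k, 6 * (2 ^ k - 1), (1 : ℤ)) : ℤ × ℤ × ℤ) + 6 • h =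
      (6 * (2 ^ k + h.1), 6 * (2 ^ k - 1 + h.2.1), (1 : ℤ)) := by
    ext <;> simp [hz] <;> ring
  rw [e', GammaPrimeProof.layer_one hP _ _ (by omega) (by omega)] at hm
  exact GammaPrimeProof.not_A_tip_add k h.1 h.2.1 hx hy hpos (by omega) (by omega) hm
end
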